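/- Let d ≥ 3 and let W be a random vector in ℝ^d with E W = 0. Suppose W' is a random vector on the same probability space such that (W, W') is exchangeable and E(W' − W | W) = −Λ(W + R) for some invertible d×d matrix Λ and some random vector R. Let D = W' − W and suppose E‖D‖_∞⁴ < ∞. Let Σ be a d×d positive definite matrix with σ̄² = max_j Σ_{jj}, σ̲² = min_j Σ_{jj}, smallest eigenvalue σ_*² > 0, and Z ~ N(0,Σ). Define Δ₁ := E[max_{j,k} |Σ_{jk} − ½ E[(Λ⁻¹D)_j D_k | W]|], Δ₂ := E[max_{j,k,l,m} E[|(Λ⁻¹D)_j D_k D_l D_m| | W]], and Δ₃(η) := E[max_{j,k,l,m} |(Λ⁻¹D)_j D_k D_l D_m| · 1{‖D‖_∞ > η}]. Then there is an absolute constant C > 0 such that for any η ≥ 0 and t > 0 with η/√t ≤ σ_*/√(log d): sup_{A∈𝓡} |P(W ∈ A) − P(Z ∈ A)| ≤ C { (1/σ_*) E[max_j |R_j|] √(log d) + (1/σ_*²) Δ₁ (|log t| ∨ 1) log d + (1/σ_*⁴)(Δ₂ + Δ₃(η)) (log d)²/t + (σ̄/σ̲) √t log d }. -/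

import Mathlib

open MeasureTheory ProbabilityTheory Real Matrix

noncomputable section

/-- Density of the centered Gaussian distribution `N(0, S)` on `ℝ^d`. -/
def gaussianPdf (d : ℕ) (S : Matrix (Fin d) (Fin d) ℝ) (x : Fin d → ℝ) : ℝ :=
  (2 * π) ^ (-(d : ℝ) / 2) * S.det ^ (-(1 : ℝ) / 2) *
    Real.exp (-(1 / 2) * (x ⬝ᵥ S⁻¹.mulVec x))

/-- The centered Gaussian distribution `N(0, S)` on `ℝ^d` (for positive definite `S`). -/
def gaussianMeasure (d : ℕ) (S : Matrix (Fin d) (Fin d) ℝ) : Measure (Fin d → ℝ) :=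
  volume.withDensity fun x => ENNReal.ofReal (gaussianPdf d S x)

/-- `A` is a hyperrectangle `∏ (a_j, b_j)` with `-∞ ≤ a_j ≤ b_j ≤ ∞`. -/
def IsHyperrectangle {d : ℕ} (A : Set (Fin d → ℝ)) : Prop :=
  ∃ a b : Fin d → EReal, A = {x | ∀ j, a j < (x j : EReal) ∧ (x j : EReal) < b j}

/-- `s ^ 2` is the smallest eigenvalue of `S`. -/
def IsSmallestEigenvalueSq {d : ℕ} (S : Matrix (Fin d) (Fin d) ℝ) (s : ℝ) : Prop :=
  IsLeast {r : ℝ | ∃ x : Fin d → ℝ, x ≠ 0 ∧ S.mulVec x = r • x} (s ^ 2)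


/-- standard normal density -/
def nphi (u : ℝ) : ℝ := (√(2 * π))⁻¹ * Real.exp (-(u ^ 2) / 2)

/-- standard normal distribution function -/
def nPhi (u : ℝ) : ℝ := ∫ x in Set.Iic u, nphi x

lemma nphi_eq : nphi = gaussianPDFReal 0 1 := by
  funext u; simp [nphi, gaussianPDFReal]

lemma nphi_pos (u : ℝ) : 0 < nphi u := by unfold nphi; positivity

lemma nphi_continuous : Continuous nphi := by unfold nphi; fun_prop

lemma nphi_integrable : Integrable nphi := by
  rw [nphi_eq]; exact integrable_gaussianPDFReal 0 1

lemma nphi_neg (u : ℝ) : nphi (-u) = nphi u := by simp [nphi]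

lemma nphi_integral : ∫ x, nphi x = 1 := by
  rw [nphi_eq]; exact integral_gaussianPDFReal_eq_one 0 one_ne_zero

lemma nPhi_sub (a b : ℝ) : nPhi b - nPhi a = ∫ x in a..b, nphi x := by
  unfold nPhi
  exact intervalIntegral.integral_Iic_sub_Iic nphi_integrable.integrableOn nphi_integrable.integrableOn

lemma nPhi_hasDerivAt (u : ℝ) : HasDerivAt nPhi (nphi u) u := by
  have h : nPhi = fun x => nPhi 0 + ∫ y in (0:ℝ)..x, nphi y := by
    funext x; rw [← nPhi_sub]; ring
  rw [h]
  exact (intervalIntegral.integral_hasDerivAt_right nphi_integrable.intervalIntegrable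
    nphi_continuous.stronglyMeasurable.stronglyMeasurableAtFilter
    nphi_continuous.continuousAt).const_add _

lemma nPhi_mono : Monotone nPhi := by
  intro a b hab
  have h := nPhi_sub a b
  have : 0 ≤ ∫ x in a..b, nphi x :=
    intervalIntegral.integral_nonneg hab fun x _ => (nphi_pos x).le
  linarith

lemma nPhi_nonneg (u : ℝ) : 0 ≤ nPhi u :=
  integral_nonneg fun x => (nphi_pos x).le

lemma nPhi_neg (u : ℝ) : nPhi (-u) = 1 - nPhi u := by
  have h1 : nPhi (-u) = ∫ x in Set.Ioi u, nphi x := by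
    unfold nPhi
    rw [← integral_comp_neg_Ioi]
    simp [nphi_neg]
  have h2 : nPhi u + ∫ x in Set.Ioi u, nphi x = 1 := by
    rw [← nphi_integral]
    exact intervalIntegral.integral_Iic_add_Ioi nphi_integrable.integrableOn
      nphi_integrable.integrableOn
  linarith

lemma nPhi_le_one (u : ℝ) : nPhi u ≤ 1 := by
  have := nPhi_nonneg (-u); rw [nPhi_neg] at this; linarith

lemma nPhi_continuous : Continuous nPhi :=
  continuous_iff_continuousAt.2 fun u => (nPhi_hasDerivAt u).continuousAt

lemma gaussian_Ioo (a b : ℝ) (hab : a ≤ b) :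
    gaussianReal 0 1 (Set.Ioo a b) = ENNReal.ofReal (nPhi b - nPhi a) := by
  rw [gaussianReal_apply_eq_integral 0 one_ne_zero, nPhi_sub, intervalIntegral.integral_of_le hab,
    integral_Ioc_eq_integral_Ioo, nphi_eq]

/-- lower tail bound -/
lemma nphi_le_tail (L u ε : ℝ) (hL : 1 ≤ L) (hu : |u| ≤ 2 * L) (hε0 : 0 ≤ ε) (hε : ε ≤ 4 / L) :
    nphi u ≤ Real.exp 23 * L * (1 - nPhi (u + ε)) := by
  have hL0 : 0 < L := by linarith
  have h1 : nPhi (u + ε + 1 / L) - nPhi (u + ε) ≤ 1 - nPhi (u + ε) := by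
    linarith [nPhi_le_one (u + ε + 1 / L)]
  have hab : u + ε ≤ u + ε + 1 / L := by have : 0 < 1 / L := by positivity
                                         linarith
  have h2 : (1 / L) * (nphi u * Real.exp (-23)) ≤ nPhi (u + ε + 1 / L) - nPhi (u + ε) := by
    rw [nPhi_sub]
    have h3 : ∫ x in (u + ε)..(u + ε + 1 / L), (nphi u * Real.exp (-23)) =
        (1 / L) * (nphi u * Real.exp (-23)) := by
      rw [intervalIntegral.integral_const]; simp
    rw [← h3]
    apply intervalIntegral.integral_mono_on hab (by simp) nphi_integrable.intervalIntegrable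
    intro v hv
    unfold nphi
    rw [mul_assoc, ← Real.exp_add]
    apply mul_le_mul_of_nonneg_left _ (by positivity)
    apply Real.exp_le_exp.2
    obtain ⟨e, rfl⟩ : ∃ e, v = u + e := ⟨v - u, by ring⟩
    have he0 : 0 ≤ e := by linarith [hv.1]
    have he1 : e ≤ 5 / L := by
      have := hv.2
      have h5 : 5 / L = 4 / L + 1 / L := by ring
      linarith
    have hue : |u| * e ≤ 10 := by
      calc |u| * e ≤ (2 * L) * (5 / L) := mul_le_mul hu he1 he0 (by positivity)
        _ = 10 := by field_simp; norm_num
    have hue' : u * e ≤ 10 := le_trans (mul_le_mul_of_nonneg_right (le_abs_self u) he0) hue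
    have he5 : e ≤ 5 := he1.trans (by rw [div_le_iff₀ hL0]; linarith)
    nlinarith
  have h4 : (1 / L) * (nphi u * Real.exp (-23)) ≤ 1 - nPhi (u + ε) := h2.trans h1
  calc nphi u = Real.exp 23 * L * ((1 / L) * (nphi u * Real.exp (-23))) := by
        rw [Real.exp_neg]; field_simp
    _ ≤ _ := by gcongr

/-- derivatives of `nPhi` up to order four -/
def nder : ℕ → ℝ → ℝ
  | 0, u => nPhi u
  | 1, u => nphi u
  | 2, u => -u * nphi u
  | 3, u => (u ^ 2 - 1) * nphi u
  | 4, u => (3 * u - u ^ 3) * nphi u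
  | _, _ => 0

lemma nphi_hasDerivAt (u : ℝ) : HasDerivAt nphi (-u * nphi u) u := by
  unfold nphi
  have h : HasDerivAt (fun u : ℝ => -(u ^ 2) / 2) (-u) u := by
    have := ((hasDerivAt_pow 2 u).neg).div_const 2
    refine this.congr_deriv ?_
    norm_num
    ring
  refine (h.exp.const_mul (√(2 * π))⁻¹).congr_deriv ?_
  ring

lemma nder_hasDerivAt (m : ℕ) (hm : m ≤ 3) (u : ℝ) :
    HasDerivAt (nder m) (nder (m + 1) u) u := by
  have hp := nphi_hasDerivAt u
  interval_cases m
  · exact nPhi_hasDerivAt u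
  · exact hp
  · have := ((hasDerivAt_id u).neg).mul hp
    refine (this.congr_deriv ?_)
    simp [nder]; ring
  · have := (((hasDerivAt_pow 2 u)).sub_const 1).mul hp
    refine (this.congr_deriv ?_)
    simp [nder]; ring

lemma nder_continuous (m : ℕ) : Continuous (nder m) := by
  have := nphi_continuous
  rcases m with _ | _ | _ | _ | _ | m
  · exact nPhi_continuous
  · exact this
  all_goals (unfold nder; fun_prop)

lemma nder_neg_abs (m : ℕ) (hm : 1 ≤ m) (u : ℝ) : |nder m (-u)| = |nder m u| := by
  rcases m with _ | _ | _ | _ | _ | m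
  · omega
  · simp [nder, nphi_neg]
  · simp [nder, nphi_neg, abs_mul]
  · simp [nder, nphi_neg, abs_mul]
  · simp only [nder, nphi_neg, abs_mul]
    congr 1
    rw [← abs_neg]; congr 1; ring
  · simp [nder]

lemma nder_poly (m : ℕ) (hm : 1 ≤ m) (u : ℝ) :
    |nder m u| ≤ 4 * (1 + |u|) ^ (m - 1) * nphi u := by
  have h0 := (nphi_pos u)
  have ha := abs_nonneg u
  rcases m with _ | _ | _ | _ | _ | m
  · omega
  · simp [nder, abs_of_pos h0]; linarith
  · simp [nder, abs_mul, abs_of_pos h0]; nlinarith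
  · simp only [nder, abs_mul, abs_of_pos h0]
    gcongr
    have : |u ^ 2 - 1| ≤ |u| ^ 2 + 1 := by
      rw [sq_abs]; rw [abs_le]; constructor <;> nlinarith [sq_nonneg u]
    norm_num
    nlinarith
  · simp only [nder, abs_mul, abs_of_pos h0]
    gcongr
    have : |3 * u - u ^ 3| ≤ 3 * |u| + |u| ^ 3 := by
      refine (abs_sub _ _).trans ?_
      rw [abs_mul, abs_pow]; norm_num
    norm_num
    nlinarith [pow_nonneg ha 3, pow_nonneg ha 2]
  · simp [nder]; positivity

lemma exp_quart_bound (x : ℝ) (hx : 0 ≤ x) : (1 + x) ^ 3 ≤ 1000 * Real.exp (x ^ 2 / 4) := by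
  have h := Real.add_one_le_exp (x ^ 2 / 4)
  have h1 : (x ^ 2 / 4) ^ 2 / 2 ≤ Real.exp (x ^ 2 / 4) := by
    have := Real.quadratic_le_exp_of_nonneg (show 0 ≤ x ^ 2 / 4 by positivity)
    have : 0 ≤ x ^ 2 / 4 := by positivity
    linarith
  nlinarith [sq_nonneg (x ^ 2 - 8), sq_nonneg (x - 1), sq_nonneg (x * (x - 4)), sq_nonneg x, sq_nonneg (x^2 - 4 * x)]

lemma nphi_le_exp (u : ℝ) : nphi u ≤ Real.exp (-(u ^ 2) / 2) := by
  unfold nphi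
  have : (√(2 * π))⁻¹ ≤ 1 := by
    apply inv_le_one_of_one_le₀
    rw [Real.one_le_sqrt]
    linarith [Real.pi_gt_three]
  have h := Real.exp_pos (-(u ^ 2) / 2)
  nlinarith

/-- The constant in the one-dimensional bound. -/
def K1 : ℝ := 4000 * Real.exp 23

lemma K1_ge : 1 ≤ K1 := by
  unfold K1
  have := Real.one_le_exp (show (0:ℝ) ≤ 23 by norm_num)
  linarith

lemma nder_bound (d : ℕ) (hd : 3 ≤ d) (L : ℝ) (hL1 : 1 ≤ L) (hL : L ^ 2 = Real.log d)
    (m : ℕ) (hm : 1 ≤ m) (hm4 : m ≤ 4) (u ε : ℝ) (hε0 : 0 ≤ ε) (hε : ε ≤ 4 / L) :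
    |nder m u| ≤ K1 * L ^ m * ((1 - nPhi (u + ε)) + 1 / d) := by
  have hd0 : (0:ℝ) < d := by positivity
  have hL0 : 0 < L := by linarith
  have hP : 0 ≤ 1 - nPhi (u + ε) := by linarith [nPhi_le_one (u + ε)]
  have hLm : 1 ≤ L ^ m := one_le_pow₀ hL1
  have he : (1:ℝ) ≤ Real.exp 23 := Real.one_le_exp (by norm_num)
  refine (nder_poly m hm u).trans ?_
  by_cases hu : |u| ≤ 2 * L
  · have h1 := nphi_le_tail L u ε hL1 hu hε0 hε
    have h2 : (1 + |u|) ^ (m - 1) ≤ 27 * L ^ (m - 1) := by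
      calc (1 + |u|) ^ (m - 1) ≤ (3 * L) ^ (m - 1) := by gcongr; linarith
        _ = 3 ^ (m - 1) * L ^ (m - 1) := by rw [mul_pow]
        _ ≤ 3 ^ 3 * L ^ (m - 1) := by gcongr; norm_num; omega
        _ = _ := by norm_num
    calc 4 * (1 + |u|) ^ (m - 1) * nphi u
        ≤ 4 * (27 * L ^ (m - 1)) * (Real.exp 23 * L * (1 - nPhi (u + ε))) := by
          have := (nphi_pos u).le
          gcongr
      _ = 108 * Real.exp 23 * (L ^ (m - 1) * L) * (1 - nPhi (u + ε)) := by ring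
      _ = 108 * Real.exp 23 * L ^ m * (1 - nPhi (u + ε)) := by
          rw [← pow_succ, Nat.sub_add_cancel hm]
      _ ≤ K1 * L ^ m * ((1 - nPhi (u + ε)) + 1 / d) := by
          have : 0 ≤ 1 / (d:ℝ) := by positivity
          unfold K1
          gcongr
          · norm_num
          · linarith
  · push Not at hu
    have h2 : (1 + |u|) ^ (m - 1) ≤ (1 + |u|) ^ 3 :=
      pow_le_pow_right₀ (by linarith [abs_nonneg u]) (by omega)
    have h3 := exp_quart_bound |u| (abs_nonneg u)
    rw [sq_abs] at h3
    have h4 := nphi_le_exp u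
    have h5 : Real.exp (-(u ^ 2) / 4) ≤ 1 / d := by
      rw [one_div, ← Real.exp_log hd0, ← Real.exp_neg]
      apply Real.exp_le_exp.2
      rw [← hL]
      have : (2 * L) ^ 2 ≤ |u| ^ 2 := by gcongr
      rw [sq_abs] at this
      nlinarith
    calc 4 * (1 + |u|) ^ (m - 1) * nphi u
        ≤ 4 * (1000 * Real.exp (u ^ 2 / 4)) * Real.exp (-(u ^ 2) / 2) := by
          have := (nphi_pos u).le
          have := h2.trans h3
          gcongr
      _ = 4000 * Real.exp (-(u ^ 2) / 4) := by
          rw [mul_assoc, mul_assoc, ← Real.exp_add]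
          ring_nf
      _ ≤ 4000 * (1 / d) := by gcongr
      _ ≤ K1 * L ^ m * ((1 - nPhi (u + ε)) + 1 / d) := by
          have : (4000:ℝ) ≤ K1 * L ^ m := by
            unfold K1
            nlinarith
          have h6 : 0 ≤ 1 / (d:ℝ) := by positivity
          have : (0:ℝ) ≤ K1 * L ^ m := by linarith
          calc 4000 * (1 / (d:ℝ)) ≤ K1 * L ^ m * (1 / d) := by gcongr
            _ ≤ _ := by gcongr; linarith

lemma nder_bound_left (d : ℕ) (hd : 3 ≤ d) (L : ℝ) (hL1 : 1 ≤ L) (hL : L ^ 2 = Real.log d)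
    (m : ℕ) (hm : 1 ≤ m) (hm4 : m ≤ 4) (u ε : ℝ) (hε0 : 0 ≤ ε) (hε : ε ≤ 4 / L) :
    |nder m u| ≤ K1 * L ^ m * (nPhi (u - ε) + 1 / d) := by
  have := nder_bound d hd L hL1 hL m hm hm4 (-u) ε hε0 hε
  rw [nder_neg_abs m hm, show -u + ε = -(u - ε) by ring, nPhi_neg] at this
  convert this using 3
  ring


/-- product function with multi-index of derivatives -/
def Gp {d : ℕ} (F : Fin d → ℕ → ℝ → ℝ) (n : Fin d → ℕ) (y : Fin d → ℝ) : ℝ :=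
  ∏ i, F i (n i) (y i)

/-- unit multi-index -/
def ee {d : ℕ} (k : Fin d) : Fin d → ℕ := Pi.single k 1

lemma Gp_split {d : ℕ} (F : Fin d → ℕ → ℝ → ℝ) (n : Fin d → ℕ) (y : Fin d → ℝ) (k : Fin d) :
    Gp F (n + ee k) y = (∏ j ∈ Finset.univ.erase k, F j (n j) (y j)) * F k (n k + 1) (y k) := by
  unfold Gp
  rw [← Finset.mul_prod_erase Finset.univ _ (Finset.mem_univ k), mul_comm]
  congr 1
  · apply Finset.prod_congr rfl
    intro j hj
    have : j ≠ k := Finset.ne_of_mem_erase hj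
    simp [ee, this]
  · simp [ee]

lemma Gp_hasDerivAt {d : ℕ} (F : Fin d → ℕ → ℝ → ℝ) (n : Fin d → ℕ) (y v : Fin d → ℝ) (u : ℝ)
    (h : ∀ i z, HasDerivAt (F i (n i)) (F i (n i + 1) z) z) :
    HasDerivAt (fun u : ℝ => Gp F n (fun i => y i + u * v i))
      (∑ k, v k * Gp F (n + ee k) (fun i => y i + u * v i)) u := by
  have h1 : ∀ i ∈ Finset.univ, HasDerivAt (fun u : ℝ => F i (n i) (y i + u * v i))
      (F i (n i + 1) (y i + u * v i) * v i) u := by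
    intro i _
    have h2 : HasDerivAt (fun u : ℝ => y i + u * v i) (v i) u := by
      have := ((hasDerivAt_id u).mul_const (v i)).const_add (y i)
      simpa using this
    exact (h i _).comp u h2
  have h3 := HasDerivAt.fun_finsetProd h1
  unfold Gp at *
  refine h3.congr_deriv ?_
  apply Finset.sum_congr rfl
  intro k _
  have := Gp_split F n (fun i => y i + u * v i) k
  unfold Gp at this
  rw [this, smul_eq_mul]
  ring

/-- majorant -/
def Mj {d : ℕ} (K B : ℝ) (p q : Fin d → ℝ) (n : Fin d → ℕ) : ℝ :=
  ∏ i, if n i = 0 then p i else K * B ^ (n i) * q i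

lemma Mj_eq {d : ℕ} (K B : ℝ) (p q : Fin d → ℝ) (n : Fin d → ℕ) :
    Mj K B p q n = K ^ (Finset.univ.filter fun i => n i ≠ 0).card * B ^ (∑ i, n i) *
      ((∏ i ∈ (Finset.univ.filter fun i => n i ≠ 0), q i) *
        ∏ i ∈ Finset.univ \ (Finset.univ.filter fun i => n i ≠ 0), p i) := by
  classical
  unfold Mj
  have hs : Finset.univ \ (Finset.univ.filter fun i => n i ≠ 0) =
      Finset.univ.filter (fun i => ¬ (n i ≠ 0)) := by
    ext; simp
  rw [hs, ← Finset.prod_filter_mul_prod_filter_not Finset.univ (fun i => n i ≠ 0)]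
  have h1 : ∏ i with n i ≠ 0, (if n i = 0 then p i else K * B ^ (n i) * q i) =
      ∏ i with n i ≠ 0, K * B ^ (n i) * q i := by
    apply Finset.prod_congr rfl
    intro i hi
    simp at hi
    simp [hi]
  have h2 : ∏ i with ¬ (n i ≠ 0), (if n i = 0 then p i else K * B ^ (n i) * q i) =
      ∏ i with ¬ (n i ≠ 0), p i := by
    apply Finset.prod_congr rfl
    intro i hi
    simp at hi
    simp [hi]
  have h3 : ∑ i, n i = ∑ i with n i ≠ 0, n i := by
    rw [Finset.sum_filter_ne_zero]
  rw [h1, h2, Finset.prod_mul_distrib, Finset.prod_mul_distrib, Finset.prod_const, h3,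
    Finset.prod_pow_eq_pow_sum]
  ring

lemma card_supp_le {d : ℕ} (n : Fin d → ℕ) :
    (Finset.univ.filter fun i => n i ≠ 0).card ≤ ∑ i, n i := by
  rw [Finset.card_eq_sum_ones, Finset.sum_filter]
  apply Finset.sum_le_sum
  intro i _
  split_ifs with h
  · omega
  · omega

lemma Mj_sum {d : ℕ} {α : Type*} [Fintype α] (K B : ℝ) (hK : 1 ≤ K) (hB : 0 ≤ B)
    (p q : Fin d → ℝ) (hp : ∀ i, 0 ≤ p i) (hq : ∀ i, 0 ≤ q i) (n : α → Fin d → ℕ) (r N : ℕ)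
    (hr : ∀ a, ∑ i, n a i = r)
    (hN : ∀ U : Finset (Fin d),
      (Finset.univ.filter fun a => (Finset.univ.filter fun i => n a i ≠ 0) = U).card ≤ N) :
    ∑ a, Mj K B p q (n a) ≤ N * (K ^ r * B ^ r) * ∏ i, (q i + p i) := by
  classical
  set ω : Finset (Fin d) → ℝ := fun U => (∏ i ∈ U, q i) * ∏ i ∈ Finset.univ \ U, p i with hω
  have hω0 : ∀ U, 0 ≤ ω U := fun U =>
    mul_nonneg (Finset.prod_nonneg fun i _ => hq i) (Finset.prod_nonneg fun i _ => hp i)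
  have hK0 : 0 ≤ K := by linarith
  have h1 : ∀ a, Mj K B p q (n a) ≤ (K ^ r * B ^ r) * ω (Finset.univ.filter fun i => n a i ≠ 0) := by
    intro a
    rw [Mj_eq, hr a]
    have : K ^ (Finset.univ.filter fun i => n a i ≠ 0).card ≤ K ^ r :=
      pow_le_pow_right₀ hK (by rw [← hr a]; exact card_supp_le _)
    have h0 := hω0 (Finset.univ.filter fun i => n a i ≠ 0)
    gcongr
  calc ∑ a, Mj K B p q (n a)
      ≤ ∑ a, (K ^ r * B ^ r) * ω (Finset.univ.filter fun i => n a i ≠ 0) :=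
        Finset.sum_le_sum fun a _ => h1 a
    _ = (K ^ r * B ^ r) * ∑ a, ω (Finset.univ.filter fun i => n a i ≠ 0) := by
        rw [Finset.mul_sum]
    _ = (K ^ r * B ^ r) * ∑ U : Finset (Fin d), ∑ a with
          (Finset.univ.filter fun i => n a i ≠ 0) = U, ω U := by
        congr 1
        rw [← Finset.sum_fiberwise (s := Finset.univ)
          (g := fun a => (Finset.univ.filter fun i => n a i ≠ 0))]
        apply Finset.sum_congr rfl
        intro U _
        apply Finset.sum_congr rfl
        intro a ha
        rw [(Finset.mem_filter.1 ha).2]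
    _ ≤ (K ^ r * B ^ r) * ∑ U : Finset (Fin d), N * ω U := by
        gcongr with U _
        rw [Finset.sum_const, nsmul_eq_mul]
        have := hω0 U
        gcongr
        exact hN U
    _ = N * (K ^ r * B ^ r) * ∏ i, (q i + p i) := by
        rw [Finset.prod_add, ← Finset.mul_sum, Finset.powerset_univ]
        ring

lemma sum_ee {d : ℕ} (k : Fin d) : ∑ i, ee k i = 1 := by
  simp [ee]

lemma Mj_sum1 {d : ℕ} (K B : ℝ) (hK : 1 ≤ K) (hB : 0 ≤ B)
    (p q : Fin d → ℝ) (hp : ∀ i, 0 ≤ p i) (hq : ∀ i, 0 ≤ q i) :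
    ∑ j, Mj K B p q (ee j) ≤ 256 * (K ^ 1 * B ^ 1) * ∏ i, (q i + p i) := by
  classical
  have := Mj_sum K B hK hB p q hp hq (fun j => ee j) 1 256 (fun a => sum_ee a) (by
    intro U
    have hsub : (Finset.univ.filter fun a : Fin d => (Finset.univ.filter fun i => ee a i ≠ 0) = U)
        ⊆ U := by
      intro a ha
      rw [← (Finset.mem_filter.1 ha).2]
      refine Finset.mem_filter.2 ⟨Finset.mem_univ _, ?_⟩
      simp [ee]
    by_cases hne : (Finset.univ.filter fun a : Fin d =>
        (Finset.univ.filter fun i => ee a i ≠ 0) = U).Nonempty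
    · obtain ⟨a, ha⟩ := hne
      have hU : U.card ≤ 1 := by
        rw [← (Finset.mem_filter.1 ha).2, ← sum_ee a]
        exact card_supp_le _
      exact (Finset.card_le_card hsub).trans (hU.trans (by norm_num))
    · rw [Finset.not_nonempty_iff_eq_empty.1 hne]; simp)
  exact_mod_cast this

lemma Mj_sum2 {d : ℕ} (K B : ℝ) (hK : 1 ≤ K) (hB : 0 ≤ B)
    (p q : Fin d → ℝ) (hp : ∀ i, 0 ≤ p i) (hq : ∀ i, 0 ≤ q i) :
    ∑ j, ∑ k, Mj K B p q (ee j + ee k) ≤ 256 * (K ^ 2 * B ^ 2) * ∏ i, (q i + p i) := by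
  classical
  have hr : ∀ a : Fin d × Fin d, ∑ i, (ee a.1 + ee a.2) i = 2 := by
    intro a; simp [Finset.sum_add_distrib, sum_ee]
  have := Mj_sum K B hK hB p q hp hq (fun a : Fin d × Fin d => ee a.1 + ee a.2) 2 256 hr (by
    intro U
    have hsub : (Finset.univ.filter fun a : Fin d × Fin d =>
        (Finset.univ.filter fun i => (ee a.1 + ee a.2) i ≠ 0) = U) ⊆ U ×ˢ U := by
      intro a ha
      rw [← (Finset.mem_filter.1 ha).2]
      simp [ee]
    by_cases hne : (Finset.univ.filter fun a : Fin d × Fin d =>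
        (Finset.univ.filter fun i => (ee a.1 + ee a.2) i ≠ 0) = U).Nonempty
    · obtain ⟨a, ha⟩ := hne
      have hU : U.card ≤ 2 := by
        rw [← (Finset.mem_filter.1 ha).2, ← hr a]
        exact card_supp_le _
      refine (Finset.card_le_card hsub).trans ?_
      simp only [Finset.card_product]
      calc _ ≤ 2 * 2 := by gcongr
        _ ≤ 256 := by norm_num
    · rw [Finset.not_nonempty_iff_eq_empty.1 hne]; simp)
  rw [Fintype.sum_prod_type] at this
  exact_mod_cast this

lemma Mj_sum4 {d : ℕ} (K B : ℝ) (hK : 1 ≤ K) (hB : 0 ≤ B)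
    (p q : Fin d → ℝ) (hp : ∀ i, 0 ≤ p i) (hq : ∀ i, 0 ≤ q i) :
    ∑ j, ∑ k, ∑ l, ∑ m, Mj K B p q (ee j + ee k + ee l + ee m) ≤
      256 * (K ^ 4 * B ^ 4) * ∏ i, (q i + p i) := by
  classical
  have hr : ∀ a : Fin d × Fin d × Fin d × Fin d,
      ∑ i, (ee a.1 + ee a.2.1 + ee a.2.2.1 + ee a.2.2.2) i = 4 := by
    intro a; simp [Finset.sum_add_distrib, sum_ee]
  have := Mj_sum K B hK hB p q hp hq (fun a : Fin d × Fin d × Fin d × Fin d =>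
      ee a.1 + ee a.2.1 + ee a.2.2.1 + ee a.2.2.2) 4 256 hr (by
    intro U
    have hsub : (Finset.univ.filter fun a : Fin d × Fin d × Fin d × Fin d =>
        (Finset.univ.filter fun i => (ee a.1 + ee a.2.1 + ee a.2.2.1 + ee a.2.2.2) i ≠ 0) = U)
        ⊆ U ×ˢ U ×ˢ U ×ˢ U := by
      intro a ha
      rw [← (Finset.mem_filter.1 ha).2]
      simp [ee]
    by_cases hne : (Finset.univ.filter fun a : Fin d × Fin d × Fin d × Fin d =>
        (Finset.univ.filter fun i => (ee a.1 + ee a.2.1 + ee a.2.2.1 + ee a.2.2.2) i ≠ 0) =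
          U).Nonempty
    · obtain ⟨a, ha⟩ := hne
      have hU : U.card ≤ 4 := by
        rw [← (Finset.mem_filter.1 ha).2, ← hr a]
        exact card_supp_le _
      refine (Finset.card_le_card hsub).trans ?_
      simp only [Finset.card_product]
      calc _ ≤ 4 * (4 * (4 * 4)) := by gcongr
        _ ≤ 256 := by norm_num
    · rw [Finset.not_nonempty_iff_eq_empty.1 hne]; simp)
  simp only [Fintype.sum_prod_type] at this
  exact_mod_cast this

/-- factor of the smoothed rectangle indicator and its derivatives -/
def RF {d : ℕ} (a b : Fin d → ℝ) (τ : ℝ) (i : Fin d) (m : ℕ) (y : ℝ) : ℝ :=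
  (-1 / τ) ^ m * (nder m ((b i - y) / τ) - nder m ((a i - y) / τ))

lemma RF_continuous {d : ℕ} (a b : Fin d → ℝ) (τ : ℝ) (i : Fin d) (m : ℕ) :
    Continuous (RF a b τ i m) := by
  have := nder_continuous m
  unfold RF
  fun_prop

lemma RF_hasDerivAt {d : ℕ} (a b : Fin d → ℝ) (τ : ℝ) (i : Fin d) (m : ℕ) (hm : m ≤ 3) (y : ℝ) :
    HasDerivAt (RF a b τ i m) (RF a b τ i (m + 1) y) y := by
  have h (c : ℝ) : HasDerivAt (fun y => nder m ((c - y) / τ)) (nder (m + 1) ((c - y) / τ) *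
      (-1 / τ)) y := by
    have h1 : HasDerivAt (fun y => (c - y) / τ) (-1 / τ) y :=
      (((hasDerivAt_id y).const_sub c).div_const τ)
    exact (nder_hasDerivAt m hm _).comp y h1
  unfold RF
  refine (((h (b i)).sub (h (a i))).const_mul ((-1 / τ) ^ m)).congr_deriv ?_
  rw [pow_succ]; ring

/-- enlarged mass -/
def RE {d : ℕ} (a b : Fin d → ℝ) (τ e : ℝ) (y : Fin d → ℝ) (i : Fin d) : ℝ :=
  nPhi ((b i - y i) / τ + e) - nPhi ((a i - y i) / τ - e)

/-- majorant for derivatives of the smoothed indicator near `y` -/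
def RM {d : ℕ} (a b : Fin d → ℝ) (τ L e : ℝ) (n : Fin d → ℕ) (y : Fin d → ℝ) : ℝ :=
  Mj K1 (L / τ) (RE a b τ e y) (fun i => (1 - RE a b τ e y i) + 2 / d) n

lemma RE_le_one {d : ℕ} (a b : Fin d → ℝ) (τ e : ℝ) (y : Fin d → ℝ) (i : Fin d) :
    RE a b τ e y i ≤ 1 := by
  unfold RE; linarith [nPhi_le_one ((b i - y i) / τ + e), nPhi_nonneg ((a i - y i) / τ - e)]

lemma RE_nonneg {d : ℕ} (a b : Fin d → ℝ) (τ e : ℝ) (y : Fin d → ℝ) (i : Fin d)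
    (hab : a i ≤ b i) (hτ : 0 < τ) (he : 0 ≤ e) : 0 ≤ RE a b τ e y i := by
  unfold RE
  have : (a i - y i) / τ ≤ (b i - y i) / τ := by gcongr
  linarith [nPhi_mono (show (a i - y i) / τ - e ≤ (b i - y i) / τ + e by linarith)]

lemma RM_continuous {d : ℕ} (a b : Fin d → ℝ) (τ L e : ℝ) (n : Fin d → ℕ) :
    Continuous (RM a b τ L e n) := by
  have hE : ∀ i, Continuous (fun y => RE a b τ e y i) := by
    intro i; have := nPhi_continuous; unfold RE; fun_prop
  unfold RM Mj
  refine continuous_finsetProd _ fun i _ => ?_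
  split_ifs
  · exact hE i
  · exact continuous_const.mul ((continuous_const.sub (hE i)).add continuous_const)

lemma RF_bound {d : ℕ} (hd : 3 ≤ d) (L : ℝ) (hL1 : 1 ≤ L) (hL : L ^ 2 = Real.log d)
    (a b : Fin d → ℝ) (τ e : ℝ) (hτ : 0 < τ) (he : 0 ≤ e) (heL : e ≤ 2 / L)
    (y y0 : Fin d → ℝ) (i : Fin d) (hy : |y i - y0 i| ≤ e * τ) (hab : a i ≤ b i) (m : ℕ)
    (hm : m ≤ 4) :
    |RF a b τ i m (y i)| ≤ if m = 0 then RE a b τ e y0 i else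
      K1 * (L / τ) ^ m * ((1 - RE a b τ e y0 i) + 2 / d) := by
  have hy1 : |(y i - y0 i) / τ| ≤ e := by
    rw [abs_div, abs_of_pos hτ, div_le_iff₀ hτ]; exact hy
  have hy2 := abs_le.1 hy1
  have eb : (b i - y0 i) / τ + e = (b i - y i) / τ + ((y i - y0 i) / τ + e) := by ring
  have ea : (a i - y0 i) / τ - e = (a i - y i) / τ - (e - (y i - y0 i) / τ) := by ring
  have h4 : 4 / L = 2 / L + 2 / L := by ring
  split_ifs with h0
  · subst h0
    unfold RF RE
    simp only [nder, pow_zero, one_mul]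
    have : (a i - y i) / τ ≤ (b i - y i) / τ := by gcongr
    have h1 := nPhi_mono this
    rw [abs_of_nonneg (by linarith), eb, ea]
    have h2 := nPhi_mono (show (b i - y i) / τ ≤ (b i - y i) / τ + ((y i - y0 i) / τ + e) by linarith)
    have h3 := nPhi_mono (show (a i - y i) / τ - (e - (y i - y0 i) / τ) ≤ (a i - y i) / τ by linarith)
    linarith
  · have hm1 : 1 ≤ m := by omega
    have hb := nder_bound d hd L hL1 hL m hm1 hm ((b i - y i) / τ) ((y i - y0 i) / τ + e)
      (by linarith) (by linarith)
    have ha := nder_bound_left d hd L hL1 hL m hm1 hm ((a i - y i) / τ) (e - (y i - y0 i) / τ)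
      (by linarith) (by linarith)
    rw [← eb] at hb
    rw [← ea] at ha
    unfold RF RE
    rw [abs_mul, abs_pow, abs_div, abs_neg, abs_one, abs_of_pos hτ]
    calc (1 / τ) ^ m * |nder m ((b i - y i) / τ) - nder m ((a i - y i) / τ)|
        ≤ (1 / τ) ^ m * (|nder m ((b i - y i) / τ)| + |nder m ((a i - y i) / τ)|) := by
          gcongr; exact abs_sub _ _
      _ ≤ (1 / τ) ^ m * (K1 * L ^ m * ((1 - nPhi ((b i - y0 i) / τ + e)) + 1 / d) +
            K1 * L ^ m * (nPhi ((a i - y0 i) / τ - e) + 1 / d)) := by gcongr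
      _ = _ := by rw [div_pow, div_pow]; ring

lemma Gp_RF_bound {d : ℕ} (hd : 3 ≤ d) (L : ℝ) (hL1 : 1 ≤ L) (hL : L ^ 2 = Real.log d)
    (a b : Fin d → ℝ) (τ e : ℝ) (hτ : 0 < τ) (he : 0 ≤ e) (heL : e ≤ 2 / L)
    (y y0 : Fin d → ℝ) (hy : ∀ i, |y i - y0 i| ≤ e * τ) (hab : ∀ i, a i ≤ b i) (n : Fin d → ℕ)
    (hn : ∀ i, n i ≤ 4) :
    |Gp (RF a b τ) n y| ≤ RM a b τ L e n y0 := by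
  unfold Gp RM Mj
  rw [Finset.abs_prod]
  apply Finset.prod_le_prod
  · intro i _; exact abs_nonneg _
  · intro i _
    exact RF_bound hd L hL1 hL a b τ e hτ he heL y y0 i (hy i) (hab i) (n i) (hn i)

/-- The constant in the sum bounds. -/
def K2 : ℝ := 256 * K1 ^ 4 * Real.exp 2

lemma K2_pos : 0 < K2 := by
  unfold K2; have := K1_ge; positivity

lemma RM_prod_le {d : ℕ} (hd : 3 ≤ d) (r : Fin d → ℝ) :
    ∏ i, (((1 - r i) + 2 / (d:ℝ)) + r i) ≤ Real.exp 2 := by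
  have hd0 : (0:ℝ) < d := by positivity
  have : ∀ i : Fin d, (((1 - r i) + 2 / (d:ℝ)) + r i) = 1 + 2 / d := by intro i; ring
  simp only [this, Finset.prod_const, Finset.card_univ, Fintype.card_fin]
  calc (1 + 2 / (d:ℝ)) ^ d ≤ (Real.exp (2 / d)) ^ d := by
        gcongr; linarith [Real.add_one_le_exp (2 / (d:ℝ))]
    _ = Real.exp 2 := by rw [← Real.exp_nat_mul]; congr 1; field_simp

lemma RM_sum1 {d : ℕ} (hd : 3 ≤ d) (L : ℝ) (hL1 : 1 ≤ L)
    (a b : Fin d → ℝ) (τ e : ℝ) (hτ : 0 < τ) (he : 0 ≤ e)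
    (y : Fin d → ℝ) (hab : ∀ i, a i ≤ b i) : ∑ j, RM a b τ L e (ee j) y ≤ K2 * (L / τ) := by
  have h := Mj_sum1 K1 (L / τ) K1_ge (by positivity) (RE a b τ e y)
    (fun i => (1 - RE a b τ e y i) + 2 / d) (fun i => RE_nonneg a b τ e y i (hab i) hτ he)
    (fun i => by have := RE_le_one a b τ e y i; have : (0:ℝ) ≤ 2 / d := by positivity
                 linarith)
  have h2 := RM_prod_le hd (RE a b τ e y)
  have hk := K1_ge
  have hk4 : K1 ^ 1 ≤ K1 ^ 4 := pow_le_pow_right₀ hk (by norm_num)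
  have hpn : 0 ≤ ∏ i, (1 - RE a b τ e y i + 2 / (d:ℝ) + RE a b τ e y i) :=
    Finset.prod_nonneg fun i _ => by
      have : (0:ℝ) ≤ 2 / d := by positivity
      linarith
  unfold RM
  refine h.trans ?_
  calc _ ≤ 256 * (K1 ^ 4 * (L / τ) ^ 1) * Real.exp 2 := by gcongr
    _ = _ := by unfold K2; ring

lemma RM_sum2 {d : ℕ} (hd : 3 ≤ d) (L : ℝ) (hL1 : 1 ≤ L)
    (a b : Fin d → ℝ) (τ e : ℝ) (hτ : 0 < τ) (he : 0 ≤ e)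
    (y : Fin d → ℝ) (hab : ∀ i, a i ≤ b i) : ∑ j, ∑ k, RM a b τ L e (ee j + ee k) y ≤ K2 * (L / τ) ^ 2 := by
  have h := Mj_sum2 K1 (L / τ) K1_ge (by positivity) (RE a b τ e y)
    (fun i => (1 - RE a b τ e y i) + 2 / d) (fun i => RE_nonneg a b τ e y i (hab i) hτ he)
    (fun i => by have := RE_le_one a b τ e y i; have : (0:ℝ) ≤ 2 / d := by positivity
                 linarith)
  have h2 := RM_prod_le hd (RE a b τ e y)
  have hk := K1_ge
  have hk4 : K1 ^ 2 ≤ K1 ^ 4 := pow_le_pow_right₀ hk (by norm_num)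
  have hpn : 0 ≤ ∏ i, (1 - RE a b τ e y i + 2 / (d:ℝ) + RE a b τ e y i) :=
    Finset.prod_nonneg fun i _ => by
      have : (0:ℝ) ≤ 2 / d := by positivity
      linarith
  unfold RM
  refine h.trans ?_
  calc _ ≤ 256 * (K1 ^ 4 * (L / τ) ^ 2) * Real.exp 2 := by gcongr
    _ = _ := by unfold K2; ring

lemma RM_sum4 {d : ℕ} (hd : 3 ≤ d) (L : ℝ) (hL1 : 1 ≤ L)
    (a b : Fin d → ℝ) (τ e : ℝ) (hτ : 0 < τ) (he : 0 ≤ e)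
    (y : Fin d → ℝ) (hab : ∀ i, a i ≤ b i) : ∑ j, ∑ k, ∑ l, ∑ m, RM a b τ L e (ee j + ee k + ee l + ee m) y ≤
    K2 * (L / τ) ^ 4 := by
  have h := Mj_sum4 K1 (L / τ) K1_ge (by positivity) (RE a b τ e y)
    (fun i => (1 - RE a b τ e y i) + 2 / d) (fun i => RE_nonneg a b τ e y i (hab i) hτ he)
    (fun i => by have := RE_le_one a b τ e y i; have : (0:ℝ) ≤ 2 / d := by positivity
                 linarith)
  have h2 := RM_prod_le hd (RE a b τ e y)
  have hk := K1_ge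
  have hpn : 0 ≤ ∏ i, (1 - RE a b τ e y i + 2 / (d:ℝ) + RE a b τ e y i) :=
    Finset.prod_nonneg fun i _ => by
      have : (0:ℝ) ≤ 2 / d := by positivity
      linarith
  unfold RM
  refine h.trans ?_
  calc _ ≤ 256 * (K1 ^ 4 * (L / τ) ^ 4) * Real.exp 2 := by gcongr
    _ = _ := by unfold K2; ring

lemma RM_nonneg {d : ℕ} (hd : 3 ≤ d) (L : ℝ) (hL1 : 1 ≤ L)
    (a b : Fin d → ℝ) (τ e : ℝ) (hτ : 0 < τ) (he : 0 ≤ e)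
    (y : Fin d → ℝ) (hab : ∀ i, a i ≤ b i) (n : Fin d → ℕ) : 0 ≤ RM a b τ L e n y := by
  unfold RM Mj
  refine Finset.prod_nonneg fun i _ => ?_
  have h1 := RE_nonneg a b τ e y i (hab i) hτ he
  have h2 := RE_le_one a b τ e y i
  have hk := K1_ge
  have : (0:ℝ) ≤ 2 / d := by positivity
  split_ifs
  · exact h1
  · have : 0 ≤ 1 - RE a b τ e y i + 2 / d := by linarith
    positivity


lemma le_sup1 {ι : Type*} [Finite ι] (f : ι → ℝ) (i : ι) : f i ≤ ⨆ i, f i :=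
  le_ciSup (Set.finite_range f).bddAbove i

lemma le_sup2 {ι : Type*} [Finite ι] (f : ι → ι → ℝ) (i j : ι) : f i j ≤ ⨆ i, ⨆ j, f i j :=
  (le_sup1 (f i) j).trans (le_sup1 (fun i => ⨆ j, f i j) i)

lemma le_sup4 {ι : Type*} [Finite ι] (f : ι → ι → ι → ι → ℝ) (i j k l : ι) :
    f i j k l ≤ ⨆ i, ⨆ j, ⨆ k, ⨆ l, f i j k l :=
  (le_sup2 (f i j) k l).trans (le_sup2 (fun i j => ⨆ k, ⨆ l, f i j k l) i j)

lemma integrable_iSup_fin {Ω ι : Type*} [MeasurableSpace Ω] {P : Measure Ω} [Fintype ι]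
    {f : ι → Ω → ℝ} (hf : ∀ i, Integrable (f i) P) : Integrable (fun ω => ⨆ i, f i ω) P := by
  have hs : Integrable (fun ω => ∑ i, |f i ω|) P := integrable_finsetSum _ fun i _ => (hf i).abs
  refine hs.mono' ?_ (Filter.Eventually.of_forall fun ω => ?_)
  · exact (AEMeasurable.iSup fun i => (hf i).aemeasurable).aestronglyMeasurable
  · rw [Real.norm_eq_abs]
    rcases isEmpty_or_nonempty ι with h | h
    · simp
    · have hi : ∀ i, |f i ω| ≤ ∑ i, |f i ω| := fun i =>
        Finset.single_le_sum (f := fun i => |f i ω|) (fun i _ => abs_nonneg _) (Finset.mem_univ i)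
      rw [abs_le]
      constructor
      · obtain ⟨i⟩ := h
        have := le_sup1 (fun i => f i ω) i
        have h3 := neg_abs_le (f i ω)
        have := hi i
        have h4 : f i ω ≤ ⨆ i, f i ω := le_sup1 (fun i => f i ω) i
        linarith
      · exact ciSup_le fun i => (le_abs_self _).trans (hi i)

/-- pull out `W`-measurable factors -/
lemma ce_mul {Ω E : Type*} [MeasurableSpace Ω] [MeasurableSpace E] {P : Measure Ω}
    [IsProbabilityMeasure P] {W : Ω → E}
    (hW : Measurable W) {X : Ω → ℝ} (hX : Integrable X P) {g : E → ℝ} (hg : Measurable g)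
    {B : ℝ} (hB : ∀ x, |g x| ≤ B) :
    ∫ ω, X ω * g (W ω) ∂P =
      ∫ ω, (P[X | MeasurableSpace.comap W inferInstance]) ω * g (W ω) ∂P := by
  have hm := hW.comap_le
  have hgm : StronglyMeasurable[MeasurableSpace.comap W inferInstance] (fun ω => g (W ω)) :=
    (hg.comp (comap_measurable W)).stronglyMeasurable
  have hInt0 : Integrable (X * fun ω => g (W ω)) P :=
    hX.mul_bdd (hg.comp hW).aestronglyMeasurable (Filter.Eventually.of_forall fun ω => hB _)
  have h := condExp_mul_of_stronglyMeasurable_right (m := MeasurableSpace.comap W inferInstance)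
    hgm hInt0 hX
  have h2 := integral_condExp (μ := P) hm (f := X * fun ω => g (W ω))
  rw [integral_congr_ae h] at h2
  exact h2.symm

lemma exch_integral {Ω E : Type*} [MeasurableSpace Ω] [MeasurableSpace E] {P : Measure Ω}
    {W W' : Ω → E} (hW : Measurable W) (hW' : Measurable W')
    (hex : Measure.map (fun ω => (W ω, W' ω)) P = Measure.map (fun ω => (W' ω, W ω)) P)
    (f : E × E → ℝ) (hf : Measurable f) :
    ∫ ω, f (W ω, W' ω) ∂P = ∫ ω, f (W' ω, W ω) ∂P := by
  rw [← integral_map (hW.prodMk hW').aemeasurable hf.aestronglyMeasurable, hex,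
    integral_map (hW'.prodMk hW).aemeasurable hf.aestronglyMeasurable]

lemma trapezoid (q q1 q2 q3 : ℝ → ℝ) (h0 : ∀ u, HasDerivAt q (q1 u) u)
    (h1 : ∀ u, HasDerivAt q1 (q2 u) u) (h2 : ∀ u, HasDerivAt q2 (q3 u) u) (M : ℝ)
    (hM : ∀ u ∈ Set.Icc (0:ℝ) 1, |q3 u| ≤ M) :
    |q 1 - q 0 - (1 / 2) * (q1 0 + q1 1)| ≤ (1 / 2) * M := by
  have hM0 : 0 ≤ M := (abs_nonneg _).trans (hM 0 ⟨le_rfl, zero_le_one⟩)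
  have hq2 : ∀ x ∈ Set.Icc (0:ℝ) 1, ∀ y ∈ Set.Icc (0:ℝ) 1, |q2 y - q2 x| ≤ M := by
    intro x hx y hy
    have := Convex.norm_image_sub_le_of_norm_hasDerivWithin_le (f := q2) (f' := q3)
      (s := Set.Icc (0:ℝ) 1) (C := M) (fun u _ => (h2 u).hasDerivWithinAt) hM
      (convex_Icc 0 1) hx hy
    rw [Real.norm_eq_abs, Real.norm_eq_abs] at this
    refine this.trans ?_
    have : |y - x| ≤ 1 := by rw [abs_le]; constructor <;> linarith [hx.1, hx.2, hy.1, hy.2]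
    nlinarith
  have he : ∀ u, HasDerivAt (fun u => q u - q 0 - (u / 2) * (q1 0 + q1 u))
      (q1 u - ((1 / 2) * (q1 0 + q1 u) + (u / 2) * q2 u)) u := by
    intro u
    have ha := ((hasDerivAt_id u).div_const 2).mul ((h1 u).const_add (q1 0))
    exact ((h0 u).sub_const (q 0)).sub ha
  have hb : ∀ u ∈ Set.Icc (0:ℝ) 1,
      ‖q1 u - ((1 / 2) * (q1 0 + q1 u) + (u / 2) * q2 u)‖ ≤ (1 / 2) * M := by
    intro u hu
    rw [Real.norm_eq_abs]
    rcases eq_or_lt_of_le hu.1 with h | h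
    · subst h
      have : q1 0 - (1 / 2 * (q1 0 + q1 0) + 0 / 2 * q2 0) = 0 := by ring
      rw [this, abs_zero]; positivity
    · obtain ⟨ξ, hξ, hs⟩ := exists_hasDerivAt_eq_slope q1 q2 h
        (fun x _ => (h1 x).continuousAt.continuousWithinAt) (fun x _ => h1 x)
      have e1 : q1 u - q1 0 = u * q2 ξ := by
        rw [hs]; field_simp; ring
      have e2 : q1 u - (1 / 2 * (q1 0 + q1 u) + u / 2 * q2 u) = (u / 2) * (q2 ξ - q2 u) := by
        linear_combination (1 / 2) * e1
      rw [e2, abs_mul, abs_of_nonneg (by linarith)]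
      have := hq2 u hu ξ ⟨hξ.1.le, hξ.2.le.trans hu.2⟩
      have hu2 := hu.2
      exact mul_le_mul (by linarith) this (abs_nonneg _) (by norm_num)
  have hfin := Convex.norm_image_sub_le_of_norm_hasDerivWithin_le (x := 0) (y := 1)
    (f := fun u => q u - q 0 - (u / 2) * (q1 0 + q1 u))
    (f' := fun u => q1 u - ((1 / 2) * (q1 0 + q1 u) + (u / 2) * q2 u)) (C := (1 / 2) * M)
    (s := Set.Icc (0:ℝ) 1) (fun u _ => (he u).hasDerivWithinAt) hb (convex_Icc 0 1)
    ⟨le_rfl, zero_le_one⟩ ⟨zero_le_one, le_rfl⟩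
  rw [Real.norm_eq_abs] at hfin
  have e3 : (q 1 - q 0 - (1 / 2) * (q1 0 + q1 1)) - (q 0 - q 0 - (0 / 2) * (q1 0 + q1 0))
    = q 1 - q 0 - (1 / 2) * (q1 0 + q1 1) := by ring
  have e4 : ‖(1:ℝ) - 0‖ = 1 := by norm_num
  rw [e3, e4, mul_one] at hfin
  exact hfin

/-- abstract bound for exchangeable pairs -/
lemma exch_abstract {d : ℕ} {Ω : Type} [MeasurableSpace Ω] (P : Measure Ω) [IsProbabilityMeasure P]
    (W W' : Ω → Fin d → ℝ) (hW : Measurable W) (hW' : Measurable W')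
    (hWi : ∀ j, Integrable (fun ω => W ω j) P)
    (hex : Measure.map (fun ω => (W ω, W' ω)) P = Measure.map (fun ω => (W' ω, W ω)) P)
    (Λ : Matrix (Fin d) (Fin d) ℝ) (hΛ : Λ.det ≠ 0) (R : Ω → Fin d → ℝ)
    (hR : P[fun ω => W' ω - W ω | MeasurableSpace.comap W inferInstance]
          =ᵐ[P] fun ω => -Λ.mulVec (W ω + R ω))
    (D : Ω → Fin d → ℝ) (hD : D = (fun ω => W' ω - W ω)) (hD4 : Integrable (fun ω => ‖D ω‖ ^ 4) P)
    (S : Matrix (Fin d) (Fin d) ℝ) (η : ℝ)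
    (g : Fin d → (Fin d → ℝ) → ℝ) (h : Fin d → Fin d → (Fin d → ℝ) → ℝ)
    (M : Fin d → Fin d → Fin d → Fin d → (Fin d → ℝ) → ℝ)
    (hg : ∀ j, Measurable (g j)) (hh : ∀ j k, Measurable (h j k))
    (hM : ∀ j k l m, Measurable (M j k l m)) (hM0 : ∀ j k l m x, 0 ≤ M j k l m x)
    (B1 B2 B4 : ℝ) (hB1 : ∀ x, ∑ j, |g j x| ≤ B1) (hB2 : ∀ x, ∑ j, ∑ k, |h j k x| ≤ B2)
    (hB4 : ∀ x, ∑ j, ∑ k, ∑ l, ∑ m, M j k l m x ≤ B4)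
    (hrem : ∀ x v α : Fin d → ℝ, ‖v‖ ≤ η →
      |∑ j, α j * (g j (x + v) - g j x) - (1 / 2) * ∑ j, ∑ k, α j * v k * (h j k x + h j k (x + v))|
        ≤ ∑ j, ∑ k, ∑ l, ∑ m, |α j * v k * v l * v m| * M j k l m x)
    (hrem' : ∀ x v α : Fin d → ℝ,
      |∑ j, α j * (g j (x + v) - g j x) - (1 / 2) * ∑ j, ∑ k, α j * v k * (h j k x + h j k (x + v))|
        ≤ (⨆ j, ⨆ k, ⨆ l, ⨆ m, |α j * v k * v l * v m|) * B4) :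
    |∫ ω, (∑ j, ∑ k, S j k * h j k (W ω) - ∑ j, W ω j * g j (W ω)) ∂P| ≤
      B1 * (∫ ω, ⨆ j, |R ω j| ∂P) +
      B2 * (∫ ω, ⨆ j, ⨆ k, |S j k - (1 / 2) *
            (P[fun ω' => Λ⁻¹.mulVec (D ω') j * D ω' k |
                MeasurableSpace.comap W inferInstance]) ω| ∂P) +
      B4 * ((∫ ω, ⨆ j, ⨆ k, ⨆ l, ⨆ m,
          (P[fun ω' => |Λ⁻¹.mulVec (D ω') j * D ω' k * D ω' l * D ω' m| |
              MeasurableSpace.comap W inferInstance]) ω ∂P) +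
        ∫ ω in {ω | η < ‖D ω‖}, ⨆ j, ⨆ k, ⨆ l, ⨆ m,
          |Λ⁻¹.mulVec (D ω) j * D ω k * D ω l * D ω m| ∂P) := by
  have hDm : Measurable D := by rw [hD]; exact hW'.sub hW
  -- pointwise bounds
  have hg1 : ∀ j x, |g j x| ≤ B1 := fun j x => le_trans
    (Finset.single_le_sum (f := fun j => |g j x|) (fun i _ => abs_nonneg _) (Finset.mem_univ j)) (hB1 x)
  have hh1 : ∀ j k x, |h j k x| ≤ B2 := fun j k x => le_trans
    ((Finset.single_le_sum (f := fun k => |h j k x|) (fun i _ => abs_nonneg _)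
      (Finset.mem_univ k)).trans
    (Finset.single_le_sum (f := fun j => ∑ k, |h j k x|)
      (fun i _ => Finset.sum_nonneg fun _ _ => abs_nonneg _) (Finset.mem_univ j))) (hB2 x)
  have hM1 : ∀ j k l m x, |M j k l m x| ≤ B4 := fun j k l m x => by
    rw [abs_of_nonneg (hM0 _ _ _ _ _)]
    refine le_trans ?_ (hB4 x)
    refine le_trans ?_ (Finset.single_le_sum (f := fun j => ∑ k, ∑ l, ∑ m, M j k l m x)
      (fun i _ => Finset.sum_nonneg fun _ _ => Finset.sum_nonneg fun _ _ => Finset.sum_nonneg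
        fun _ _ => hM0 _ _ _ _ _) (Finset.mem_univ j))
    refine le_trans ?_ (Finset.single_le_sum (f := fun k => ∑ l, ∑ m, M j k l m x)
      (fun i _ => Finset.sum_nonneg fun _ _ => Finset.sum_nonneg
        fun _ _ => hM0 _ _ _ _ _) (Finset.mem_univ k))
    refine le_trans ?_ (Finset.single_le_sum (f := fun l => ∑ m, M j k l m x)
      (fun i _ => Finset.sum_nonneg fun _ _ => hM0 _ _ _ _ _) (Finset.mem_univ l))
    exact Finset.single_le_sum (f := fun m => M j k l m x)
      (fun _ _ => hM0 _ _ _ _ _) (Finset.mem_univ m)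
  -- a := Λ⁻¹ D
  set a : Ω → Fin d → ℝ := fun ω => Λ⁻¹.mulVec (D ω) with ha
  have ham : ∀ j, Measurable (fun ω => a ω j) := by
    intro j
    have : Continuous (fun v : Fin d → ℝ => Λ⁻¹.mulVec v j) := by fun_prop
    exact this.measurable.comp hDm
  have hDjm : ∀ j, Measurable (fun ω => D ω j) := fun j => (measurable_pi_apply j).comp hDm
  obtain ⟨κ, hκ0, hκ⟩ : ∃ κ : ℝ, 0 ≤ κ ∧ ∀ (v : Fin d → ℝ) j, |Λ⁻¹.mulVec v j| ≤ κ * ‖v‖ := by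
    refine ⟨‖(Matrix.mulVecLin Λ⁻¹).toContinuousLinearMap‖, norm_nonneg _, fun v j => ?_⟩
    have h1 := (Matrix.mulVecLin Λ⁻¹).toContinuousLinearMap.le_opNorm v
    have h2 := norm_le_pi_norm (Λ⁻¹.mulVec v) j
    exact h2.trans h1
  have hDn : ∀ ω j, |D ω j| ≤ ‖D ω‖ := fun ω j => norm_le_pi_norm (D ω) j
  have hD1 : Integrable (fun ω => ‖D ω‖) P := by
    refine ((integrable_const (1:ℝ)).add hD4).mono' hDm.norm.aestronglyMeasurable
      (Filter.Eventually.of_forall fun ω => ?_)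
    have := norm_nonneg (D ω)
    simp only [norm_norm, Pi.add_apply]
    by_cases hc : ‖D ω‖ ≤ 1
    · have : 0 ≤ ‖D ω‖ ^ 4 := by positivity
      linarith
    · have : ‖D ω‖ ^ 1 ≤ ‖D ω‖ ^ 4 := pow_le_pow_right₀ (by linarith) (by norm_num)
      rw [pow_one] at this
      linarith
  have hD2 : Integrable (fun ω => ‖D ω‖ ^ 2) P := by
    refine ((integrable_const (1:ℝ)).add hD4).mono' (hDm.norm.pow_const 2).aestronglyMeasurable
      (Filter.Eventually.of_forall fun ω => ?_)
    have := norm_nonneg (D ω)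
    simp only [Pi.add_apply, norm_pow, norm_norm]
    nlinarith [sq_nonneg (‖D ω‖ ^ 2 - 1), sq_nonneg (‖D ω‖ ^ 2)]
  have hDi : Integrable D P := by
    rw [← integrable_norm_iff hDm.aestronglyMeasurable]; exact hD1
  have haI : ∀ j, Integrable (fun ω => a ω j) P := fun j =>
    (hD1.const_mul κ).mono' (ham j).aestronglyMeasurable
      (Filter.Eventually.of_forall fun ω => hκ _ _)
  have haD : ∀ j k, Integrable (fun ω => a ω j * D ω k) P := fun j k =>
    (hD2.const_mul κ).mono' ((ham j).mul (hDjm k)).aestronglyMeasurable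
      (Filter.Eventually.of_forall fun ω => by
        rw [Real.norm_eq_abs, abs_mul]
        calc |a ω j| * |D ω k| ≤ (κ * ‖D ω‖) * ‖D ω‖ :=
              mul_le_mul (hκ _ _) (hDn _ _) (abs_nonneg _) (by positivity)
          _ = _ := by ring)
  have haDDD : ∀ j k l m, Integrable (fun ω => |a ω j * D ω k * D ω l * D ω m|) P :=
    fun j k l m => by
    refine (hD4.const_mul κ).mono'
      ((((ham j).mul (hDjm k)).mul (hDjm l)).mul (hDjm m)).abs.aestronglyMeasurable
      (Filter.Eventually.of_forall fun ω => ?_)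
    rw [Real.norm_eq_abs, abs_abs, abs_mul, abs_mul, abs_mul]
    calc |a ω j| * |D ω k| * |D ω l| * |D ω m| ≤ (κ * ‖D ω‖) * ‖D ω‖ * ‖D ω‖ * ‖D ω‖ := by
          gcongr
          · exact hκ _ _
          · exact hDn _ _
          · exact hDn _ _
          · exact hDn _ _
      _ = _ := by ring
  have hB1_0 : ∀ x, 0 ≤ ∑ j, |g j x| := fun x => Finset.sum_nonneg fun _ _ => abs_nonneg _
  -- conditional expectation of `a`
  have hce : ∀ j, P[fun ω => a ω j | (MeasurableSpace.comap W inferInstance)] =ᵐ[P] fun ω => -(W ω j + R ω j) := by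
    intro j
    let T : (Fin d → ℝ) →L[ℝ] ℝ :=
      (ContinuousLinearMap.proj j).comp (Matrix.mulVecLin Λ⁻¹).toContinuousLinearMap
    have h1 := ContinuousLinearMap.comp_condExp_comm (m := (MeasurableSpace.comap W inferInstance)) hDi T
    have h2 : P[D | (MeasurableSpace.comap W inferInstance)] =ᵐ[P] fun ω => -Λ.mulVec (W ω + R ω) := by rw [hD]; exact hR
    have h3 : (fun ω => a ω j) = ⇑T ∘ D := rfl
    rw [h3]
    filter_upwards [h1, h2] with ω e1 e2
    rw [← e1]
    simp only [Function.comp_apply, e2]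
    change (Λ⁻¹.mulVec (-Λ.mulVec (W ω + R ω))) j = _
    rw [Matrix.mulVec_neg, Matrix.mulVec_mulVec, Matrix.nonsing_inv_mul _ (isUnit_iff_ne_zero.2 hΛ),
      Matrix.one_mulVec]
    simp
  have hRI : ∀ j, Integrable (fun ω => R ω j) P := by
    intro j
    have h1 : Integrable (fun ω => -(P[fun ω => a ω j | (MeasurableSpace.comap W inferInstance)]) ω - W ω j) P :=
      (integrable_condExp.neg).sub (hWi j)
    refine h1.congr ?_
    filter_upwards [hce j] with ω e
    rw [e]; ring
  -- composed measurability / integrability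
  have hgW : ∀ j, Measurable (fun ω => g j (W ω)) := fun j => (hg j).comp hW
  have hgW' : ∀ j, Measurable (fun ω => g j (W' ω)) := fun j => (hg j).comp hW'
  have hhW : ∀ j k, Measurable (fun ω => h j k (W ω)) := fun j k => (hh j k).comp hW
  have hhW' : ∀ j k, Measurable (fun ω => h j k (W' ω)) := fun j k => (hh j k).comp hW'
  have iag : ∀ j, Integrable (fun ω => a ω j * g j (W ω)) P := fun j =>
    (haI j).mul_bdd (hgW j).aestronglyMeasurable (Filter.Eventually.of_forall fun ω => hg1 _ _)
  have iag' : ∀ j, Integrable (fun ω => a ω j * g j (W' ω)) P := fun j =>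
    (haI j).mul_bdd (hgW' j).aestronglyMeasurable (Filter.Eventually.of_forall fun ω => hg1 _ _)
  have iah : ∀ j k, Integrable (fun ω => a ω j * D ω k * h j k (W ω)) P := fun j k =>
    (haD j k).mul_bdd (hhW j k).aestronglyMeasurable (Filter.Eventually.of_forall fun ω => hh1 _ _ _)
  have iah' : ∀ j k, Integrable (fun ω => a ω j * D ω k * h j k (W' ω)) P := fun j k =>
    (haD j k).mul_bdd (hhW' j k).aestronglyMeasurable
      (Filter.Eventually.of_forall fun ω => hh1 _ _ _)
  have iRg : ∀ j, Integrable (fun ω => R ω j * g j (W ω)) P := fun j =>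
    (hRI j).mul_bdd (hgW j).aestronglyMeasurable (Filter.Eventually.of_forall fun ω => hg1 _ _)
  have iWg : ∀ j, Integrable (fun ω => W ω j * g j (W ω)) P := fun j =>
    (hWi j).mul_bdd (hgW j).aestronglyMeasurable (Filter.Eventually.of_forall fun ω => hg1 _ _)
  have ih : ∀ j k, Integrable (fun ω => h j k (W ω)) P := fun j k =>
    (integrable_const B2).mono' (hhW j k).aestronglyMeasurable
      (Filter.Eventually.of_forall fun ω => hh1 _ _ _)
  -- swap facts
  have swap1 : ∀ j, ∫ ω, a ω j * g j (W' ω) ∂P = - ∫ ω, a ω j * g j (W ω) ∂P := by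
    intro j
    have hc : Continuous (fun v : Fin d → ℝ => Λ⁻¹.mulVec v j) := by fun_prop
    have := exch_integral hW hW' hex
      (fun p : (Fin d → ℝ) × (Fin d → ℝ) => Λ⁻¹.mulVec (p.2 - p.1) j * g j p.2)
      ((hc.measurable.comp (measurable_snd.sub measurable_fst)).mul ((hg j).comp measurable_snd))
    simp only at this
    rw [ha, hD]
    simp only
    rw [this, ← integral_neg]
    congr 1
    funext ω
    rw [← neg_sub (W' ω) (W ω), Matrix.mulVec_neg, Pi.neg_apply]
    ring
  have swap2 : ∀ j k, ∫ ω, a ω j * D ω k * h j k (W' ω) ∂P = ∫ ω, a ω j * D ω k * h j k (W ω) ∂P := by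
    intro j k
    have hc : Continuous (fun v : Fin d → ℝ => Λ⁻¹.mulVec v j) := by fun_prop
    have := exch_integral hW hW' hex
      (fun p : (Fin d → ℝ) × (Fin d → ℝ) => Λ⁻¹.mulVec (p.2 - p.1) j * (p.2 - p.1) k * h j k p.2)
      (((hc.measurable.comp (measurable_snd.sub measurable_fst)).mul
        ((measurable_pi_apply k).comp (measurable_snd.sub measurable_fst))).mul
        ((hh j k).comp measurable_snd))
    simp only at this
    rw [ha, hD]
    simp only
    rw [this]
    congr 1
    funext ω
    rw [← neg_sub (W' ω) (W ω), Matrix.mulVec_neg, Pi.neg_apply, Pi.neg_apply]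
    ring
  -- remainder
  set rem : Ω → ℝ := fun ω => ∑ j, a ω j * (g j (W' ω) - g j (W ω)) -
    (1 / 2) * ∑ j, ∑ k, a ω j * D ω k * (h j k (W ω) + h j k (W' ω)) with hremdef
  have hWD : ∀ ω, W' ω = W ω + D ω := by intro ω; rw [hD]; simp
  have irem : Integrable rem P := by
    refine Integrable.sub (integrable_finsetSum _ fun j _ => ?_)
      ((integrable_finsetSum _ fun j _ => integrable_finsetSum _ fun k _ => ?_).const_mul _)
    · simp only [mul_sub]
      exact (iag' j).sub (iag j)
    · simp only [mul_add]
      exact (iah j k).add (iah' j k)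
  have Erem : ∫ ω, rem ω ∂P = -2 * (∑ j, ∫ ω, a ω j * g j (W ω) ∂P) -
      ∑ j, ∑ k, ∫ ω, a ω j * D ω k * h j k (W ω) ∂P := by
    rw [hremdef]
    simp only [mul_sub, mul_add]
    rw [integral_sub, integral_finsetSum, integral_const_mul, integral_finsetSum]
    · have e1 : ∀ j, ∫ ω, (a ω j * g j (W' ω) - a ω j * g j (W ω)) ∂P =
          -2 * ∫ ω, a ω j * g j (W ω) ∂P := by
        intro j
        rw [integral_sub (iag' j) (iag j), swap1]; ring
      have e2 : ∀ j, ∫ ω, ∑ k, (a ω j * D ω k * h j k (W ω) + a ω j * D ω k * h j k (W' ω)) ∂P =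
          2 * ∑ k, ∫ ω, a ω j * D ω k * h j k (W ω) ∂P := by
        intro j
        rw [integral_finsetSum, Finset.mul_sum]
        · apply Finset.sum_congr rfl
          intro k _
          rw [integral_add (iah j k) (iah' j k), swap2]; ring
        · intro k _; exact (iah j k).add (iah' j k)
      simp only [e1, e2]
      rw [← Finset.mul_sum, ← Finset.mul_sum]
      ring
    · intro j _; exact integrable_finsetSum _ fun k _ => (iah j k).add (iah' j k)
    · intro j _; exact (iag' j).sub (iag j)
    · exact integrable_finsetSum _ fun j _ => (iag' j).sub (iag j)
    · exact (integrable_finsetSum _ fun j _ => integrable_finsetSum _ fun k _ =>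
        (iah j k).add (iah' j k)).const_mul _
  have Eag : ∀ j, ∫ ω, a ω j * g j (W ω) ∂P =
      - ∫ ω, W ω j * g j (W ω) ∂P - ∫ ω, R ω j * g j (W ω) ∂P := by
    intro j
    rw [ce_mul hW (haI j) (hg j) (hg1 j), ← integral_neg]
    refine Eq.trans ?_ (integral_sub (iWg j).neg (iRg j))
    apply integral_congr_ae
    filter_upwards [hce j] with ω e
    rw [e]; simp; ring
  set Y : Fin d → Fin d → Ω → ℝ := fun j k => P[fun ω' => a ω' j * D ω' k | (MeasurableSpace.comap W inferInstance)] with hY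
  have iY : ∀ j k, Integrable (Y j k) P := fun j k => integrable_condExp
  have iYh : ∀ j k, Integrable (fun ω => (S j k - (1 / 2) * Y j k ω) * h j k (W ω)) P := fun j k =>
    ((integrable_const (S j k)).sub ((iY j k).const_mul _)).mul_bdd (hhW j k).aestronglyMeasurable
      (Filter.Eventually.of_forall fun ω => hh1 _ _ _)
  have Eah : ∀ j k, ∫ ω, (S j k - (1 / 2) * Y j k ω) * h j k (W ω) ∂P =
      S j k * ∫ ω, h j k (W ω) ∂P - (1 / 2) * ∫ ω, a ω j * D ω k * h j k (W ω) ∂P := by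
    intro j k
    rw [ce_mul hW (haD j k) (hh j k) (hh1 j k), ← integral_const_mul, ← integral_const_mul,
      ← integral_sub]
    · congr 1; funext ω; ring
    · exact (ih j k).const_mul _
    · have : Integrable (fun ω => Y j k ω * h j k (W ω)) P :=
        (iY j k).mul_bdd (hhW j k).aestronglyMeasurable
          (Filter.Eventually.of_forall fun ω => hh1 _ _ _)
      exact this.const_mul _
  -- main identity
  have key : ∫ ω, (∑ j, ∑ k, S j k * h j k (W ω) - ∑ j, W ω j * g j (W ω)) ∂P =
      ∫ ω, (∑ j, R ω j * g j (W ω)) ∂P +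
      ∫ ω, (∑ j, ∑ k, (S j k - (1 / 2) * Y j k ω) * h j k (W ω)) ∂P - (1 / 2) * ∫ ω, rem ω ∂P := by
    rw [Erem, integral_finsetSum _ (fun j _ => iRg j),
      integral_finsetSum _ (fun j _ => integrable_finsetSum _ fun k _ => iYh j k), integral_sub,
      integral_finsetSum _ (fun j _ => iWg j), integral_finsetSum]
    · have e1 : ∀ j, ∫ ω, ∑ k, S j k * h j k (W ω) ∂P = ∑ k, S j k * ∫ ω, h j k (W ω) ∂P := by
        intro j
        rw [integral_finsetSum _ (fun k _ => (ih j k).const_mul _)]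
        simp only [integral_const_mul]
      have e2 : ∀ j, ∫ ω, ∑ k, (S j k - (1 / 2) * Y j k ω) * h j k (W ω) ∂P =
          ∑ k, S j k * ∫ ω, h j k (W ω) ∂P -
            (1 / 2) * ∑ k, ∫ ω, a ω j * D ω k * h j k (W ω) ∂P := by
        intro j
        rw [integral_finsetSum _ (fun k _ => iYh j k), Finset.mul_sum, ← Finset.sum_sub_distrib]
        exact Finset.sum_congr rfl fun k _ => Eah j k
      simp only [e1, e2, Eag]
      rw [Finset.sum_sub_distrib, Finset.sum_sub_distrib, ← Finset.mul_sum,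
        Finset.sum_neg_distrib]
      ring
    · intro j _; exact integrable_finsetSum _ fun k _ => (ih j k).const_mul _
    · exact integrable_finsetSum _ fun j _ => integrable_finsetSum _ fun k _ => (ih j k).const_mul _
    · exact integrable_finsetSum _ fun j _ => iWg j
  -- bounds of the three pieces
  have b1 : |∫ ω, (∑ j, R ω j * g j (W ω)) ∂P| ≤ B1 * ∫ ω, ⨆ j, |R ω j| ∂P := by
    rw [← integral_const_mul]
    refine (abs_integral_le_integral_abs).trans (integral_mono ?_ ?_ ?_)
    · exact (integrable_finsetSum _ fun j _ => iRg j).abs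
    · exact (integrable_iSup_fin fun j => (hRI j).abs).const_mul _
    · intro ω
      simp only
      calc |∑ j, R ω j * g j (W ω)| ≤ ∑ j, |R ω j * g j (W ω)| := Finset.abs_sum_le_sum_abs _ _
        _ ≤ ∑ j, (⨆ j, |R ω j|) * |g j (W ω)| := by
            apply Finset.sum_le_sum; intro j _
            rw [abs_mul]
            gcongr
            exact le_sup1 (fun j => |R ω j|) j
        _ = (∑ j, |g j (W ω)|) * ⨆ j, |R ω j| := by rw [← Finset.mul_sum, mul_comm]
        _ ≤ B1 * ⨆ j, |R ω j| := by
            gcongr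
            · exact Real.iSup_nonneg fun j => abs_nonneg _
            · exact hB1 _
  have b2 : |∫ ω, (∑ j, ∑ k, (S j k - (1 / 2) * Y j k ω) * h j k (W ω)) ∂P| ≤
      B2 * ∫ ω, ⨆ j, ⨆ k, |S j k - (1 / 2) * Y j k ω| ∂P := by
    rw [← integral_const_mul]
    refine (abs_integral_le_integral_abs).trans (integral_mono ?_ ?_ ?_)
    · exact (integrable_finsetSum _ fun j _ => integrable_finsetSum _ fun k _ => iYh j k).abs
    · exact (integrable_iSup_fin fun j => integrable_iSup_fin fun k =>
        ((integrable_const (S j k)).sub ((iY j k).const_mul _)).abs).const_mul _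
    · intro ω
      simp only
      calc |∑ j, ∑ k, (S j k - (1 / 2) * Y j k ω) * h j k (W ω)|
          ≤ ∑ j, ∑ k, |(S j k - (1 / 2) * Y j k ω) * h j k (W ω)| :=
            (Finset.abs_sum_le_sum_abs _ _).trans
              (Finset.sum_le_sum fun j _ => Finset.abs_sum_le_sum_abs _ _)
        _ ≤ ∑ j, ∑ k, (⨆ j, ⨆ k, |S j k - (1 / 2) * Y j k ω|) * |h j k (W ω)| := by
            apply Finset.sum_le_sum; intro j _
            apply Finset.sum_le_sum; intro k _
            rw [abs_mul]
            gcongr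
            exact le_sup2 (fun j k => |S j k - (1 / 2) * Y j k ω|) j k
        _ = (∑ j, ∑ k, |h j k (W ω)|) * ⨆ j, ⨆ k, |S j k - (1 / 2) * Y j k ω| := by
            simp only [← Finset.mul_sum]; rw [mul_comm]
        _ ≤ _ := by
            gcongr
            · exact Real.iSup_nonneg fun j => Real.iSup_nonneg fun k => abs_nonneg _
            · exact hB2 _
  set V : Fin d → Fin d → Fin d → Fin d → Ω → ℝ := fun j k l m =>
    P[fun ω' => |a ω' j * D ω' k * D ω' l * D ω' m| | (MeasurableSpace.comap W inferInstance)] with hV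
  have iV : ∀ j k l m, Integrable (V j k l m) P := fun j k l m => integrable_condExp
  have V0 : ∀ᵐ ω ∂P, ∀ j k l m, 0 ≤ V j k l m ω := by
    simp only [ae_all_iff]
    intro j k l m
    have : 0 ≤ᵐ[P] V j k l m := condExp_nonneg (Filter.Eventually.of_forall fun ω => abs_nonneg _)
    exact this
  have iQ : Integrable (fun ω => ⨆ j, ⨆ k, ⨆ l, ⨆ m, |a ω j * D ω k * D ω l * D ω m|) P :=
    integrable_iSup_fin fun j => integrable_iSup_fin fun k => integrable_iSup_fin fun l =>
      integrable_iSup_fin fun m => haDDD j k l m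
  have Q0 : ∀ ω, 0 ≤ ⨆ j, ⨆ k, ⨆ l, ⨆ m, |a ω j * D ω k * D ω l * D ω m| := fun ω =>
    Real.iSup_nonneg fun _ => Real.iSup_nonneg fun _ => Real.iSup_nonneg fun _ =>
      Real.iSup_nonneg fun _ => abs_nonneg _
  have hset : MeasurableSet {ω | η < ‖D ω‖} := measurableSet_lt measurable_const hDm.norm
  have iaM : ∀ j k l m, Integrable (fun ω => |a ω j * D ω k * D ω l * D ω m| * M j k l m (W ω)) P :=
    fun j k l m => (haDDD j k l m).mul_bdd ((hM j k l m).comp hW).aestronglyMeasurable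
      (Filter.Eventually.of_forall fun ω => hM1 _ _ _ _ _)
  have iVM : ∀ j k l m, Integrable (fun ω => V j k l m ω * M j k l m (W ω)) P :=
    fun j k l m => (iV j k l m).mul_bdd ((hM j k l m).comp hW).aestronglyMeasurable
      (Filter.Eventually.of_forall fun ω => hM1 _ _ _ _ _)
  have b3 : |∫ ω, rem ω ∂P| ≤ B4 * ((∫ ω, ⨆ j, ⨆ k, ⨆ l, ⨆ m, V j k l m ω ∂P) +
      ∫ ω in {ω | η < ‖D ω‖}, ⨆ j, ⨆ k, ⨆ l, ⨆ m, |a ω j * D ω k * D ω l * D ω m| ∂P) := by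
    have i1 : Integrable (fun ω => ∑ j, ∑ k, ∑ l, ∑ m,
        |a ω j * D ω k * D ω l * D ω m| * M j k l m (W ω)) P :=
      integrable_finsetSum _ fun j _ => integrable_finsetSum _ fun k _ =>
        integrable_finsetSum _ fun l _ => integrable_finsetSum _ fun m _ => iaM j k l m
    have i1V : Integrable (fun ω => ∑ j, ∑ k, ∑ l, ∑ m, V j k l m ω * M j k l m (W ω)) P :=
      integrable_finsetSum _ fun j _ => integrable_finsetSum _ fun k _ =>
        integrable_finsetSum _ fun l _ => integrable_finsetSum _ fun m _ => iVM j k l m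
    have i2 : Integrable ({ω | η < ‖D ω‖}.indicator fun ω =>
        B4 * ⨆ j, ⨆ k, ⨆ l, ⨆ m, |a ω j * D ω k * D ω l * D ω m|) P :=
      (iQ.const_mul B4).indicator hset
    have hpt : ∀ ω, |rem ω| ≤ (∑ j, ∑ k, ∑ l, ∑ m,
        |a ω j * D ω k * D ω l * D ω m| * M j k l m (W ω)) + ({ω | η < ‖D ω‖}.indicator fun ω =>
        B4 * ⨆ j, ⨆ k, ⨆ l, ⨆ m, |a ω j * D ω k * D ω l * D ω m|) ω := by
      intro ω
      have hs0 : 0 ≤ ∑ j, ∑ k, ∑ l, ∑ m,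
          |a ω j * D ω k * D ω l * D ω m| * M j k l m (W ω) :=
        Finset.sum_nonneg fun _ _ => Finset.sum_nonneg fun _ _ => Finset.sum_nonneg fun _ _ =>
          Finset.sum_nonneg fun _ _ => mul_nonneg (abs_nonneg _) (hM0 _ _ _ _ _)
      by_cases hc : η < ‖D ω‖
      · rw [Set.indicator_of_mem (show ω ∈ {ω | η < ‖D ω‖} from hc)]
        have := hrem' (W ω) (D ω) (a ω)
        rw [← hWD ω] at this
        have h5 : |rem ω| ≤ B4 * ⨆ j, ⨆ k, ⨆ l, ⨆ m, |a ω j * D ω k * D ω l * D ω m| := by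
          refine le_trans ?_ (this.trans_eq (mul_comm _ _))
          exact le_rfl
        linarith
      · rw [Set.indicator_of_notMem (show ω ∉ {ω | η < ‖D ω‖} from hc), add_zero]
        have := hrem (W ω) (D ω) (a ω) (not_lt.1 hc)
        rw [← hWD ω] at this
        exact this
    have e1 : ∫ ω, (∑ j, ∑ k, ∑ l, ∑ m,
        |a ω j * D ω k * D ω l * D ω m| * M j k l m (W ω)) ∂P =
        ∫ ω, (∑ j, ∑ k, ∑ l, ∑ m, V j k l m ω * M j k l m (W ω)) ∂P := by
      rw [integral_finsetSum _ fun j _ => integrable_finsetSum _ fun k _ =>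
        integrable_finsetSum _ fun l _ => integrable_finsetSum _ fun m _ => iaM j k l m,
        integral_finsetSum _ fun j _ => integrable_finsetSum _ fun k _ =>
        integrable_finsetSum _ fun l _ => integrable_finsetSum _ fun m _ => iVM j k l m]
      apply Finset.sum_congr rfl; intro j _
      rw [integral_finsetSum _ fun k _ =>
        integrable_finsetSum _ fun l _ => integrable_finsetSum _ fun m _ => iaM j k l m,
        integral_finsetSum _ fun k _ =>
        integrable_finsetSum _ fun l _ => integrable_finsetSum _ fun m _ => iVM j k l m]
      apply Finset.sum_congr rfl; intro k _
      rw [integral_finsetSum _ fun l _ => integrable_finsetSum _ fun m _ => iaM j k l m,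
        integral_finsetSum _ fun l _ => integrable_finsetSum _ fun m _ => iVM j k l m]
      apply Finset.sum_congr rfl; intro l _
      rw [integral_finsetSum _ fun m _ => iaM j k l m, integral_finsetSum _ fun m _ => iVM j k l m]
      apply Finset.sum_congr rfl; intro m _
      exact ce_mul hW (haDDD j k l m) (hM j k l m) (hM1 j k l m)
    have e2 : ∫ ω, (∑ j, ∑ k, ∑ l, ∑ m, V j k l m ω * M j k l m (W ω)) ∂P ≤
        B4 * ∫ ω, ⨆ j, ⨆ k, ⨆ l, ⨆ m, V j k l m ω ∂P := by
      rw [← integral_const_mul]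
      apply integral_mono_ae i1V
      · exact (integrable_iSup_fin fun j => integrable_iSup_fin fun k => integrable_iSup_fin
          fun l => integrable_iSup_fin fun m => iV j k l m).const_mul _
      · filter_upwards [V0] with ω hω
        calc ∑ j, ∑ k, ∑ l, ∑ m, V j k l m ω * M j k l m (W ω)
            ≤ ∑ j, ∑ k, ∑ l, ∑ m, (⨆ j, ⨆ k, ⨆ l, ⨆ m, V j k l m ω) * M j k l m (W ω) := by
              apply Finset.sum_le_sum; intro j _
              apply Finset.sum_le_sum; intro k _
              apply Finset.sum_le_sum; intro l _
              apply Finset.sum_le_sum; intro m _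
              exact mul_le_mul_of_nonneg_right (le_sup4 (fun j k l m => V j k l m ω) j k l m)
                (hM0 _ _ _ _ _)
          _ = (∑ j, ∑ k, ∑ l, ∑ m, M j k l m (W ω)) * ⨆ j, ⨆ k, ⨆ l, ⨆ m, V j k l m ω := by
              simp only [← Finset.mul_sum]; rw [mul_comm]
          _ ≤ _ := by
              refine mul_le_mul_of_nonneg_right (hB4 _) ?_
              exact Real.iSup_nonneg fun j => Real.iSup_nonneg fun k => Real.iSup_nonneg fun l =>
                Real.iSup_nonneg fun m => hω j k l m
    calc |∫ ω, rem ω ∂P| ≤ ∫ ω, |rem ω| ∂P := abs_integral_le_integral_abs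
      _ ≤ ∫ ω, ((∑ j, ∑ k, ∑ l, ∑ m,
        |a ω j * D ω k * D ω l * D ω m| * M j k l m (W ω)) + ({ω | η < ‖D ω‖}.indicator fun ω =>
        B4 * ⨆ j, ⨆ k, ⨆ l, ⨆ m, |a ω j * D ω k * D ω l * D ω m|) ω) ∂P :=
          integral_mono irem.abs (i1.add i2) hpt
      _ = _ := integral_add i1 i2
      _ ≤ _ := by
          rw [e1, integral_indicator hset, integral_const_mul, mul_add]
          gcongr
  have hB4s : 0 ≤ B4 * ((∫ ω, ⨆ j, ⨆ k, ⨆ l, ⨆ m, V j k l m ω ∂P) +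
      ∫ ω in {ω | η < ‖D ω‖}, ⨆ j, ⨆ k, ⨆ l, ⨆ m, |a ω j * D ω k * D ω l * D ω m| ∂P) :=
    (abs_nonneg _).trans b3
  rw [key]
  have t1 := abs_sub (∫ ω, (∑ j, R ω j * g j (W ω)) ∂P +
      ∫ ω, (∑ j, ∑ k, (S j k - (1 / 2) * Y j k ω) * h j k (W ω)) ∂P) ((1 / 2) * ∫ ω, rem ω ∂P)
  have t2 := abs_add_le (∫ ω, (∑ j, R ω j * g j (W ω)) ∂P)
      (∫ ω, (∑ j, ∑ k, (S j k - (1 / 2) * Y j k ω) * h j k (W ω)) ∂P)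
  have t3 : |(1 / 2) * ∫ ω, rem ω ∂P| = (1 / 2) * |∫ ω, rem ω ∂P| := by
    rw [abs_mul]; norm_num
  linarith


lemma ee_le {d : ℕ} (k i : Fin d) : ee k i ≤ 1 := by
  unfold ee; by_cases h : i = k
  · subst h; simp
  · simp [Pi.single_apply, h]

lemma rem_core {d : ℕ} (a b : Fin d → ℝ) (τ : ℝ) (y w α : Fin d → ℝ) (M : ℝ)
    (hM : ∀ u ∈ Set.Icc (0:ℝ) 1, |∑ j, α j * ∑ k, w k * ∑ l, w l * ∑ m, w m *
      Gp (RF a b τ) (ee j + ee k + ee l + ee m) (fun i => y i + u * w i)| ≤ M) :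
    |∑ j, α j * (Gp (RF a b τ) (ee j) (fun i => y i + w i) - Gp (RF a b τ) (ee j) y) -
      (1 / 2) * ∑ j, ∑ k, α j * w k * (Gp (RF a b τ) (ee j + ee k) y +
        Gp (RF a b τ) (ee j + ee k) (fun i => y i + w i))| ≤ (1 / 2) * M := by
  set F := RF a b τ with hF
  have hder : ∀ n : Fin d → ℕ, (∀ i, n i ≤ 3) → ∀ u,
      HasDerivAt (fun u => Gp F n (fun i => y i + u * w i))
        (∑ k, w k * Gp F (n + ee k) (fun i => y i + u * w i)) u := fun n hn u =>
    Gp_hasDerivAt F n y w u fun i z => RF_hasDerivAt a b τ i (n i) (hn i) z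
  have h := trapezoid (fun u => ∑ j, α j * Gp F (ee j) (fun i => y i + u * w i))
    (fun u => ∑ j, α j * ∑ k, w k * Gp F (ee j + ee k) (fun i => y i + u * w i))
    (fun u => ∑ j, α j * ∑ k, w k * ∑ l, w l * Gp F (ee j + ee k + ee l) (fun i => y i + u * w i))
    (fun u => ∑ j, α j * ∑ k, w k * ∑ l, w l * ∑ m, w m *
      Gp F (ee j + ee k + ee l + ee m) (fun i => y i + u * w i))
    (fun u => HasDerivAt.fun_sum fun j _ => (hder _ (fun i => by
      have := ee_le j i; omega) u).const_mul _)
    (fun u => HasDerivAt.fun_sum fun j _ => (HasDerivAt.fun_sum fun k _ =>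
      (hder _ (fun i => by
        have := ee_le j i; have := ee_le k i; simp only [Pi.add_apply]; omega) u).const_mul _).const_mul _)
    (fun u => HasDerivAt.fun_sum fun j _ => (HasDerivAt.fun_sum fun k _ =>
      (HasDerivAt.fun_sum fun l _ => (hder _ (fun i => by
        have := ee_le j i; have := ee_le k i; have := ee_le l i
        simp only [Pi.add_apply]; omega) u).const_mul _).const_mul _).const_mul _) M hM
  simp only [zero_mul, add_zero, one_mul] at h
  convert h using 3
  · rw [← Finset.sum_sub_distrib]; exact Finset.sum_congr rfl fun j _ => by ring
  · congr 1
    rw [← Finset.sum_add_distrib]; refine Finset.sum_congr rfl fun j _ => ?_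
    rw [← mul_add, ← Finset.sum_add_distrib, Finset.mul_sum]
    exact Finset.sum_congr rfl fun k _ => by ring

lemma sum4_abs {d : ℕ} (α w : Fin d → ℝ) (G M : Fin d → Fin d → Fin d → Fin d → ℝ)
    (hG : ∀ j k l m, |G j k l m| ≤ M j k l m) :
    |∑ j, α j * ∑ k, w k * ∑ l, w l * ∑ m, w m * G j k l m| ≤
      ∑ j, ∑ k, ∑ l, ∑ m, |α j * w k * w l * w m| * M j k l m := by
  simp only [Finset.mul_sum]
  refine (Finset.abs_sum_le_sum_abs _ _).trans (Finset.sum_le_sum fun j _ => ?_)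
  refine (Finset.abs_sum_le_sum_abs _ _).trans (Finset.sum_le_sum fun k _ => ?_)
  refine (Finset.abs_sum_le_sum_abs _ _).trans (Finset.sum_le_sum fun l _ => ?_)
  refine (Finset.abs_sum_le_sum_abs _ _).trans (Finset.sum_le_sum fun m _ => ?_)
  rw [show α j * (w k * (w l * (w m * G j k l m))) = (α j * w k * w l * w m) * G j k l m by ring,
    abs_mul]
  exact mul_le_mul_of_nonneg_left (hG _ _ _ _) (abs_nonneg _)

lemma Gp_RF_continuous {d : ℕ} (a b : Fin d → ℝ) (τ : ℝ) (n : Fin d → ℕ) :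
    Continuous (Gp (RF a b τ) n) := by
  unfold Gp
  exact continuous_finset_prod _ fun i _ => (RF_continuous a b τ i (n i)).comp (continuous_apply i)

/-- concrete bound for exchangeable pairs -/
lemma exch_rect {d : ℕ} {Ω : Type} [MeasurableSpace Ω] (P : Measure Ω) [IsProbabilityMeasure P]
    (W W' : Ω → Fin d → ℝ) (hW : Measurable W) (hW' : Measurable W')
    (hWi : ∀ j, Integrable (fun ω => W ω j) P)
    (hex : Measure.map (fun ω => (W ω, W' ω)) P = Measure.map (fun ω => (W' ω, W ω)) P)
    (Λ : Matrix (Fin d) (Fin d) ℝ) (hΛ : Λ.det ≠ 0) (R : Ω → Fin d → ℝ)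
    (hR : P[fun ω => W' ω - W ω | MeasurableSpace.comap W inferInstance]
          =ᵐ[P] fun ω => -Λ.mulVec (W ω + R ω))
    (D : Ω → Fin d → ℝ) (hD : D = (fun ω => W' ω - W ω)) (hD4 : Integrable (fun ω => ‖D ω‖ ^ 4) P)
    (S : Matrix (Fin d) (Fin d) ℝ) (η : ℝ)
    (hd : 3 ≤ d) (L : ℝ) (hL1 : 1 ≤ L) (hL : L ^ 2 = Real.log d)
    (a b : Fin d → ℝ) (hab : ∀ i, a i ≤ b i) (τ e c : ℝ) (hτ : 0 < τ) (he : 0 ≤ e) (heL : e ≤ 2 / L)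
    (hc : 0 ≤ c) (hcη : c * η ≤ e * τ) (z : Fin d → ℝ) :
    |∫ ω, (∑ j, ∑ k, S j k * (c * Gp (RF a b τ) (ee j + ee k) (fun i => c * W ω i + z i)) -
        ∑ j, W ω j * Gp (RF a b τ) (ee j) (fun i => c * W ω i + z i)) ∂P| ≤
      K2 * (L / τ) * (∫ ω, ⨆ j, |R ω j| ∂P) +
      c * (K2 * (L / τ) ^ 2) * (∫ ω, ⨆ j, ⨆ k, |S j k - (1 / 2) *
            (P[fun ω' => Λ⁻¹.mulVec (D ω') j * D ω' k |
                MeasurableSpace.comap W inferInstance]) ω| ∂P) +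
      c ^ 3 * (K2 * (L / τ) ^ 4) * ((∫ ω, ⨆ j, ⨆ k, ⨆ l, ⨆ m,
          (P[fun ω' => |Λ⁻¹.mulVec (D ω') j * D ω' k * D ω' l * D ω' m| |
              MeasurableSpace.comap W inferInstance]) ω ∂P) +
        ∫ ω in {ω | η < ‖D ω‖}, ⨆ j, ⨆ k, ⨆ l, ⨆ m,
          |Λ⁻¹.mulVec (D ω) j * D ω k * D ω l * D ω m| ∂P) := by
  have hcont : Continuous (fun (x : Fin d → ℝ) (i : Fin d) => c * x i + z i) := by fun_prop
  have h0L : 0 ≤ 2 / L := by positivity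
  have n4 : ∀ (j k l m : Fin d) i, (ee j + ee k + ee l + ee m) i ≤ 4 := by
    intro j k l m i
    have := ee_le j i; have := ee_le k i; have := ee_le l i; have := ee_le m i
    simp only [Pi.add_apply]; omega
  have n2 : ∀ (j k : Fin d) i, (ee j + ee k) i ≤ 4 := by
    intro j k i
    have := ee_le j i; have := ee_le k i
    simp only [Pi.add_apply]; omega
  have n1 : ∀ (j : Fin d) i, (ee j) i ≤ 4 := by
    intro j i
    have := ee_le j i; omega
  have bd : ∀ (n : Fin d → ℕ), (∀ i, n i ≤ 4) → ∀ y, |Gp (RF a b τ) n y| ≤ RM a b τ L 0 n y :=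
    fun n hn y => Gp_RF_bound hd L hL1 hL a b τ 0 hτ le_rfl h0L y y (by simp) hab n hn
  -- common remainder reduction
  have hred : ∀ (x v α : Fin d → ℝ) (B : ℝ), (∀ u ∈ Set.Icc (0:ℝ) 1,
      |∑ j, α j * ∑ k, (c * v k) * ∑ l, (c * v l) * ∑ m, (c * v m) *
        Gp (RF a b τ) (ee j + ee k + ee l + ee m) (fun i => (c * x i + z i) + u * (c * v i))| ≤ B) →
      |∑ j, α j * (Gp (RF a b τ) (ee j) (fun i => c * (x + v) i + z i) -
        Gp (RF a b τ) (ee j) (fun i => c * x i + z i)) -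
        (1 / 2) * ∑ j, ∑ k, α j * v k * (c * Gp (RF a b τ) (ee j + ee k) (fun i => c * x i + z i) +
          c * Gp (RF a b τ) (ee j + ee k) (fun i => c * (x + v) i + z i))| ≤ B := by
    intro x v α B hB
    have hB0 : 0 ≤ B := (abs_nonneg _).trans (hB 0 ⟨le_rfl, zero_le_one⟩)
    have h := rem_core a b τ (fun i => c * x i + z i) (fun i => c * v i) α B hB
    have e1 : (fun i => c * (x + v) i + z i) = fun i => c * x i + z i + c * v i := by
      funext i; simp only [Pi.add_apply]; ring
    rw [e1]
    refine le_trans (le_of_eq ?_) (h.trans (by linarith))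
    congr 3
    refine Finset.sum_congr rfl fun j _ => Finset.sum_congr rfl fun k _ => ?_
    ring
  have hscale : ∀ (α v : Fin d → ℝ) j k l m, |α j * (c * v k) * (c * v l) * (c * v m)| =
      c ^ 3 * |α j * v k * v l * v m| := by
    intro α v j k l m
    rw [show α j * (c * v k) * (c * v l) * (c * v m) = c ^ 3 * (α j * v k * v l * v m) by ring,
      abs_mul, abs_of_nonneg (by positivity)]
  refine exch_abstract P W W' hW hW' hWi hex Λ hΛ R hR D hD hD4 S η
    (fun j x => Gp (RF a b τ) (ee j) (fun i => c * x i + z i))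
    (fun j k x => c * Gp (RF a b τ) (ee j + ee k) (fun i => c * x i + z i))
    (fun j k l m x => c ^ 3 * RM a b τ L e (ee j + ee k + ee l + ee m) (fun i => c * x i + z i))
    (fun j => ((Gp_RF_continuous a b τ _).comp hcont).measurable)
    (fun j k => (((Gp_RF_continuous a b τ _).comp hcont).measurable).const_mul c)
    (fun j k l m => (((RM_continuous a b τ L e _).comp hcont).measurable).const_mul _)
    (fun j k l m x => mul_nonneg (by positivity) (RM_nonneg hd L hL1 a b τ e hτ he _ hab _))
    (K2 * (L / τ)) (c * (K2 * (L / τ) ^ 2)) (c ^ 3 * (K2 * (L / τ) ^ 4)) ?_ ?_ ?_ ?_ ?_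
  · intro x
    refine le_trans (Finset.sum_le_sum fun j _ => bd _ (n1 j) _)
      (RM_sum1 hd L hL1 a b τ 0 hτ le_rfl _ hab)
  · intro x
    simp only [abs_mul, abs_of_nonneg hc, ← Finset.mul_sum]
    refine mul_le_mul_of_nonneg_left ?_ hc
    refine le_trans (Finset.sum_le_sum fun j _ => Finset.sum_le_sum fun k _ => bd _ (n2 j k) _)
      (RM_sum2 hd L hL1 a b τ 0 hτ le_rfl _ hab)
  · intro x
    simp only [← Finset.mul_sum]
    exact mul_le_mul_of_nonneg_left (RM_sum4 hd L hL1 a b τ e hτ he _ hab) (by positivity)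
  · intro x v α hv
    apply hred
    intro u hu
    refine (sum4_abs α (fun i => c * v i) _
      (fun j k l m => RM a b τ L e (ee j + ee k + ee l + ee m) (fun i => c * x i + z i)) ?_).trans ?_
    · intro j k l m
      refine Gp_RF_bound hd L hL1 hL a b τ e hτ he heL _ _ ?_ hab _ (n4 j k l m)
      intro i
      have hvi : |v i| ≤ η := (norm_le_pi_norm v i).trans hv
      rw [show c * x i + z i + u * (c * v i) - (c * x i + z i) = u * (c * v i) by ring, abs_mul,
        abs_mul, abs_of_nonneg hu.1, abs_of_nonneg hc]
      have h1 : c * |v i| ≤ e * τ := (mul_le_mul_of_nonneg_left hvi hc).trans hcη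
      have h2 : 0 ≤ c * |v i| := by positivity
      nlinarith [hu.2]
    · refine le_of_eq (Finset.sum_congr rfl fun j _ => Finset.sum_congr rfl fun k _ =>
        Finset.sum_congr rfl fun l _ => Finset.sum_congr rfl fun m _ => ?_)
      simp only [hscale]; ring
  · intro x v α
    apply hred
    intro u hu
    set y : Fin d → ℝ := fun i => c * x i + z i + u * (c * v i) with hy
    refine (sum4_abs α (fun i => c * v i) _
      (fun j k l m => RM a b τ L 0 (ee j + ee k + ee l + ee m) y) fun j k l m => bd _ (n4 _ _ _ _) _).trans ?_
    set Q := ⨆ j, ⨆ k, ⨆ l, ⨆ m, |α j * v k * v l * v m| with hQ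
    have hQ0 : 0 ≤ Q := Real.iSup_nonneg fun _ => Real.iSup_nonneg fun _ => Real.iSup_nonneg fun _ =>
      Real.iSup_nonneg fun _ => abs_nonneg _
    calc _ ≤ ∑ j, ∑ k, ∑ l, ∑ m, (Q * c ^ 3) * RM a b τ L 0 (ee j + ee k + ee l + ee m) y := by
          refine Finset.sum_le_sum fun j _ => Finset.sum_le_sum fun k _ =>
            Finset.sum_le_sum fun l _ => Finset.sum_le_sum fun m _ => ?_
          refine mul_le_mul_of_nonneg_right ?_ (RM_nonneg hd L hL1 a b τ 0 hτ le_rfl _ hab _)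
          rw [hscale, mul_comm]
          exact mul_le_mul_of_nonneg_right (le_sup4 (fun j k l m => |α j * v k * v l * v m|) j k l m)
            (by positivity)
      _ = (Q * c ^ 3) * ∑ j, ∑ k, ∑ l, ∑ m, RM a b τ L 0 (ee j + ee k + ee l + ee m) y := by
          simp only [← Finset.mul_sum]
      _ ≤ (Q * c ^ 3) * (K2 * (L / τ) ^ 4) :=
          mul_le_mul_of_nonneg_left (RM_sum4 hd L hL1 a b τ 0 hτ le_rfl _ hab) (by positivity)
      _ = _ := by ring


def stdG (d : ℕ) : Measure (Fin d → ℝ) := Measure.pi (fun _ => gaussianReal 0 1)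

instance (d : ℕ) : IsProbabilityMeasure (stdG d) := by unfold stdG; infer_instance

lemma stdG_eq (d : ℕ) : stdG d =
    volume.withDensity (fun x : Fin d → ℝ => ENNReal.ofReal (∏ i, gaussianPDFReal 0 1 (x i))) := by
  unfold stdG
  refine Measure.pi_eq fun s hs => ?_
  rw [withDensity_apply _ (MeasurableSet.univ_pi hs)]
  rw [volume_pi, Measure.restrict_pi_pi]
  have hi : Integrable (fun x : Fin d → ℝ => ∏ i, gaussianPDFReal 0 1 (x i))
      (Measure.pi fun i => volume.restrict (s i)) :=
    Integrable.fintype_prod (fun i => (integrable_gaussianPDFReal 0 1).restrict)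
  rw [← ofReal_integral_eq_lintegral_ofReal hi (Filter.Eventually.of_forall fun x =>
    Finset.prod_nonneg fun i _ => gaussianPDFReal_nonneg _ _ _)]
  rw [integral_fintype_prod_eq_prod (fun _ => gaussianPDFReal 0 1),
    ENNReal.ofReal_prod_of_nonneg (fun i _ => integral_nonneg fun x => gaussianPDFReal_nonneg _ _ _)]
  refine Finset.prod_congr rfl fun i _ => ?_
  rw [gaussianReal_apply_eq_integral _ one_ne_zero]

lemma stdG_density (d : ℕ) (x : Fin d → ℝ) : ∏ i, gaussianPDFReal 0 1 (x i) =
    (2 * π) ^ (-(d : ℝ) / 2) * Real.exp (-(1 / 2) * (x ⬝ᵥ x)) := by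
  simp only [gaussianPDFReal, NNReal.coe_one, mul_one, sub_zero]
  rw [Finset.prod_mul_distrib, ← Real.exp_sum]
  congr 1
  · rw [Finset.prod_const, Finset.card_univ, Fintype.card_fin, Real.sqrt_eq_rpow, ← Real.rpow_neg (by positivity),
      ← Real.rpow_natCast, ← Real.rpow_mul (by positivity)]
    congr 1; ring
  · congr 1
    rw [dotProduct, Finset.mul_sum]
    exact Finset.sum_congr rfl fun i _ => by ring

lemma posDef_factor {d : ℕ} (S : Matrix (Fin d) (Fin d) ℝ) (hS : S.PosDef) :
    ∃ B : Matrix (Fin d) (Fin d) ℝ, B.det ≠ 0 ∧ S = B * Bᵀ := by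
  open scoped MatrixOrder in
  obtain ⟨B, hB⟩ := CStarAlgebra.nonneg_iff_eq_star_mul_self.mp hS.posSemidef.nonneg
  have hB' : S = Bᵀ * B := hB
  refine ⟨Bᵀ, ?_, by simpa using hB'⟩
  intro h
  have := hS.det_pos
  rw [hB', det_mul, h] at this
  simp at this

lemma gm_eq_map {d : ℕ} (S B : Matrix (Fin d) (Fin d) ℝ) (hB : B.det ≠ 0) (hS : S = B * Bᵀ) :
    gaussianMeasure d S = (stdG d).map B.mulVec := by
  have hm : Measurable B.mulVec := by
    have : Continuous (fun v : Fin d → ℝ => B.mulVec v) := by fun_prop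
    exact this.measurable
  have hmi : Measurable B⁻¹.mulVec := by
    have : Continuous (fun v : Fin d → ℝ => B⁻¹.mulVec v) := by fun_prop
    exact this.measurable
  have hvol := Real.map_matrix_volume_pi_eq_smul_volume_pi hB
  have hvol' : Measure.map B.mulVec (volume : Measure (Fin d → ℝ)) =
    ENNReal.ofReal (abs (det B)⁻¹) • volume := hvol
  have hu : IsUnit B.det := isUnit_iff_ne_zero.2 hB
  have hinv : ∀ x, B⁻¹.mulVec (B.mulVec x) = x := by
    intro x; rw [mulVec_mulVec, nonsing_inv_mul _ hu, one_mulVec]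
  have hfm : Measurable (fun x : Fin d → ℝ => ENNReal.ofReal (∏ i, gaussianPDFReal 0 1 (x i))) := by
    have : Measurable (gaussianPDFReal 0 1) := measurable_gaussianPDFReal 0 1
    fun_prop
  have hfmi : Measurable (fun y : Fin d → ℝ =>
      ENNReal.ofReal (∏ i, gaussianPDFReal 0 1 (B⁻¹.mulVec y i))) := hfm.comp hmi
  ext E hE
  rw [Measure.map_apply hm hE, stdG_eq, withDensity_apply _ (hm hE), gaussianMeasure,
    withDensity_apply _ hE]
  have h1 : ∫⁻ x in B.mulVec ⁻¹' E, ENNReal.ofReal (∏ i, gaussianPDFReal 0 1 (x i)) =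
      ∫⁻ x in B.mulVec ⁻¹' E,
        (fun y => ENNReal.ofReal (∏ i, gaussianPDFReal 0 1 (B⁻¹.mulVec y i))) (B.mulVec x) := by
    simp only [hinv]
  rw [h1, ← setLIntegral_map hE hfmi hm, hvol', Measure.restrict_smul,
    lintegral_smul_measure, smul_eq_mul, ← lintegral_const_mul _ hfmi]
  refine lintegral_congr fun y => ?_
  rw [← ENNReal.ofReal_mul (abs_nonneg _)]
  congr 1
  rw [stdG_density, gaussianPdf]
  have e1 : S.det ^ (-(1:ℝ) / 2) = |B.det⁻¹| := by
    rw [hS, det_mul, det_transpose, show -(1:ℝ)/2 = -(1/2) by ring, ← sq, Real.rpow_neg (by positivity),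
      ← Real.sqrt_eq_rpow, Real.sqrt_sq_eq_abs, abs_inv]
  have e2 : y ⬝ᵥ S⁻¹.mulVec y = B⁻¹.mulVec y ⬝ᵥ B⁻¹.mulVec y := by
    rw [hS, Matrix.mul_inv_rev, ← mulVec_mulVec, dotProduct_mulVec, ← transpose_nonsing_inv,
      vecMul_transpose]
  rw [e1, e2]; ring

lemma gm_prob {d : ℕ} (S : Matrix (Fin d) (Fin d) ℝ) (hS : S.PosDef) :
    IsProbabilityMeasure (gaussianMeasure d S) := by
  obtain ⟨B, hB, h⟩ := posDef_factor S hS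
  rw [gm_eq_map S B hB h]
  have hm : Measurable B.mulVec := by
    have : Continuous (fun v : Fin d → ℝ => B.mulVec v) := by fun_prop
    exact this.measurable
  exact Measure.isProbabilityMeasure_map hm.aemeasurable

lemma ext_cf {d : ℕ} (μ ν : Measure (Fin d → ℝ)) [IsProbabilityMeasure μ] [IsProbabilityMeasure ν]
    (h : ∀ t : Fin d → ℝ, ∫ x, Complex.exp (((t ⬝ᵥ x : ℝ) : ℂ) * Complex.I) ∂μ =
      ∫ x, Complex.exp (((t ⬝ᵥ x : ℝ) : ℂ) * Complex.I) ∂ν) : μ = ν := by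
  apply Measure.ext_of_charFunDual
  ext Lf
  rw [charFunDual_apply, charFunDual_apply]
  have e : ∀ v : Fin d → ℝ, Lf v = (fun i => Lf (Pi.single i 1)) ⬝ᵥ v := by
    intro v
    conv_lhs => rw [← Finset.univ_sum_single v]
    rw [map_sum, dotProduct]
    refine Finset.sum_congr rfl fun i _ => ?_
    rw [mul_comm, ← smul_eq_mul, ← map_smul]
    congr 1
    rw [← Pi.single_smul, smul_eq_mul, mul_one]
  generalize (fun i => Lf (Pi.single i 1)) = t at e
  simp only [e]
  exact h _

lemma stdG_cf {d : ℕ} (t : Fin d → ℝ) :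
    ∫ x, Complex.exp (((t ⬝ᵥ x : ℝ) : ℂ) * Complex.I) ∂(stdG d) =
      Complex.exp (-(((t ⬝ᵥ t : ℝ) : ℂ) / 2)) := by
  have e : ∀ x : Fin d → ℝ, Complex.exp (((t ⬝ᵥ x : ℝ) : ℂ) * Complex.I) =
      ∏ i, Complex.exp ((t i : ℂ) * (x i : ℂ) * Complex.I) := by
    intro x
    rw [← Complex.exp_sum, dotProduct]
    push_cast
    rw [Finset.sum_mul]
  simp only [e]
  unfold stdG
  rw [integral_fintype_prod_eq_prod (fun i (y : ℝ) => Complex.exp ((t i : ℂ) * (y : ℂ) * Complex.I))]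
  simp only [← charFun_apply_real, charFun_gaussianReal]
  rw [← Complex.exp_sum, dotProduct]
  congr 1
  push_cast
  rw [Finset.sum_div, ← Finset.sum_neg_distrib]
  refine Finset.sum_congr rfl fun i _ => ?_
  ring

lemma gm_cf {d : ℕ} (S : Matrix (Fin d) (Fin d) ℝ) (hS : S.PosDef) (t : Fin d → ℝ) :
    ∫ x, Complex.exp (((t ⬝ᵥ x : ℝ) : ℂ) * Complex.I) ∂(gaussianMeasure d S) =
      Complex.exp (-(((t ⬝ᵥ S.mulVec t : ℝ) : ℂ) / 2)) := by
  obtain ⟨B, hB, h⟩ := posDef_factor S hS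
  rw [gm_eq_map S B hB h]
  have hm : Measurable B.mulVec := by
    have : Continuous (fun v : Fin d → ℝ => B.mulVec v) := by fun_prop
    exact this.measurable
  have hc : Continuous (fun x : Fin d → ℝ => Complex.exp (((t ⬝ᵥ x : ℝ) : ℂ) * Complex.I)) := by
    unfold dotProduct; fun_prop
  rw [integral_map hm.aemeasurable hc.aestronglyMeasurable]
  simp only [dotProduct_mulVec]
  rw [stdG_cf]
  congr 4
  rw [h, ← mulVec_transpose, ← mulVec_transpose, transpose_mul, transpose_transpose, ← mulVec_mulVec]
  rw [dotProduct_comm (B.mulVec _) t, dotProduct_mulVec t B, mulVec_transpose]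

/-- independent linear combination of Gaussians -/
lemma gm_conv {d : ℕ} (S1 S2 S : Matrix (Fin d) (Fin d) ℝ) (h1 : S1.PosDef) (h2 : S2.PosDef)
    (hS : S.PosDef) (c s : ℝ) (h : S = c ^ 2 • S1 + s ^ 2 • S2) :
    gaussianMeasure d S = ((gaussianMeasure d S1).prod (gaussianMeasure d S2)).map
      (fun p i => c * p.1 i + s * p.2 i) := by
  have := gm_prob S1 h1
  have := gm_prob S2 h2
  have := gm_prob S hS
  have hc : Continuous (fun (p : (Fin d → ℝ) × (Fin d → ℝ)) (i : Fin d) => c * p.1 i + s * p.2 i) := by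
    fun_prop
  have := Measure.isProbabilityMeasure_map (μ := (gaussianMeasure d S1).prod (gaussianMeasure d S2))
    hc.measurable.aemeasurable
  apply ext_cf
  intro t
  have hc2 : Continuous (fun x : Fin d → ℝ => Complex.exp (((t ⬝ᵥ x : ℝ) : ℂ) * Complex.I)) := by
    unfold dotProduct; fun_prop
  rw [integral_map hc.measurable.aemeasurable hc2.aestronglyMeasurable, gm_cf S hS]
  have e : ∀ p : (Fin d → ℝ) × (Fin d → ℝ),
      Complex.exp (((t ⬝ᵥ (fun i => c * p.1 i + s * p.2 i) : ℝ) : ℂ) * Complex.I) =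
      Complex.exp ((((c • t) ⬝ᵥ p.1 : ℝ) : ℂ) * Complex.I) *
        Complex.exp ((((s • t) ⬝ᵥ p.2 : ℝ) : ℂ) * Complex.I) := by
    intro p
    rw [← Complex.exp_add, ← add_mul, ← Complex.ofReal_add]
    congr 3
    simp only [dotProduct, Pi.smul_apply, smul_eq_mul]
    rw [← Finset.sum_add_distrib]
    exact Finset.sum_congr rfl fun i _ => by ring
  simp only [e]
  rw [integral_prod_mul (fun x : Fin d → ℝ => Complex.exp ((((c • t) ⬝ᵥ x : ℝ) : ℂ) * Complex.I))
    (fun x : Fin d → ℝ => Complex.exp ((((s • t) ⬝ᵥ x : ℝ) : ℂ) * Complex.I)),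
    gm_cf S1 h1, gm_cf S2 h2, ← Complex.exp_add, h]
  congr 1
  simp only [add_mulVec, smul_mulVec, mulVec_smul, dotProduct_add, dotProduct_smul, smul_dotProduct,
    smul_eq_mul]
  push_cast
  ring

lemma gm_one (d : ℕ) : gaussianMeasure d 1 = stdG d := by
  rw [gm_eq_map (1 : Matrix (Fin d) (Fin d) ℝ) 1 (by simp) (by simp)]
  have : (1 : Matrix (Fin d) (Fin d) ℝ).mulVec = id := by funext x; simp
  rw [this, Measure.map_id]


lemma stdG_mgf {d : ℕ} (t : Fin d → ℝ) :
    Integrable (fun x => Real.exp (t ⬝ᵥ x)) (stdG d) ∧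
    ∫ x, Real.exp (t ⬝ᵥ x) ∂(stdG d) = Real.exp ((t ⬝ᵥ t) / 2) := by
  have e : ∀ x : Fin d → ℝ, Real.exp (t ⬝ᵥ x) = ∏ i, Real.exp (t i * x i) := by
    intro x
    rw [← Real.exp_sum, dotProduct]
  simp only [e]
  unfold stdG
  constructor
  · exact Integrable.fintype_prod (f := fun i (y : ℝ) => Real.exp (t i * y))
      fun i => integrable_exp_mul_gaussianReal (t i)
  rw [integral_fintype_prod_eq_prod (fun i (y : ℝ) => Real.exp (t i * y))]
  have : ∀ i, ∫ y, Real.exp (t i * y) ∂(gaussianReal 0 1) = Real.exp (t i * t i / 2) := by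
    intro i
    have := mgf_gaussianReal (p := gaussianReal 0 1) (X := id) (μ := 0) (v := 1) (by simp) (t i)
    rw [mgf] at this
    simp only [id] at this
    rw [this]; congr 1; simp; ring
  simp only [this]
  rw [← Real.exp_sum, dotProduct, Finset.sum_div]

lemma mulVec_meas {d : ℕ} (B : Matrix (Fin d) (Fin d) ℝ) : Measurable B.mulVec := by
  have : Continuous (fun v : Fin d → ℝ => B.mulVec v) := by fun_prop
  exact this.measurable

lemma gm_mgf {d : ℕ} (S : Matrix (Fin d) (Fin d) ℝ) (hS : S.PosDef) (t : Fin d → ℝ) :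
    Integrable (fun x => Real.exp (t ⬝ᵥ x)) (gaussianMeasure d S) ∧
    ∫ x, Real.exp (t ⬝ᵥ x) ∂(gaussianMeasure d S) = Real.exp ((t ⬝ᵥ S.mulVec t) / 2) := by
  obtain ⟨B, hB, h⟩ := posDef_factor S hS
  rw [gm_eq_map S B hB h]
  have hm := mulVec_meas B
  have hc : Continuous (fun x : Fin d → ℝ => Real.exp (t ⬝ᵥ x)) := by
    unfold dotProduct; fun_prop
  rw [integral_map hm.aemeasurable hc.aestronglyMeasurable,
    integrable_map_measure hc.aestronglyMeasurable hm.aemeasurable]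
  have e : (fun x => Real.exp (t ⬝ᵥ x)) ∘ B.mulVec = fun x => Real.exp ((vecMul t B) ⬝ᵥ x) := by
    funext x; simp only [Function.comp_apply, dotProduct_mulVec]
  rw [e]
  simp only [dotProduct_mulVec]
  refine ⟨(stdG_mgf _).1, ?_⟩
  rw [(stdG_mgf _).2]
  congr 2
  rw [h, ← mulVec_transpose, ← mulVec_transpose, transpose_mul, transpose_transpose, ← mulVec_mulVec]
  rw [dotProduct_comm (B.mulVec _) t, dotProduct_mulVec t B, mulVec_transpose]

lemma gm_coord_int {d : ℕ} (S : Matrix (Fin d) (Fin d) ℝ) (hS : S.PosDef) (j : Fin d) :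
    Integrable (fun x : Fin d → ℝ => |x j|) (gaussianMeasure d S) := by
  have h1 := (gm_mgf S hS (Pi.single j 1)).1
  have h2 := (gm_mgf S hS (Pi.single j (-1))).1
  simp only [single_dotProduct, one_mul, neg_mul] at h1 h2
  refine (h1.add h2).mono' (continuous_apply j).abs.aestronglyMeasurable (Filter.Eventually.of_forall fun x => ?_)
  simp only [Pi.add_apply, Real.norm_eq_abs, abs_abs]
  have a1 := Real.add_one_le_exp (x j)
  have a2 := Real.add_one_le_exp (-x j)
  have p1 := Real.exp_pos (x j)
  have p2 := Real.exp_pos (-x j)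
  rcases abs_cases (x j) with h | h <;> linarith [h.1]

/-- Chernoff bound for a coordinate -/
lemma gm_tail {d : ℕ} (S : Matrix (Fin d) (Fin d) ℝ) (hS : S.PosDef) (j : Fin d) (u : ℝ)
    (hu : 0 ≤ u) :
    (gaussianMeasure d S).real {x | u ≤ |x j|} ≤ 2 * Real.exp (-(u ^ 2 / (2 * S j j))) := by
  have := gm_prob S hS
  have hSj : 0 < S j j := hS.diag_pos
  have key : ∀ ε : ℝ, ε ^ 2 = 1 → (gaussianMeasure d S).real {x | u ≤ ε * x j} ≤
      Real.exp (-(u ^ 2 / (2 * S j j))) := by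
    intro ε hε
    have h := gm_mgf S hS (Pi.single j (ε * (u / S j j)))
    have hmk := mul_meas_ge_le_integral_of_nonneg (μ := gaussianMeasure d S)
      (f := fun x => Real.exp ((Pi.single j (ε * (u / S j j))) ⬝ᵥ x))
      (Filter.Eventually.of_forall fun x => (Real.exp_pos _).le) h.1 (Real.exp (u * (u / S j j)))
    rw [h.2] at hmk
    have hsub : {x : Fin d → ℝ | u ≤ ε * x j} ⊆ {x | Real.exp (u * (u / S j j)) ≤
        Real.exp ((Pi.single j (ε * (u / S j j))) ⬝ᵥ x)} := by
      intro x hx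
      simp only [Set.mem_ofPred_eq] at hx ⊢
      rw [Real.exp_le_exp, single_dotProduct]
      have : 0 ≤ u / S j j := by positivity
      nlinarith
    have h3 := measureReal_mono (μ := gaussianMeasure d S) hsub
    have h4 : (Pi.single j (ε * (u / S j j))) ⬝ᵥ S.mulVec (Pi.single j (ε * (u / S j j))) =
        u ^ 2 / S j j := by
      rw [single_dotProduct, mulVec_single]
      simp only [MulOpposite.smul_eq_mul_unop, MulOpposite.unop_op, Pi.smul_apply, col_apply,
        smul_eq_mul]
      field_simp
      linear_combination u ^ 2 * hε
    rw [h4] at hmk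
    have hp := Real.exp_pos (u * (u / S j j))
    refine h3.trans ?_
    rw [← le_div_iff₀' hp, ← Real.exp_sub] at hmk
    refine hmk.trans (le_of_eq ?_)
    congr 1
    field_simp
    ring
  have hsub : {x : Fin d → ℝ | u ≤ |x j|} ⊆ {x | u ≤ 1 * x j} ∪ {x | u ≤ (-1) * x j} := by
    intro x hx
    simp only [Set.mem_ofPred_eq, Set.mem_union] at hx ⊢
    rcases abs_cases (x j) with h | h
    · left; linarith [h.1]
    · right; linarith [h.1]
  have h1 := key 1 (by norm_num)
  have h2 := key (-1) (by norm_num)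
  have h3 := measureReal_mono (μ := gaussianMeasure d S) hsub
  have h4 := measureReal_union_le (μ := gaussianMeasure d S) {x : Fin d → ℝ | u ≤ 1 * x j}
    {x | u ≤ (-1) * x j}
  linarith

lemma pdf_shift {d : ℕ} (S : Matrix (Fin d) (Fin d) ℝ) (hS : S.PosDef) (w x : Fin d → ℝ) :
    gaussianPdf d S (x + S.mulVec w) =
      gaussianPdf d S x * Real.exp (-(w ⬝ᵥ x) - (w ⬝ᵥ S.mulVec w) / 2) := by
  unfold gaussianPdf
  rw [mul_assoc (_ * _) (Real.exp _) (Real.exp _), ← Real.exp_add]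
  congr 2
  have hu : IsUnit S.det := isUnit_iff_ne_zero.2 hS.det_pos.ne'
  have e1 : S⁻¹.mulVec (S.mulVec w) = w := by
    rw [mulVec_mulVec, nonsing_inv_mul _ hu, one_mulVec]
  have hT : S⁻¹ᵀ = S⁻¹ := by
    rw [transpose_nonsing_inv]; congr 1; exact hS.isHermitian
  have e2 : S.mulVec w ⬝ᵥ S⁻¹.mulVec x = w ⬝ᵥ x := by
    rw [dotProduct_mulVec, ← mulVec_transpose, hT, e1]
  rw [mulVec_add, e1, add_dotProduct, dotProduct_add, dotProduct_add, e2, dotProduct_comm x w,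
    dotProduct_comm (S.mulVec w) w]
  ring

lemma pdf_continuous {d : ℕ} (S : Matrix (Fin d) (Fin d) ℝ) : Continuous (gaussianPdf d S) := by
  unfold gaussianPdf dotProduct mulVec dotProduct; fun_prop

lemma pdf_nonneg {d : ℕ} (S : Matrix (Fin d) (Fin d) ℝ) (hS : S.PosDef) (x : Fin d → ℝ) :
    0 ≤ gaussianPdf d S x := by
  have := hS.det_pos
  unfold gaussianPdf; positivity

/-- quantitative Cameron-Martin -/
lemma gm_shift_le {d : ℕ} (S : Matrix (Fin d) (Fin d) ℝ) (hS : S.PosDef) (w : Fin d → ℝ)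
    (E F : Set (Fin d → ℝ)) (hE : MeasurableSet E) (hF : MeasurableSet F)
    (hEF : ∀ z ∈ E, z + S.mulVec w ∈ F) (κ : ℝ)
    (hκ : ∀ z ∈ E, κ ≤ -(w ⬝ᵥ z) - (w ⬝ᵥ S.mulVec w) / 2) :
    Real.exp κ * (gaussianMeasure d S).real E ≤ (gaussianMeasure d S).real F := by
  have := gm_prob S hS
  have h : ENNReal.ofReal (Real.exp κ) * gaussianMeasure d S E ≤ gaussianMeasure d S F := by
    have hm : Measurable (fun x => ENNReal.ofReal (gaussianPdf d S x)) :=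
      (pdf_continuous S).measurable.ennreal_ofReal
    unfold gaussianMeasure
    rw [withDensity_apply _ hE, withDensity_apply _ hF, ← lintegral_const_mul _ hm,
      ← lintegral_indicator hF, ← lintegral_indicator hE,
      ← lintegral_add_right_eq_self (F.indicator _) (S.mulVec w)]
    refine lintegral_mono fun x => ?_
    by_cases hx : x ∈ E
    · rw [Set.indicator_of_mem hx, Set.indicator_of_mem (hEF x hx),
        ← ENNReal.ofReal_mul (Real.exp_pos _).le, pdf_shift S hS]
      apply ENNReal.ofReal_le_ofReal
      rw [mul_comm]
      exact mul_le_mul_of_nonneg_left (Real.exp_le_exp.2 (hκ x hx)) (pdf_nonneg S hS x)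
    · rw [Set.indicator_of_notMem hx]; exact zero_le
  have h2 := ENNReal.toReal_mono (measure_ne_top _ _) h
  rw [ENNReal.toReal_mul, ENNReal.toReal_ofReal (Real.exp_pos _).le] at h2
  exact h2

lemma gm_integral {d : ℕ} (S : Matrix (Fin d) (Fin d) ℝ) (hS : S.PosDef) (f : (Fin d → ℝ) → ℝ) :
    ∫ x, f x ∂(gaussianMeasure d S) = ∫ x, gaussianPdf d S x * f x := by
  unfold gaussianMeasure
  rw [integral_withDensity_eq_integral_toReal_smul (pdf_continuous S).measurable.ennreal_ofReal
    (Filter.Eventually.of_forall fun x => ENNReal.ofReal_lt_top)]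
  simp only [ENNReal.toReal_ofReal (pdf_nonneg S hS _), smul_eq_mul]

lemma gm_integrable {d : ℕ} (S : Matrix (Fin d) (Fin d) ℝ) (hS : S.PosDef) (f : (Fin d → ℝ) → ℝ) :
    Integrable f (gaussianMeasure d S) ↔ Integrable (fun x => gaussianPdf d S x * f x) := by
  unfold gaussianMeasure
  rw [integrable_withDensity_iff_integrable_smul' (pdf_continuous S).measurable.ennreal_ofReal
    (Filter.Eventually.of_forall fun x => ENNReal.ofReal_lt_top)]
  simp only [ENNReal.toReal_ofReal (pdf_nonneg S hS _), smul_eq_mul]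

lemma pdf_line {d : ℕ} (S : Matrix (Fin d) (Fin d) ℝ) (hS : S.PosDef) (w x : Fin d → ℝ) :
    HasLineDerivAt ℝ (gaussianPdf d S) (-(w ⬝ᵥ x) * gaussianPdf d S x) x (S.mulVec w) := by
  unfold HasLineDerivAt
  have e : (fun u : ℝ => gaussianPdf d S (x + u • S.mulVec w)) = fun u =>
      gaussianPdf d S x * Real.exp (-(u * (w ⬝ᵥ x)) - (u ^ 2 * (w ⬝ᵥ S.mulVec w)) / 2) := by
    funext u
    rw [← mulVec_smul, pdf_shift S hS, mulVec_smul]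
    congr 2
    simp only [smul_dotProduct, dotProduct_smul, smul_eq_mul]
    ring
  rw [e]
  have h1 : HasDerivAt (fun u : ℝ => -(u * (w ⬝ᵥ x)) - (u ^ 2 * (w ⬝ᵥ S.mulVec w)) / 2)
      (-(w ⬝ᵥ x)) 0 := by
    have a := ((hasDerivAt_id (0:ℝ)).mul_const (w ⬝ᵥ x)).neg
    have b := (((hasDerivAt_pow 2 (0:ℝ)).mul_const (w ⬝ᵥ S.mulVec w)).div_const 2)
    refine (a.sub b).congr_deriv ?_
    norm_num
  have h2 := (h1.exp).const_mul (gaussianPdf d S x)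
  refine h2.congr_deriv ?_
  norm_num
  ring

/-- Stein identity -/
lemma gm_stein {d : ℕ} (S : Matrix (Fin d) (Fin d) ℝ) (hS : S.PosDef) (j : Fin d)
    (G G' : (Fin d → ℝ) → ℝ) (hG : Continuous G) (hG' : Continuous G') (B B' : ℝ)
    (hB : ∀ x, |G x| ≤ B) (hB' : ∀ x, |G' x| ≤ B')
    (hd : ∀ x, HasLineDerivAt ℝ G (G' x) x (S.mulVec (Pi.single j 1))) :
    ∫ x, x j * G x ∂(gaussianMeasure d S) = ∫ x, G' x ∂(gaussianMeasure d S) := by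
  have := gm_prob S hS
  have i1 : Integrable G (gaussianMeasure d S) :=
    Integrable.of_bound hG.aestronglyMeasurable B (Filter.Eventually.of_forall hB)
  have i2 : Integrable G' (gaussianMeasure d S) :=
    Integrable.of_bound hG'.aestronglyMeasurable B' (Filter.Eventually.of_forall hB')
  have i3 : Integrable (fun x : Fin d → ℝ => x j * G x) (gaussianMeasure d S) := by
    refine ((gm_coord_int S hS j).mul_const B).mono' (by fun_prop) (Filter.Eventually.of_forall fun x => ?_)
    rw [Real.norm_eq_abs, abs_mul]
    exact mul_le_mul_of_nonneg_left (hB x) (abs_nonneg _)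
  have h := integral_bilinear_hasLineDerivAt_right_eq_neg_left_of_integrable
    (μ := (volume : Measure (Fin d → ℝ))) (B := ContinuousLinearMap.mul ℝ ℝ)
    (f := gaussianPdf d S) (f' := fun x => -(Pi.single j 1 ⬝ᵥ x) * gaussianPdf d S x)
    (g := G) (g' := G') (v := S.mulVec (Pi.single j 1)) ?_ ?_ ?_
    (fun x _ => pdf_line S hS _ x) (fun x _ => hd x)
  · simp only [ContinuousLinearMap.mul_apply'] at h
    rw [gm_integral S hS, gm_integral S hS, h, ← integral_neg]
    refine integral_congr_ae (Filter.Eventually.of_forall fun x => ?_)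
    simp only [single_dotProduct]; ring
  · refine (((gm_integrable S hS _).1 i3).neg).congr (Filter.Eventually.of_forall fun x => ?_)
    simp only [ContinuousLinearMap.mul_apply', single_dotProduct, Pi.neg_apply]; ring
  · exact (gm_integrable S hS _).1 i2
  · exact (gm_integrable S hS _).1 i1


lemma mr_mono {α : Type*} [MeasurableSpace α] (μ : Measure α) [IsProbabilityMeasure μ]
    {s t : Set α} (h : s ⊆ t) : μ.real s ≤ μ.real t :=
  measureReal_mono h (measure_ne_top _ _)

lemma dot_meas {d : ℕ} (w : Fin d → ℝ) : Measurable (fun z : Fin d → ℝ => w ⬝ᵥ z) := by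
  have : Continuous (fun z : Fin d → ℝ => w ⬝ᵥ z) := by unfold dotProduct; fun_prop
  exact this.measurable

/-- Cauchy-Schwarz for unit vectors in the metric of S -/
lemma cs_unit {d : ℕ} (S : Matrix (Fin d) (Fin d) ℝ) (hS : S.PosDef) (u v : Fin d → ℝ)
    (hu : u ⬝ᵥ S.mulVec u = 1) (hv : v ⬝ᵥ S.mulVec v = 1) : u ⬝ᵥ S.mulVec v ≤ 1 := by
  have h := hS.posSemidef.dotProduct_mulVec_nonneg (u - v)
  have hT : Sᵀ = S := hS.isHermitian
  have hs : v ⬝ᵥ S.mulVec u = u ⬝ᵥ S.mulVec v := by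
    rw [dotProduct_mulVec, ← mulVec_transpose, hT, dotProduct_comm]
  simp only [star_trivial, mulVec_sub, dotProduct_sub, sub_dotProduct] at h
  linarith

lemma slab_inj {y δ x : ℝ} {k k' : ℕ} (hδ : 0 < δ) (h1 : y + k * δ ≤ x) (h2 : x < y + k * δ + δ)
    (h3 : y + k' * δ ≤ x) (h4 : x < y + k' * δ + δ) : k = k' := by
  rcases lt_trichotomy k k' with h | h | h
  · exfalso
    have : (k : ℝ) + 1 ≤ k' := by exact_mod_cast h
    nlinarith
  · exact h
  · exfalso
    have : (k' : ℝ) + 1 ≤ k := by exact_mod_cast h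
    nlinarith

lemma sum_disj_le_one {α ι : Type*} [MeasurableSpace α] (μ : Measure α) [IsProbabilityMeasure μ]
    (s : Finset ι) (E : ι → Set α) (hE : ∀ i, MeasurableSet (E i))
    (hd : ∀ i ∈ s, ∀ j ∈ s, ∀ x, x ∈ E i → x ∈ E j → i = j) : ∑ i ∈ s, μ.real (E i) ≤ 1 := by
  rw [← measureReal_biUnion_finset _ (fun i _ => hE i)]
  · exact measureReal_le_one
  · intro i hi j hj hij
    refine Set.disjoint_left.2 fun x hx hx' => hij (hd i hi j hj x hx hx')

/-- slab far away -/
lemma naz_far {d : ℕ} (S : Matrix (Fin d) (Fin d) ℝ) (hS : S.PosDef) (w : Fin d → ℝ)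
    (hw : w ⬝ᵥ S.mulVec w = 1) (y K δ : ℝ) (hK : 1 ≤ K) (hy : K ≤ y) (hδ : 0 < δ) :
    (gaussianMeasure d S).real {z | y ≤ w ⬝ᵥ z ∧ w ⬝ᵥ z < y + δ} ≤
      2 * δ * Real.exp (-(K ^ 2 / 2)) := by
  have := gm_prob S hS
  set n := ⌈1 / δ⌉₊ with hn
  have hn1 : 1 ≤ n * δ := by
    have := Nat.le_ceil (1 / δ)
    rwa [div_le_iff₀ hδ] at this
  have hn2 : ∀ k : ℕ, k < n → k * δ ≤ 1 := by
    intro k hk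
    have := (Nat.lt_ceil.1 hk).le
    rwa [le_div_iff₀ hδ] at this
  let E : ℕ → Set (Fin d → ℝ) := fun k =>
    {z | (y - K) + k * δ ≤ w ⬝ᵥ z ∧ w ⬝ᵥ z < (y - K) + k * δ + δ}
  have hm : ∀ a b : ℝ, MeasurableSet {z : Fin d → ℝ | a ≤ w ⬝ᵥ z ∧ w ⬝ᵥ z < b} := fun a b =>
    (measurableSet_le measurable_const (dot_meas w)).inter
      (measurableSet_lt (dot_meas w) measurable_const)
  have h1 := sum_disj_le_one (gaussianMeasure d S) (Finset.range n) E (fun k => hm _ _)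
    (fun k _ k' _ z hz hz' => slab_inj hδ hz.1 hz.2 hz'.1 hz'.2)
  have h2 : ∀ k ∈ Finset.range n, Real.exp ((K ^ 2 - 1) / 2) *
      (gaussianMeasure d S).real {z | y ≤ w ⬝ᵥ z ∧ w ⬝ᵥ z < y + δ} ≤
      (gaussianMeasure d S).real (E k) := by
    intro k hk
    have hk1 := hn2 k (Finset.mem_range.1 hk)
    have hk0 : 0 ≤ k * δ := by positivity
    refine gm_shift_le S hS ((k * δ - K) • w) _ _ (hm _ _) (hm _ _) ?_ _ ?_
    · intro z hz
      have e : w ⬝ᵥ (z + S.mulVec ((k * δ - K) • w)) = w ⬝ᵥ z + (k * δ - K) := by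
        rw [dotProduct_add, mulVec_smul, dotProduct_smul, hw]; simp
      constructor
      · rw [e]; linarith [hz.1]
      · rw [e]; linarith [hz.2]
    · intro z hz
      rw [mulVec_smul, dotProduct_smul, smul_dotProduct, smul_dotProduct, hw]
      simp only [smul_eq_mul]
      have := hz.1
      have h5 : 0 ≤ (K - k * δ) * (w ⬝ᵥ z - K) := mul_nonneg (by linarith) (by linarith)
      nlinarith
  have h3 := (Finset.sum_le_sum h2).trans h1
  rw [Finset.sum_const, Finset.card_range, nsmul_eq_mul] at h3
  set X := (gaussianMeasure d S).real {z | y ≤ w ⬝ᵥ z ∧ w ⬝ᵥ z < y + δ} with hX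
  have hX0 : 0 ≤ X := measureReal_nonneg
  have e1 : Real.exp ((K ^ 2 - 1) / 2) = Real.exp (K ^ 2 / 2) * Real.exp (-(1 / 2)) := by
    rw [← Real.exp_add]; congr 1; ring
  have e2 : 1 / 2 ≤ Real.exp (-(1 / 2)) := by
    have := Real.add_one_le_exp (-(1 / 2 : ℝ)); linarith
  rw [Real.exp_neg, ← div_eq_mul_inv, le_div_iff₀ (Real.exp_pos _)]
  rw [e1] at h3
  have hp := Real.exp_pos (K ^ 2 / 2)
  set q := Real.exp (K ^ 2 / 2)
  have h6 : n * (q * (1 / 2) * X) ≤ 1 := by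
    refine le_trans ?_ h3
    gcongr
  have h7 : (1 : ℝ) * (q * X) ≤ n * δ * (q * X) :=
    mul_le_mul_of_nonneg_right hn1 (by positivity)
  nlinarith

/-- the near part -/
lemma naz_near {d m : ℕ} (S : Matrix (Fin d) (Fin d) ℝ) (hS : S.PosDef) (w : Fin m → Fin d → ℝ)
    (hw : ∀ i, w i ⬝ᵥ S.mulVec (w i) = 1) (y : Fin m → ℝ) (K δ : ℝ) (hK : 1 ≤ K)
    (I : Finset (Fin m)) (hI : ∀ i ∈ I, y i ≤ K) (hδ : 0 < δ) (hδK : δ * K ≤ 1) :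
    (gaussianMeasure d S).real {z | (∃ i ∈ I, y i ≤ w i ⬝ᵥ z) ∧ ∀ i ∈ I, w i ⬝ᵥ z < y i + δ} ≤
      27 * (δ * K) := by
  have := gm_prob S hS
  have hδK0 : 0 < δ * K := by positivity
  set n := ⌈1 / (δ * K)⌉₊ with hn
  have hn1 : 1 ≤ n * (δ * K) := by
    have := Nat.le_ceil (1 / (δ * K))
    rwa [div_le_iff₀ hδK0] at this
  have hn2 : ∀ k : ℕ, k < n → k * (δ * K) ≤ 1 := by
    intro k hk
    have := (Nat.lt_ceil.1 hk).le
    rwa [le_div_iff₀ hδK0] at this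
  let E : Fin m × ℕ → Set (Fin d → ℝ) := fun p =>
    {z | y p.1 + p.2 * δ ≤ w p.1 ⬝ᵥ z} ∩ {z | w p.1 ⬝ᵥ z < y p.1 + p.2 * δ + δ} ∩
      ((⋂ k ∈ I.filter (fun k => k < p.1), {z | w k ⬝ᵥ z - y k < w p.1 ⬝ᵥ z - y p.1}) ∩
      (⋂ k ∈ I, {z | w k ⬝ᵥ z - y k ≤ w p.1 ⬝ᵥ z - y p.1}))
  have hEm : ∀ p, MeasurableSet (E p) := by
    intro p
    refine ((measurableSet_le measurable_const (dot_meas _)).inter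
      (measurableSet_lt (dot_meas _) measurable_const)).inter ((Finset.measurableSet_biInter _
        fun k _ => measurableSet_lt ((dot_meas _).sub_const _) ((dot_meas _).sub_const _)).inter
        (Finset.measurableSet_biInter _
        fun k _ => measurableSet_le ((dot_meas _).sub_const _) ((dot_meas _).sub_const _)))
  have hE : ∀ p z, z ∈ E p ↔ (y p.1 + p.2 * δ ≤ w p.1 ⬝ᵥ z ∧ w p.1 ⬝ᵥ z < y p.1 + p.2 * δ + δ) ∧
      ((∀ k ∈ I, k < p.1 → w k ⬝ᵥ z - y k < w p.1 ⬝ᵥ z - y p.1) ∧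
        ∀ k ∈ I, w k ⬝ᵥ z - y k ≤ w p.1 ⬝ᵥ z - y p.1) := by
    intro p z
    simp only [E, Set.mem_inter_iff, Set.mem_ofPred_eq, Set.mem_iInter, Finset.mem_filter, and_imp]
  have h1 := sum_disj_le_one (gaussianMeasure d S) (I ×ˢ Finset.range n) E hEm (by
    rintro ⟨i, k⟩ hi ⟨j, l⟩ hj z hz hz'
    rw [hE] at hz hz'
    simp only [Finset.mem_product] at hi hj hz hz'
    have hij : i = j := by
      rcases lt_trichotomy i j with h | h | h
      · have a := hz'.2.1 i hi.1 h
        have b := hz.2.2 j hj.1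
        linarith
      · exact h
      · have a := hz.2.1 j hj.1 h
        have b := hz'.2.2 i hi.1
        linarith
    subst hij
    rw [slab_inj hδ hz.1.1 hz.1.2 hz'.1.1 hz'.1.2])
  rw [Finset.sum_product] at h1
  have h2 : ∀ i ∈ I, ∀ k ∈ Finset.range n, Real.exp (-(5 / 2)) *
      (gaussianMeasure d S).real (E (i, 0)) ≤ (gaussianMeasure d S).real (E (i, k)) := by
    intro i hi k hk
    have hk1 := hn2 k (Finset.mem_range.1 hk)
    have hk0 : 0 ≤ k * δ := by positivity
    have hkd : k * δ ≤ 1 := by nlinarith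
    refine gm_shift_le S hS ((k * δ) • w i) _ _ (hEm _) (hEm _) ?_ _ ?_
    · intro z hz
      rw [hE] at hz ⊢
      have e : ∀ l, w l ⬝ᵥ (z + S.mulVec ((k * δ) • w i)) =
          w l ⬝ᵥ z + k * δ * (w l ⬝ᵥ S.mulVec (w i)) := by
        intro l
        rw [dotProduct_add, mulVec_smul, dotProduct_smul]; simp
      have e2 : ∀ l, k * δ * (w l ⬝ᵥ S.mulVec (w i)) ≤ k * δ := fun l => by
        have := cs_unit S hS _ _ (hw l) (hw i)
        nlinarith
      simp only [e, hw i, Nat.cast_zero] at hz ⊢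
      refine ⟨⟨by linarith [hz.1.1], by linarith [hz.1.2]⟩, fun l hl hli => ?_, fun l hl => ?_⟩
      · have := hz.2.1 l hl hli
        linarith [e2 l]
      · have := hz.2.2 l hl
        linarith [e2 l]
    · intro z hz
      rw [hE] at hz
      rw [mulVec_smul, dotProduct_smul, smul_dotProduct, smul_dotProduct, hw]
      simp only [smul_eq_mul]
      have h3 := hz.1.2
      simp only [Nat.cast_zero, zero_mul, add_zero] at h3
      have h4 := hI i hi
      have hd1 : δ ≤ 1 := by nlinarith
      have h5 : k * δ * (w i ⬝ᵥ z) ≤ k * δ * (K + δ) :=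
        mul_le_mul_of_nonneg_left (by linarith) hk0
      nlinarith
  have h3 : ∑ i ∈ I, n * (Real.exp (-(5 / 2)) * (gaussianMeasure d S).real (E (i, 0))) ≤ 1 := by
    refine le_trans (Finset.sum_le_sum fun i hi => ?_) h1
    have := Finset.sum_le_sum (h2 i hi)
    rwa [Finset.sum_const, Finset.card_range, nsmul_eq_mul] at this
  rw [← Finset.mul_sum, ← Finset.mul_sum] at h3
  have hsub : {z | (∃ i ∈ I, y i ≤ w i ⬝ᵥ z) ∧ ∀ i ∈ I, w i ⬝ᵥ z < y i + δ} ⊆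
      ⋃ i ∈ I, E (i, 0) := by
    rintro z ⟨⟨i0, hi0, hy0⟩, hz⟩
    obtain ⟨i1, hi1, hmax⟩ := I.exists_max_image (fun k => w k ⬝ᵥ z - y k) ⟨i0, hi0⟩
    let J := I.filter (fun k => w k ⬝ᵥ z - y k = w i1 ⬝ᵥ z - y i1)
    have hJ : J.Nonempty := ⟨i1, by simp [J, hi1]⟩
    have hj := Finset.min'_mem J hJ
    set j := J.min' hJ with hjd
    simp only [J, Finset.mem_filter] at hj
    simp only [Set.mem_iUnion]
    refine ⟨j, hj.1, ?_⟩
    rw [hE]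
    simp only [Nat.cast_zero, zero_mul, add_zero]
    refine ⟨⟨?_, hz j hj.1⟩, ?_, ?_⟩
    · have := hmax i0 hi0
      linarith [hj.2]
    · intro k hk hkj
      refine lt_of_le_of_ne ?_ ?_
      · rw [hj.2]; exact hmax k hk
      · intro he
        have : k ∈ J := by simp only [J, Finset.mem_filter]; exact ⟨hk, he.trans hj.2⟩
        have := J.min'_le k this
        exact absurd hkj (not_lt.2 this)
    · intro k hk
      rw [hj.2]; exact hmax k hk
  have h4 := (mr_mono (gaussianMeasure d S) hsub).trans
    (measureReal_biUnion_finset_le _ _)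
  refine h4.trans ?_
  set X := ∑ i ∈ I, (gaussianMeasure d S).real (E (i, 0)) with hX
  have hX0 : 0 ≤ X := Finset.sum_nonneg fun i _ => measureReal_nonneg
  have e2 : 1 / 27 ≤ Real.exp (-(5 / 2)) := by
    rw [Real.exp_neg, one_div]
    apply inv_anti₀ (Real.exp_pos _)
    have h := Real.exp_one_lt_three
    calc Real.exp (5 / 2) ≤ Real.exp ((3 : ℕ) * 1) := Real.exp_le_exp.2 (by norm_num)
      _ = Real.exp 1 ^ 3 := Real.exp_nat_mul 1 3
      _ ≤ 3 ^ 3 := by gcongr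
      _ = 27 := by norm_num
  have h6 : n * (1 / 27 * X) ≤ 1 := by
    refine le_trans ?_ h3
    gcongr
  have h7 : (1 : ℝ) * X ≤ n * (δ * K) * X := mul_le_mul_of_nonneg_right hn1 hX0
  nlinarith

lemma naz_gen {d m : ℕ} (S : Matrix (Fin d) (Fin d) ℝ) (hS : S.PosDef) (w : Fin m → Fin d → ℝ)
    (hw : ∀ i, w i ⬝ᵥ S.mulVec (w i) = 1) (y : Fin m → ℝ) (K δ : ℝ) (hK : 1 ≤ K)
    (hm : (m : ℝ) ≤ Real.exp (K ^ 2 / 2)) (hδ : 0 ≤ δ) :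
    (gaussianMeasure d S).real {z | ∀ i, w i ⬝ᵥ z < y i + δ} ≤
      (gaussianMeasure d S).real {z | ∀ i, w i ⬝ᵥ z < y i} + 29 * (δ * K) := by
  have := gm_prob S hS
  rcases hδ.eq_or_lt with h0 | h0
  · rw [← h0]; simp
  rcases le_or_gt 1 (δ * K) with h1 | h1
  · have : (gaussianMeasure d S).real {z | ∀ i, w i ⬝ᵥ z < y i + δ} ≤ 1 := measureReal_le_one
    have : 0 ≤ (gaussianMeasure d S).real {z | ∀ i, w i ⬝ᵥ z < y i} := measureReal_nonneg
    linarith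
  let I : Finset (Fin m) := Finset.univ.filter fun i => y i ≤ K
  let J : Finset (Fin m) := Finset.univ.filter fun i => K < y i
  have hsub : {z | ∀ i, w i ⬝ᵥ z < y i + δ} ⊆ {z | ∀ i, w i ⬝ᵥ z < y i} ∪
      ({z | (∃ i ∈ I, y i ≤ w i ⬝ᵥ z) ∧ ∀ i ∈ I, w i ⬝ᵥ z < y i + δ} ∪
      ⋃ i ∈ J, {z | y i ≤ w i ⬝ᵥ z ∧ w i ⬝ᵥ z < y i + δ}) := by
    intro z hz
    by_cases h : ∀ i, w i ⬝ᵥ z < y i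
    · left; exact h
    · right
      push Not at h
      obtain ⟨i, hi⟩ := h
      by_cases hiK : y i ≤ K
      · left
        exact ⟨⟨i, by simp [I, hiK], hi⟩, fun k _ => hz k⟩
      · right
        simp only [Set.mem_iUnion]
        exact ⟨i, by simpa [J] using hiK, hi, hz i⟩
  have h2 := mr_mono (gaussianMeasure d S) hsub
  have h3 := measureReal_union_le (μ := gaussianMeasure d S) {z | ∀ i, w i ⬝ᵥ z < y i}
    ({z | (∃ i ∈ I, y i ≤ w i ⬝ᵥ z) ∧ ∀ i ∈ I, w i ⬝ᵥ z < y i + δ} ∪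
      ⋃ i ∈ J, {z | y i ≤ w i ⬝ᵥ z ∧ w i ⬝ᵥ z < y i + δ})
  have h4 := measureReal_union_le (μ := gaussianMeasure d S)
    {z | (∃ i ∈ I, y i ≤ w i ⬝ᵥ z) ∧ ∀ i ∈ I, w i ⬝ᵥ z < y i + δ}
    (⋃ i ∈ J, {z | y i ≤ w i ⬝ᵥ z ∧ w i ⬝ᵥ z < y i + δ})
  have h5 := naz_near S hS w hw y K δ hK I (fun i hi => by simpa [I] using hi) h0 h1.le
  have h6 : (gaussianMeasure d S).real (⋃ i ∈ J, {z | y i ≤ w i ⬝ᵥ z ∧ w i ⬝ᵥ z < y i + δ}) ≤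
      2 * δ := by
    refine (measureReal_biUnion_finset_le _ _).trans ?_
    have : ∀ i ∈ J, (gaussianMeasure d S).real {z | y i ≤ w i ⬝ᵥ z ∧ w i ⬝ᵥ z < y i + δ} ≤
        2 * δ * Real.exp (-(K ^ 2 / 2)) := fun i hi => by
      have hi' : K < y i := by simpa [J] using hi
      exact naz_far S hS (w i) (hw i) (y i) K δ hK hi'.le h0
    refine (Finset.sum_le_sum this).trans ?_
    rw [Finset.sum_const, nsmul_eq_mul]
    have hc : (J.card : ℝ) ≤ m := by
      have := Finset.card_le_univ J
      rw [Fintype.card_fin] at this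
      exact_mod_cast this
    have hq := Real.exp_pos (K ^ 2 / 2)
    rw [Real.exp_neg, ← div_eq_mul_inv, mul_div_assoc', div_le_iff₀ hq]
    have : (J.card : ℝ) ≤ Real.exp (K ^ 2 / 2) := hc.trans hm
    nlinarith
  nlinarith

/-- open finite rectangle -/
def rect {d : ℕ} (a b : Fin d → ℝ) : Set (Fin d → ℝ) := {x | ∀ j, a j < x j ∧ x j < b j}

lemma rect_meas {d : ℕ} (a b : Fin d → ℝ) : MeasurableSet (rect a b) := by
  have : rect a b = ⋂ j, ({x | a j < x j} ∩ {x | x j < b j}) := by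
    ext x; simp [rect]
  rw [this]
  exact MeasurableSet.iInter fun j => (measurableSet_lt measurable_const (measurable_pi_apply j)).inter
    (measurableSet_lt (measurable_pi_apply j) measurable_const)

/-- Nazarov inequality for rectangles -/
lemma naz_rect {d : ℕ} (hd : 3 ≤ d) (S : Matrix (Fin d) (Fin d) ℝ) (hS : S.PosDef) (σ : ℝ)
    (hσ : 0 < σ) (hσS : ∀ j, σ ^ 2 ≤ S j j) (L : ℝ) (hL1 : 1 ≤ L) (hL : L ^ 2 = Real.log d)
    (a b : Fin d → ℝ) (δ : ℝ) (hδ : 0 ≤ δ) :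
    (gaussianMeasure d S).real (rect (fun j => a j - δ) (fun j => b j + δ)) ≤
      (gaussianMeasure d S).real (rect a b) + 58 * (δ / σ * L) := by
  have := gm_prob S hS
  let e := (Fintype.equivFin (Fin d × Bool)).symm
  let sg : Bool → ℝ := fun c => if c then 1 else -1
  let w0 : Fin d × Bool → Fin d → ℝ := fun p => Pi.single p.1 (sg p.2 / √(S p.1 p.1))
  let y0 : Fin d × Bool → ℝ := fun p => (if p.2 then b p.1 else - a p.1) / √(S p.1 p.1)
  have hsq : ∀ j, 0 < √(S j j) := fun j => Real.sqrt_pos.2 hS.diag_pos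
  have hsg : ∀ c, sg c ^ 2 = 1 := by intro c; cases c <;> simp [sg]
  have hw0 : ∀ p, w0 p ⬝ᵥ S.mulVec (w0 p) = 1 := by
    intro p
    simp only [w0]
    rw [single_dotProduct, mulVec_single]
    simp only [MulOpposite.smul_eq_mul_unop, MulOpposite.unop_op, Pi.smul_apply, col_apply]
    have h1 := hsq p.1
    have h2 := Real.sq_sqrt (hS.diag_pos (i := p.1)).le
    have h3 := hsg p.2
    field_simp
    rw [h2, h3]; ring
  have hdot : ∀ p z, w0 p ⬝ᵥ z = (sg p.2 * z p.1) / √(S p.1 p.1) := by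
    intro p z
    simp only [w0]
    rw [single_dotProduct]; ring
  have h := naz_gen S hS (fun i => w0 (e i)) (fun i => hw0 _) (fun i => y0 (e i)) (2 * L) (δ / σ)
    (by linarith) ?_ (by positivity)
  · have r1 : {z : Fin d → ℝ | ∀ i, w0 (e i) ⬝ᵥ z < y0 (e i)} = rect a b := by
      ext z
      simp only [Set.mem_ofPred_eq, rect]
      rw [e.forall_congr_left (p := fun i => w0 (e i) ⬝ᵥ z < y0 (e i))]
      simp only [Equiv.apply_symm_apply, hdot, y0, Prod.forall, Bool.forall_bool, sg]
      refine forall_congr' fun j => ?_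
      simp only [div_lt_div_iff_of_pos_right (hsq j)]
      simp
    have r2 : rect (fun j => a j - δ) (fun j => b j + δ) ⊆
        {z : Fin d → ℝ | ∀ i, w0 (e i) ⬝ᵥ z < y0 (e i) + δ / σ} := by
      intro z hz i
      set p := e i
      have hq : δ / √(S p.1 p.1) ≤ δ / σ := by
        apply div_le_div_of_nonneg_left hδ hσ
        exact Real.le_sqrt_of_sq_le (hσS _)
      refine lt_of_lt_of_le ?_ (add_le_add le_rfl hq)
      rw [hdot]
      simp only [y0]
      rw [← add_div, div_lt_div_iff_of_pos_right (hsq _)]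
      have := hz p.1
      cases hp : p.2
      · simp [sg]; linarith [this.1]
      · simp [sg]; linarith [this.2]
    rw [r1] at h
    have h2 := (mr_mono (gaussianMeasure d S) r2).trans h
    refine h2.trans (le_of_eq ?_)
    ring
  · have e1 : (2 * L) ^ 2 / 2 = (2 : ℕ) * Real.log d := by rw [← hL]; push_cast; ring
    have hd0 : (0 : ℝ) < d := by exact_mod_cast (by omega : 0 < d)
    rw [e1, Real.exp_nat_mul, Real.exp_log hd0]
    have hd3 : (3 : ℝ) ≤ d := by exact_mod_cast hd
    simp only [Fintype.card_prod, Fintype.card_fin, Fintype.card_bool]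
    push_cast
    nlinarith

/-- tail of the maximum -/
lemma gm_max_tail {d : ℕ} (hd : 3 ≤ d) (S : Matrix (Fin d) (Fin d) ℝ) (hS : S.PosDef) (σ : ℝ)
    (hσ : 0 < σ) (hσS : ∀ j, S j j ≤ σ ^ 2) (L : ℝ) (hL1 : 1 ≤ L) (hL : L ^ 2 = Real.log d) :
    (gaussianMeasure d S).real {z | ∃ j, 3 * σ * L ≤ |z j|} ≤ 1 / 4 := by
  have := gm_prob S hS
  have hd3 : (3 : ℝ) ≤ d := by exact_mod_cast hd
  have hd0 : (0 : ℝ) < d := by linarith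
  have e : {z : Fin d → ℝ | ∃ j, 3 * σ * L ≤ |z j|} ⊆ ⋃ j ∈ Finset.univ, {z | 3 * σ * L ≤ |z j|} := by
    intro z hz
    simpa using hz
  refine (mr_mono (gaussianMeasure d S) e).trans ?_
  refine (measureReal_biUnion_finset_le _ _).trans ?_
  have h1 : ∀ j ∈ (Finset.univ : Finset (Fin d)),
      (gaussianMeasure d S).real {z | 3 * σ * L ≤ |z j|} ≤ 2 * (1 / (d : ℝ) ^ 4) := by
    intro j _
    refine (gm_tail S hS j (3 * σ * L) (by positivity)).trans ?_
    have hS0 : 0 < S j j := hS.diag_pos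
    have : Real.exp (-((3 * σ * L) ^ 2 / (2 * S j j))) ≤ Real.exp (-((4 : ℕ) * Real.log d)) := by
      apply Real.exp_le_exp.2
      rw [neg_le_neg_iff, le_div_iff₀ (by positivity), ← hL]
      have := hσS j
      have hL2 : 0 < L ^ 2 := by positivity
      push_cast
      nlinarith
    rw [Real.exp_neg ((4 : ℕ) * Real.log d), Real.exp_nat_mul, Real.exp_log hd0] at this
    rw [one_div]; linarith
  refine (Finset.sum_le_sum h1).trans ?_
  rw [Finset.sum_const, Finset.card_univ, Fintype.card_fin, nsmul_eq_mul]
  rw [one_div, ← mul_assoc, ← div_eq_mul_inv, div_le_iff₀ (by positivity)]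
  have : (27 : ℝ) ≤ (d : ℝ) ^ 3 := by
    calc (27 : ℝ) = 3 ^ 3 := by norm_num
      _ ≤ _ := by gcongr
  nlinarith


lemma log3_ge : 1 ≤ Real.log 3 := by
  rw [Real.le_log_iff_exp_le (by norm_num)]
  exact Real.exp_one_lt_three.le

lemma nder_bdd : ∃ B : ℝ, 1 ≤ B ∧ ∀ m ≤ 4, ∀ u, |nder m u| ≤ B := by
  have hL1 : 1 ≤ √(Real.log 3) := Real.one_le_sqrt.2 log3_ge
  have hL : √(Real.log 3) ^ 2 = Real.log ((3 : ℕ) : ℝ) := by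
    rw [Real.sq_sqrt (by linarith [log3_ge])]; norm_num
  have hK := K1_ge
  refine ⟨1 + K1 * √(Real.log 3) ^ 4 * 2, by
    have : 0 ≤ K1 * √(Real.log 3) ^ 4 * 2 := by positivity
    linarith, fun m hm u => ?_⟩
  have hp : 0 ≤ K1 * √(Real.log 3) ^ 4 * 2 := by positivity
  rcases Nat.eq_zero_or_pos m with h | h
  · subst h
    have h1 : |nder 0 u| ≤ 1 := by
      show |nPhi u| ≤ 1
      rw [abs_of_nonneg (nPhi_nonneg u)]; exact nPhi_le_one u
    linarith
  · have := nder_bound 3 le_rfl _ hL1 hL m h hm u 0 le_rfl (by positivity)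
    refine this.trans ?_
    have a1 : √(Real.log 3) ^ m ≤ √(Real.log 3) ^ 4 := pow_le_pow_right₀ hL1 hm
    have a2 : (1 - nPhi (u + 0)) + 1 / ((3 : ℕ) : ℝ) ≤ 2 := by
      have := nPhi_nonneg u
      rw [add_zero]; norm_num; linarith
    have a3 : 0 ≤ (1 - nPhi (u + 0)) + 1 / ((3 : ℕ) : ℝ) := by
      have := nPhi_le_one (u + 0)
      have : (0:ℝ) ≤ 1 / ((3 : ℕ) : ℝ) := by positivity
      linarith
    have : K1 * √(Real.log 3) ^ m * ((1 - nPhi (u + 0)) + 1 / ((3 : ℕ) : ℝ)) ≤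
        K1 * √(Real.log 3) ^ 4 * 2 := by gcongr
    linarith

lemma Gp_bdd {d : ℕ} (a b : Fin d → ℝ) (c0 : ℝ) (hc0 : 0 < c0) : ∃ B : ℝ, 0 ≤ B ∧
    ∀ τ, c0 ≤ τ → ∀ n : Fin d → ℕ, (∀ i, n i ≤ 4) → ∀ y, |Gp (RF a b τ) n y| ≤ B := by
  obtain ⟨B, hB1, hB⟩ := nder_bdd
  have hq : 1 ≤ 1 + 1 / c0 := by
    have : 0 < 1 / c0 := by positivity
    linarith
  refine ⟨((1 + 1 / c0) ^ 4 * (2 * B)) ^ d, by positivity, fun τ hτ n hn y => ?_⟩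
  have hτ0 : 0 < τ := hc0.trans_le hτ
  unfold Gp
  rw [Finset.abs_prod]
  calc ∏ i, |RF a b τ i (n i) (y i)| ≤ ∏ i : Fin d, ((1 + 1 / c0) ^ 4 * (2 * B)) := by
        refine Finset.prod_le_prod (fun i _ => abs_nonneg _) fun i _ => ?_
        unfold RF
        rw [abs_mul, abs_pow, abs_div, abs_neg, abs_one, abs_of_pos hτ0]
        have h1 : (1 / τ) ^ n i ≤ (1 + 1 / c0) ^ 4 := by
          calc (1 / τ) ^ n i ≤ (1 + 1 / c0) ^ n i := by
                gcongr
                have : 1 / τ ≤ 1 / c0 := one_div_le_one_div_of_le hc0 hτ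
                linarith
            _ ≤ _ := pow_le_pow_right₀ hq (hn i)
        have h2 : |nder (n i) ((b i - y i) / τ) - nder (n i) ((a i - y i) / τ)| ≤ 2 * B := by
          refine (abs_sub _ _).trans ?_
          linarith [hB (n i) (hn i) ((b i - y i) / τ), hB (n i) (hn i) ((a i - y i) / τ)]
        gcongr
    _ = _ := by simp

lemma RF_theta {d : ℕ} (a b : Fin d → ℝ) (s : ℝ) (hs : s ≠ 0) (i : Fin d) (x z θ : ℝ)
    (hθ : Real.sin θ ≠ 0) :
    HasDerivAt (fun θ => RF a b (Real.sin θ * s) i 0 (Real.cos θ * x + Real.sin θ * z))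
      ((-Real.sin θ * x + Real.cos θ * z) *
          RF a b (Real.sin θ * s) i 1 (Real.cos θ * x + Real.sin θ * z) +
        s ^ 2 * (Real.sin θ * Real.cos θ) *
          RF a b (Real.sin θ * s) i 2 (Real.cos θ * x + Real.sin θ * z)) θ := by
  have hτ : HasDerivAt (fun θ => Real.sin θ * s) (Real.cos θ * s) θ :=
    (Real.hasDerivAt_sin θ).mul_const s
  have hy : HasDerivAt (fun θ => Real.cos θ * x + Real.sin θ * z)
      (-Real.sin θ * x + Real.cos θ * z) θ :=
    ((Real.hasDerivAt_cos θ).mul_const x).add ((Real.hasDerivAt_sin θ).mul_const z)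
  have h0 : Real.sin θ * s ≠ 0 := mul_ne_zero hθ hs
  have key : ∀ c : ℝ, HasDerivAt
      (fun θ => nPhi ((c - (Real.cos θ * x + Real.sin θ * z)) / (Real.sin θ * s)))
      ((-Real.sin θ * x + Real.cos θ * z) * ((-1 / (Real.sin θ * s)) ^ 1 *
        nphi ((c - (Real.cos θ * x + Real.sin θ * z)) / (Real.sin θ * s))) +
      s ^ 2 * (Real.sin θ * Real.cos θ) * ((-1 / (Real.sin θ * s)) ^ 2 *
        (-((c - (Real.cos θ * x + Real.sin θ * z)) / (Real.sin θ * s)) *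
          nphi ((c - (Real.cos θ * x + Real.sin θ * z)) / (Real.sin θ * s))))) θ := by
    intro c
    have h1 := (hy.const_sub c).div hτ h0
    have h2 := (nPhi_hasDerivAt ((c - (Real.cos θ * x + Real.sin θ * z)) / (Real.sin θ * s))).comp θ h1
    refine h2.congr_deriv ?_
    field_simp
    ring
  have h := (key (b i)).sub (key (a i))
  unfold RF
  simp only [nder, pow_zero, one_mul]
  refine h.congr_deriv ?_
  ring

lemma Gp_theta {d : ℕ} (a b : Fin d → ℝ) (s : ℝ) (hs : s ≠ 0) (x z : Fin d → ℝ) (θ : ℝ)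
    (hθ : Real.sin θ ≠ 0) :
    HasDerivAt (fun θ => Gp (RF a b (Real.sin θ * s)) 0
        (fun i => Real.cos θ * x i + Real.sin θ * z i))
      (∑ j, ((-Real.sin θ * x j + Real.cos θ * z j) * Gp (RF a b (Real.sin θ * s)) (ee j)
          (fun i => Real.cos θ * x i + Real.sin θ * z i) +
        s ^ 2 * (Real.sin θ * Real.cos θ) * Gp (RF a b (Real.sin θ * s)) (ee j + ee j)
          (fun i => Real.cos θ * x i + Real.sin θ * z i))) θ := by
  have h1 : ∀ i ∈ Finset.univ, HasDerivAt
      (fun θ => RF a b (Real.sin θ * s) i 0 (Real.cos θ * x i + Real.sin θ * z i)) _ θ :=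
    fun i _ => RF_theta a b s hs i (x i) (z i) θ hθ
  have h2 := HasDerivAt.fun_finsetProd h1
  unfold Gp
  refine h2.congr_deriv ?_
  refine Finset.sum_congr rfl fun j _ => ?_
  have e1 := Gp_split (RF a b (Real.sin θ * s)) 0
    (fun i => Real.cos θ * x i + Real.sin θ * z i) j
  have e2 := Gp_split (RF a b (Real.sin θ * s)) (ee j)
    (fun i => Real.cos θ * x i + Real.sin θ * z i) j
  unfold Gp at e1 e2
  rw [zero_add] at e1
  rw [e1, e2]
  have e3 : ∏ k ∈ Finset.univ.erase j, RF a b (Real.sin θ * s) k (ee j k)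
      (Real.cos θ * x k + Real.sin θ * z k) = ∏ k ∈ Finset.univ.erase j,
      RF a b (Real.sin θ * s) k 0 (Real.cos θ * x k + Real.sin θ * z k) := by
    refine Finset.prod_congr rfl fun k hk => ?_
    have : k ≠ j := Finset.ne_of_mem_erase hk
    simp [ee, this]
  have e4 : ee j j = 1 := by simp [ee]
  rw [e3, e4]
  simp only [Pi.zero_apply, smul_eq_mul, zero_add]
  ring

lemma ee2_le {d : ℕ} (j k i : Fin d) : (ee j + ee k) i ≤ 4 := by
  have h1 := ee_le j i
  have h2 := ee_le k i
  simp only [Pi.add_apply]; omega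

lemma ee1_le {d : ℕ} (j i : Fin d) : (ee j) i ≤ 4 := by
  have h1 := ee_le j i
  omega

/-- Stein identity applied to the smoothed rectangle -/
lemma stein_inner {d : ℕ} (S : Matrix (Fin d) (Fin d) ℝ) (hS : S.PosDef) (a b : Fin d → ℝ)
    (τ c u : ℝ) (hτ : 0 < τ) (x : Fin d → ℝ) (j : Fin d) :
    ∫ z, z j * Gp (RF a b τ) (ee j) (fun i => c * x i + u * z i) ∂(gaussianMeasure d S) =
      ∫ z, ∑ k, S j k * (u * Gp (RF a b τ) (ee j + ee k) (fun i => c * x i + u * z i))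
        ∂(gaussianMeasure d S) := by
  obtain ⟨B, hB0, hB⟩ := Gp_bdd a b τ hτ
  have hT : Sᵀ = S := hS.isHermitian
  have hcont : Continuous (fun z : Fin d → ℝ => (fun i => c * x i + u * z i)) := by fun_prop
  refine gm_stein S hS j _ _ ((Gp_RF_continuous a b τ _).comp hcont) ?_ B
    (∑ k, |S j k| * (|u| * B)) (fun z => hB τ le_rfl _ (ee1_le j) _) ?_ ?_
  · exact continuous_finsetSum _ fun k _ =>
      (((Gp_RF_continuous a b τ _).comp hcont).const_mul u).const_mul _
  · intro z
    refine (Finset.abs_sum_le_sum_abs _ _).trans (Finset.sum_le_sum fun k _ => ?_)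
    rw [abs_mul, abs_mul]
    have := hB τ le_rfl _ (ee2_le j k) (fun i => c * x i + u * z i)
    gcongr
  · intro z
    unfold HasLineDerivAt
    have h := Gp_hasDerivAt (RF a b τ) (ee j) (fun i => c * x i + u * z i)
      (fun i => u * S j i) 0 (fun i y => RF_hasDerivAt a b τ i _ (by have := ee_le j i; omega) y)
    have e : (fun v : ℝ => Gp (RF a b τ) (ee j) (fun i => c * x i +
        u * (z + v • S.mulVec (Pi.single j 1)) i)) =
        fun v => Gp (RF a b τ) (ee j) (fun i => c * x i + u * z i + v * (u * S j i)) := by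
      funext v
      congr 1
      funext i
      have : S.mulVec (Pi.single j 1) i = S j i := by
        rw [mulVec_single_one]
        show S i j = S j i
        conv_lhs => rw [← hT]
        rfl
      simp only [Pi.add_apply, Pi.smul_apply, smul_eq_mul, this]
      ring
    rw [e]
    refine h.congr_deriv ?_
    simp only [zero_mul, add_zero]
    refine Finset.sum_congr rfl fun k _ => ?_
    ring


section prodint
variable {d : ℕ} {Ω : Type} [MeasurableSpace Ω]

lemma int_dom (P : Measure Ω) [IsProbabilityMeasure P] (W : Ω → Fin d → ℝ)
    (hWi : ∀ j, Integrable (fun ω => W ω j) P) (S : Matrix (Fin d) (Fin d) ℝ) (hS : S.PosDef) :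
    Integrable (fun p : Ω × (Fin d → ℝ) => ∑ j, (1 + |W p.1 j| + |p.2 j|))
      (P.prod (gaussianMeasure d S)) := by
  have := gm_prob S hS
  refine integrable_finsetSum _ fun j _ => ?_
  refine ((integrable_const 1).add ?_).add ?_
  · exact ((hWi j).abs).comp_fst _
  · exact (gm_coord_int S hS j).comp_snd _

lemma comb_meas (W : Ω → Fin d → ℝ) (hW : Measurable W) (c u : ℝ) :
    Measurable (fun p : Ω × (Fin d → ℝ) => (fun i => c * W p.1 i + u * p.2 i)) := by
  refine measurable_pi_lambda _ fun i => ?_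
  have h1 : Measurable fun p : Ω × (Fin d → ℝ) => W p.1 i :=
    (measurable_pi_apply i).comp (hW.comp measurable_fst)
  have h2 : Measurable fun p : Ω × (Fin d → ℝ) => p.2 i :=
    (measurable_pi_apply i).comp measurable_snd
  exact (h1.const_mul c).add (h2.const_mul u)

lemma W_meas (W : Ω → Fin d → ℝ) (hW : Measurable W) (j : Fin d) :
    Measurable (fun p : Ω × (Fin d → ℝ) => W p.1 j) :=
  (measurable_pi_apply j).comp (hW.comp measurable_fst)

lemma z_meas (j : Fin d) : Measurable (fun p : Ω × (Fin d → ℝ) => p.2 j) :=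
  (measurable_pi_apply j).comp measurable_snd

/-- theta derivative integrand -/
def Dth (a b : Fin d → ℝ) (s : ℝ) (W : Ω → Fin d → ℝ) (θ : ℝ) (p : Ω × (Fin d → ℝ)) : ℝ :=
  ∑ j, ((-Real.sin θ * W p.1 j + Real.cos θ * p.2 j) * Gp (RF a b (Real.sin θ * s)) (ee j)
          (fun i => Real.cos θ * W p.1 i + Real.sin θ * p.2 i) +
        s ^ 2 * (Real.sin θ * Real.cos θ) * Gp (RF a b (Real.sin θ * s)) (ee j + ee j)
          (fun i => Real.cos θ * W p.1 i + Real.sin θ * p.2 i))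

lemma Dth_meas (a b : Fin d → ℝ) (s : ℝ) (W : Ω → Fin d → ℝ) (hW : Measurable W) (θ : ℝ) :
    Measurable (Dth a b s W θ) := by
  unfold Dth
  refine Finset.measurable_fun_sum _ fun j _ => ?_
  have h := comb_meas W hW (Real.cos θ) (Real.sin θ)
  refine Measurable.add (Measurable.mul ?_ ?_) (Measurable.const_mul ?_ _)
  · exact ((W_meas W hW j).const_mul _).add ((z_meas j).const_mul _)
  · exact (Gp_RF_continuous a b _ _).measurable.comp h
  · exact (Gp_RF_continuous a b _ _).measurable.comp h

set_option linter.unusedSectionVars false in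
lemma Dth_bound (a b : Fin d → ℝ) (s : ℝ) (W : Ω → Fin d → ℝ) (θ B c0 : ℝ) (hB0 : 0 ≤ B)
    (hB : ∀ τ, c0 ≤ τ → ∀ n : Fin d → ℕ, (∀ i, n i ≤ 4) → ∀ y, |Gp (RF a b τ) n y| ≤ B)
    (hθ : c0 ≤ Real.sin θ * s) (p : Ω × (Fin d → ℝ)) :
    |Dth a b s W θ p| ≤ B * (1 + s ^ 2) * ∑ j, (1 + |W p.1 j| + |p.2 j|) := by
  unfold Dth
  rw [Finset.mul_sum]
  refine (Finset.abs_sum_le_sum_abs _ _).trans (Finset.sum_le_sum fun j _ => ?_)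
  refine (abs_add_le _ _).trans ?_
  rw [abs_mul, abs_mul (s ^ 2 * _), abs_mul (s ^ 2), abs_mul (Real.sin θ)]
  have h1 := hB _ hθ _ (ee1_le j) (fun i => Real.cos θ * W p.1 i + Real.sin θ * p.2 i)
  have h2 := hB _ hθ _ (ee2_le j j) (fun i => Real.cos θ * W p.1 i + Real.sin θ * p.2 i)
  have hs := Real.abs_sin_le_one θ
  have hc := Real.abs_cos_le_one θ
  have h3 : |-Real.sin θ * W p.1 j + Real.cos θ * p.2 j| ≤ |W p.1 j| + |p.2 j| := by
    refine (abs_add_le _ _).trans ?_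
    rw [abs_mul, abs_mul, abs_neg]
    have := mul_le_of_le_one_left (abs_nonneg (W p.1 j)) hs
    have := mul_le_of_le_one_left (abs_nonneg (p.2 j)) hc
    linarith
  have h4 : |Real.sin θ| * |Real.cos θ| ≤ 1 := mul_le_one₀ hs (abs_nonneg _) hc
  rw [abs_of_nonneg (sq_nonneg s)]
  have h5 : s ^ 2 * (|Real.sin θ| * |Real.cos θ|) ≤ s ^ 2 * 1 := by gcongr
  have hw := abs_nonneg (W p.1 j)
  have hz := abs_nonneg (p.2 j)
  calc _ ≤ (|W p.1 j| + |p.2 j|) * B + s ^ 2 * 1 * B := by gcongr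
    _ ≤ _ := by
      have : 0 ≤ B * s ^ 2 * (|W p.1 j| + |p.2 j|) := by positivity
      nlinarith

/-- the interpolating function -/
def psi (P : Measure Ω) (S : Matrix (Fin d) (Fin d) ℝ) (a b : Fin d → ℝ) (s : ℝ)
    (W : Ω → Fin d → ℝ) (θ : ℝ) : ℝ :=
  ∫ p, Gp (RF a b (Real.sin θ * s)) 0 (fun i => Real.cos θ * W p.1 i + Real.sin θ * p.2 i)
    ∂(P.prod (gaussianMeasure d S))

lemma psi_hasDerivAt (P : Measure Ω) [IsProbabilityMeasure P] (W : Ω → Fin d → ℝ)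
    (hW : Measurable W) (hWi : ∀ j, Integrable (fun ω => W ω j) P)
    (S : Matrix (Fin d) (Fin d) ℝ) (hS : S.PosDef) (a b : Fin d → ℝ) (s : ℝ) (hs : 0 < s) (θ : ℝ)
    (hθ : 0 < Real.sin θ) :
    Integrable (Dth a b s W θ) (P.prod (gaussianMeasure d S)) ∧
    HasDerivAt (psi P S a b s W) (∫ p, Dth a b s W θ p ∂(P.prod (gaussianMeasure d S))) θ := by
  have := gm_prob S hS
  set c0 := Real.sin θ / 2 * s with hc0d
  have hc0 : 0 < c0 := by positivity
  obtain ⟨B, hB0, hB⟩ := Gp_bdd a b c0 hc0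
  have hnhds : {θ' | Real.sin θ / 2 < Real.sin θ'} ∈ nhds θ :=
    (isOpen_lt continuous_const Real.continuous_sin).mem_nhds (by
      show Real.sin θ / 2 < Real.sin θ
      linarith)
  have hsin : ∀ θ', θ' ∈ {θ' | Real.sin θ / 2 < Real.sin θ'} → c0 ≤ Real.sin θ' * s := by
    intro θ' h
    have h' : Real.sin θ / 2 < Real.sin θ' := h
    rw [hc0d]; gcongr
  have hmeas : ∀ θ', Measurable (fun p : Ω × (Fin d → ℝ) => Gp (RF a b (Real.sin θ' * s)) 0
      (fun i => Real.cos θ' * W p.1 i + Real.sin θ' * p.2 i)) := fun θ' =>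
    (Gp_RF_continuous a b _ _).measurable.comp (comb_meas W hW _ _)
  have hfin : ∀ θ', θ' ∈ {θ' | Real.sin θ / 2 < Real.sin θ'} → ∀ p : Ω × (Fin d → ℝ),
      HasDerivAt (fun θ' => Gp (RF a b (Real.sin θ' * s)) 0
        (fun i => Real.cos θ' * W p.1 i + Real.sin θ' * p.2 i)) (Dth a b s W θ' p) θ' := by
    intro θ' h p
    have h' : Real.sin θ / 2 < Real.sin θ' := h
    exact Gp_theta a b s hs.ne' (W p.1) p.2 θ' (by linarith)
  have hInt0 : Integrable (fun p : Ω × (Fin d → ℝ) => Gp (RF a b (Real.sin θ * s)) 0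
      (fun i => Real.cos θ * W p.1 i + Real.sin θ * p.2 i)) (P.prod (gaussianMeasure d S)) := by
    refine Integrable.of_bound (hmeas θ).aestronglyMeasurable B
      (Filter.Eventually.of_forall fun p => ?_)
    exact hB _ (hsin θ (mem_of_mem_nhds hnhds)) _ (fun i => by simp) _
  have hdb : ∀ p : Ω × (Fin d → ℝ), ∀ θ' ∈ {θ' | Real.sin θ / 2 < Real.sin θ'},
      ‖Dth a b s W θ' p‖ ≤ B * (1 + s ^ 2) * ∑ j, (1 + |W p.1 j| + |p.2 j|) := by
    intro p θ' h
    exact Dth_bound a b s W θ' B c0 hB0 hB (hsin θ' h) p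
  have hfinal := hasDerivAt_integral_of_dominated_loc_of_deriv_le
    (μ := P.prod (gaussianMeasure d S))
    (F := fun θ' (p : Ω × (Fin d → ℝ)) => Gp (RF a b (Real.sin θ' * s)) 0
        (fun i => Real.cos θ' * W p.1 i + Real.sin θ' * p.2 i))
    (F' := fun θ' p => Dth a b s W θ' p)
    (x₀ := θ)
    (s := {θ' | Real.sin θ / 2 < Real.sin θ'})
    (bound := fun p => B * (1 + s ^ 2) * ∑ j, (1 + |W p.1 j| + |p.2 j|))
    hnhds (Filter.Eventually.of_forall fun θ' => (hmeas θ').aestronglyMeasurable) hInt0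
    (Dth_meas a b s W hW θ).aestronglyMeasurable
    (Filter.Eventually.of_forall hdb) ((int_dom P W hWi S hS).const_mul _)
    (Filter.Eventually.of_forall fun p θ' h => hfin θ' h p)
  exact hfinal

end prodint


lemma psi_deriv_eq {d : ℕ} {Ω : Type} [MeasurableSpace Ω] (P : Measure Ω) [IsProbabilityMeasure P]
    (W : Ω → Fin d → ℝ)
    (hW : Measurable W) (hWi : ∀ j, Integrable (fun ω => W ω j) P)
    (S S' : Matrix (Fin d) (Fin d) ℝ) (hS' : S'.PosDef) (a b : Fin d → ℝ) (s : ℝ) (hs : 0 < s)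
    (hSS : S = S' + s ^ 2 • 1) (θ : ℝ) (hθ : 0 < Real.sin θ) :
    ∫ p, Dth a b s W θ p ∂(P.prod (gaussianMeasure d S')) =
      Real.sin θ * ∫ z, ∫ ω, (∑ j, ∑ k, S j k * (Real.cos θ * Gp (RF a b (Real.sin θ * s))
          (ee j + ee k) (fun i => Real.cos θ * W ω i + Real.sin θ * z i)) -
        ∑ j, W ω j * Gp (RF a b (Real.sin θ * s)) (ee j)
          (fun i => Real.cos θ * W ω i + Real.sin θ * z i)) ∂P ∂(gaussianMeasure d S') := by
  have := gm_prob S' hS'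
  set τ := Real.sin θ * s with hτd
  have hτ : 0 < τ := by positivity
  obtain ⟨B, hB0, hB⟩ := Gp_bdd a b τ hτ
  set u := Real.sin θ with hu
  set c := Real.cos θ with hc
  have hGm : ∀ n : Fin d → ℕ, Measurable (fun p : Ω × (Fin d → ℝ) =>
      Gp (RF a b τ) n (fun i => c * W p.1 i + u * p.2 i)) := fun n =>
    (Gp_RF_continuous a b τ n).measurable.comp (comb_meas W hW c u)
  let E : Ω × (Fin d → ℝ) → ℝ := fun p =>
    ∑ j, ∑ k, S j k * (c * Gp (RF a b τ) (ee j + ee k) (fun i => c * W p.1 i + u * p.2 i)) -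
        ∑ j, W p.1 j * Gp (RF a b τ) (ee j) (fun i => c * W p.1 i + u * p.2 i)
  have iD := (psi_hasDerivAt P W hW hWi S' hS' a b s hs θ hθ).1
  have iE : Integrable E (P.prod (gaussianMeasure d S')) := by
    refine Integrable.sub (integrable_finsetSum _ fun j _ => integrable_finsetSum _ fun k _ => ?_)
      (integrable_finsetSum _ fun j _ => ?_)
    · refine Integrable.const_mul (Integrable.const_mul ?_ _) _
      exact Integrable.of_bound (hGm _).aestronglyMeasurable B
        (Filter.Eventually.of_forall fun p => hB τ le_rfl _ (ee2_le j k) _)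
    · have h1 : Integrable (fun p : Ω × (Fin d → ℝ) => |W p.1 j| * B)
          (P.prod (gaussianMeasure d S')) := (((hWi j).abs).comp_fst _).mul_const B
      refine h1.mono' ((W_meas W hW j).mul (hGm _)).aestronglyMeasurable
        (Filter.Eventually.of_forall fun p => ?_)
      rw [Real.norm_eq_abs, abs_mul]
      exact mul_le_mul_of_nonneg_left (hB τ le_rfl _ (ee1_le j) _) (abs_nonneg _)
  have hpt : ∀ p : Ω × (Fin d → ℝ), Dth a b s W θ p - u * E p = c * ∑ j, (p.2 j *
      Gp (RF a b τ) (ee j) (fun i => c * W p.1 i + u * p.2 i) -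
      ∑ k, S' j k * (u * Gp (RF a b τ) (ee j + ee k) (fun i => c * W p.1 i + u * p.2 i))) := by
    intro p
    have hSjk : ∀ j, ∑ k, S j k * (c * Gp (RF a b τ) (ee j + ee k)
        (fun i => c * W p.1 i + u * p.2 i)) = c * ∑ k, S' j k * (Gp (RF a b τ) (ee j + ee k)
        (fun i => c * W p.1 i + u * p.2 i)) + s ^ 2 * c * Gp (RF a b τ) (ee j + ee j)
        (fun i => c * W p.1 i + u * p.2 i) := by
      intro j
      rw [hSS]
      simp only [Matrix.add_apply, Matrix.smul_apply, Matrix.one_apply, smul_eq_mul, add_mul,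
        Finset.sum_add_distrib, mul_ite, mul_one, mul_zero, ite_mul, zero_mul, Finset.sum_ite_eq,
        Finset.mem_univ, if_true, Finset.mul_sum]
      congr 1
      · refine Finset.sum_congr rfl fun k _ => ?_
        ring
      · ring
    simp only [Dth, E, hSjk, ← hu, ← hc, ← hτd]
    rw [← Finset.sum_sub_distrib, Finset.mul_sum, Finset.mul_sum, ← Finset.sum_sub_distrib]
    refine Finset.sum_congr rfl fun j _ => ?_
    have : ∑ k, S' j k * (u * Gp (RF a b τ) (ee j + ee k) (fun i => c * W p.1 i + u * p.2 i)) =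
        u * ∑ k, S' j k * Gp (RF a b τ) (ee j + ee k) (fun i => c * W p.1 i + u * p.2 i) := by
      rw [Finset.mul_sum]
      refine Finset.sum_congr rfl fun k _ => ?_
      ring
    rw [this]
    ring
  have h0 : ∫ p, (Dth a b s W θ p - u * E p) ∂(P.prod (gaussianMeasure d S')) = 0 := by
    have iDE : Integrable (fun p => Dth a b s W θ p - u * E p) (P.prod (gaussianMeasure d S')) :=
      iD.sub (iE.const_mul u)
    rw [integral_prod _ iDE]
    have : ∀ ω, ∫ z, (Dth a b s W θ (ω, z) - u * E (ω, z)) ∂(gaussianMeasure d S') = 0 := by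
      intro ω
      simp only [hpt]
      have hcont : Continuous (fun z : Fin d → ℝ => (fun i => c * W ω i + u * z i)) := by fun_prop
      have i1 : ∀ j, Integrable (fun z : Fin d → ℝ => z j *
          Gp (RF a b τ) (ee j) (fun i => c * W ω i + u * z i)) (gaussianMeasure d S') := by
        intro j
        refine ((gm_coord_int S' hS' j).mul_const B).mono' (((continuous_apply j).mul
          ((Gp_RF_continuous a b τ _).comp hcont)).aestronglyMeasurable)
          (Filter.Eventually.of_forall fun z => ?_)
        rw [Real.norm_eq_abs, abs_mul]
        exact mul_le_mul_of_nonneg_left (hB τ le_rfl _ (ee1_le j) _) (abs_nonneg _)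
      have i2 : ∀ j, Integrable (fun z : Fin d → ℝ => ∑ k, S' j k * (u *
          Gp (RF a b τ) (ee j + ee k) (fun i => c * W ω i + u * z i))) (gaussianMeasure d S') := by
        intro j
        refine integrable_finsetSum _ fun k _ => Integrable.const_mul (Integrable.const_mul ?_ _) _
        exact Integrable.of_bound ((Gp_RF_continuous a b τ _).comp hcont).aestronglyMeasurable B
          (Filter.Eventually.of_forall fun p => hB τ le_rfl _ (ee2_le j k) _)
      have i3 : ∀ j, Integrable (fun z : Fin d → ℝ => z j * Gp (RF a b τ) (ee j)
          (fun i => c * W ω i + u * z i) - ∑ k, S' j k * (u *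
          Gp (RF a b τ) (ee j + ee k) (fun i => c * W ω i + u * z i))) (gaussianMeasure d S') :=
        fun j => (i1 j).sub (i2 j)
      rw [integral_const_mul, integral_finsetSum _ fun j _ => i3 j]
      have : ∀ j, ∫ z : Fin d → ℝ, (z j * Gp (RF a b τ) (ee j) (fun i => c * W ω i + u * z i) -
          ∑ k, S' j k * (u * Gp (RF a b τ) (ee j + ee k) (fun i => c * W ω i + u * z i)))
          ∂(gaussianMeasure d S') = 0 := by
        intro j
        rw [integral_sub (i1 j) (i2 j), stein_inner S' hS' a b τ c u hτ (W ω) j, sub_self]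
      simp only [this, Finset.sum_const_zero, mul_zero]
    simp only [this, integral_zero]
  rw [integral_sub iD (iE.const_mul u), integral_const_mul, sub_eq_zero] at h0
  rw [h0, integral_prod_symm _ iE]

/-- bound on the derivative of the interpolation -/
lemma psi_deriv_bound {d : ℕ} {Ω : Type} [MeasurableSpace Ω] (P : Measure Ω)
    [IsProbabilityMeasure P]
    (W W' : Ω → Fin d → ℝ) (hW : Measurable W) (hW' : Measurable W')
    (hWi : ∀ j, Integrable (fun ω => W ω j) P)
    (hex : Measure.map (fun ω => (W ω, W' ω)) P = Measure.map (fun ω => (W' ω, W ω)) P)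
    (Λ : Matrix (Fin d) (Fin d) ℝ) (hΛ : Λ.det ≠ 0) (R : Ω → Fin d → ℝ)
    (hR : P[fun ω => W' ω - W ω | MeasurableSpace.comap W inferInstance]
          =ᵐ[P] fun ω => -Λ.mulVec (W ω + R ω))
    (D : Ω → Fin d → ℝ) (hD : D = (fun ω => W' ω - W ω)) (hD4 : Integrable (fun ω => ‖D ω‖ ^ 4) P)
    (S S' : Matrix (Fin d) (Fin d) ℝ) (hS' : S'.PosDef) (η : ℝ)
    (hd : 3 ≤ d) (L : ℝ) (hL1 : 1 ≤ L) (hL : L ^ 2 = Real.log d)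
    (a b : Fin d → ℝ) (hab : ∀ i, a i ≤ b i) (s : ℝ) (hs : 0 < s) (hSS : S = S' + s ^ 2 • 1)
    (r1 r2 r3 : ℝ) (hr1 : r1 = ∫ ω, ⨆ j, |R ω j| ∂P)
    (hr2 : r2 = ∫ ω, ⨆ j, ⨆ k, |S j k - (1 / 2) *
            (P[fun ω' => Λ⁻¹.mulVec (D ω') j * D ω' k |
                MeasurableSpace.comap W inferInstance]) ω| ∂P)
    (hr3 : r3 = (∫ ω, ⨆ j, ⨆ k, ⨆ l, ⨆ m,
          (P[fun ω' => |Λ⁻¹.mulVec (D ω') j * D ω' k * D ω' l * D ω' m| |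
              MeasurableSpace.comap W inferInstance]) ω ∂P) +
        ∫ ω in {ω | η < ‖D ω‖}, ⨆ j, ⨆ k, ⨆ l, ⨆ m,
          |Λ⁻¹.mulVec (D ω) j * D ω k * D ω l * D ω m| ∂P)
    (h2 : 0 ≤ r2) (h3 : 0 ≤ r3)
    (θ : ℝ) (hθ : 0 < θ) (hθ1 : θ ≤ π / 2) (hη : η ≤ θ * (2 * s / L)) :
    |∫ p, Dth a b s W θ p ∂(P.prod (gaussianMeasure d S'))| ≤
      K2 * (L / s) * r1 + K2 * (L / s) ^ 2 * r2 / θ + K2 * (L / s) ^ 4 * r3 / θ ^ 3 := by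
  have hsin : 0 < Real.sin θ := Real.sin_pos_of_pos_of_lt_pi hθ (by linarith [Real.pi_pos])
  have hcos : 0 ≤ Real.cos θ := Real.cos_nonneg_of_neg_pi_div_two_le_of_le
    (by linarith [Real.pi_pos]) hθ1
  have hL0 : 0 < L := by linarith
  have hts : θ * Real.cos θ ≤ Real.sin θ := by
    rcases hθ1.eq_or_lt with h | h
    · rw [h]; simp
    · have h1 := Real.le_tan hθ.le h
      have hc0 : 0 < Real.cos θ := Real.cos_pos_of_mem_Ioo ⟨by linarith, h⟩
      rwa [Real.tan_eq_sin_div_cos, le_div_iff₀ hc0] at h1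
  have hcot : Real.cos θ / Real.sin θ ≤ 1 / θ := by
    rw [div_le_div_iff₀ hsin hθ]; linarith
  have hcot0 : 0 ≤ Real.cos θ / Real.sin θ := by positivity
  rw [psi_deriv_eq P W hW hWi S S' hS' a b s hs hSS θ hsin, abs_mul, abs_of_pos hsin]
  have := gm_prob S' hS'
  have hb := fun z : Fin d → ℝ => exch_rect P W W' hW hW' hWi hex Λ hΛ R hR D hD hD4 S η hd L hL1 hL
    a b hab (Real.sin θ * s) (2 / L) (Real.cos θ) (by positivity) (by positivity) le_rfl hcos
    (by
      have h1 : Real.cos θ * η ≤ Real.cos θ * (θ * (2 * s / L)) := by gcongr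
      have h4 : (θ * Real.cos θ) * (2 * s / L) ≤ Real.sin θ * (2 * s / L) := by gcongr
      calc _ ≤ _ := h1
        _ = (θ * Real.cos θ) * (2 * s / L) := by ring
        _ ≤ _ := h4
        _ = _ := by ring) (fun i => Real.sin θ * z i)
  rw [← hr1, ← hr2, ← hr3] at hb
  simp only [← Real.norm_eq_abs] at hb
  have hn := norm_integral_le_of_norm_le_const (μ := gaussianMeasure d S')
    (Filter.Eventually.of_forall hb)
  rw [probReal_univ, mul_one, Real.norm_eq_abs] at hn
  have hK := K2_pos
  refine (mul_le_mul_of_nonneg_left hn hsin.le).trans ?_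
  have e : Real.sin θ * (K2 * (L / (Real.sin θ * s)) * r1 +
      Real.cos θ * (K2 * (L / (Real.sin θ * s)) ^ 2) * r2 +
      Real.cos θ ^ 3 * (K2 * (L / (Real.sin θ * s)) ^ 4) * r3) =
      K2 * (L / s) * r1 + K2 * (L / s) ^ 2 * r2 * (Real.cos θ / Real.sin θ) +
      K2 * (L / s) ^ 4 * r3 * (Real.cos θ / Real.sin θ) ^ 3 := by
    field_simp
  rw [e]
  have e1 : K2 * (L / s) ^ 2 * r2 * (Real.cos θ / Real.sin θ) ≤ K2 * (L / s) ^ 2 * r2 * (1 / θ) := by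
    gcongr
  have e2 : K2 * (L / s) ^ 4 * r3 * (Real.cos θ / Real.sin θ) ^ 3 ≤
      K2 * (L / s) ^ 4 * r3 * (1 / θ) ^ 3 := by gcongr
  have e3 : K2 * (L / s) ^ 2 * r2 * (1 / θ) = K2 * (L / s) ^ 2 * r2 / θ := by ring
  have e4 : K2 * (L / s) ^ 4 * r3 * (1 / θ) ^ 3 = K2 * (L / s) ^ 4 * r3 / θ ^ 3 := by
    field_simp
  linarith

/-- integrating the derivative bound -/
lemma integrate_bound (f f' : ℝ → ℝ) (θ0 θ1 A1 A2 A3 : ℝ) (h0 : 0 < θ0) (h01 : θ0 ≤ θ1)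
    (hf : ∀ θ ∈ Set.Icc θ0 θ1, HasDerivAt f (f' θ) θ)
    (hb : ∀ θ ∈ Set.Icc θ0 θ1, |f' θ| ≤ A1 + A2 / θ + A3 / θ ^ 3) :
    |f θ1 - f θ0| ≤ A1 * (θ1 - θ0) + A2 * (Real.log θ1 - Real.log θ0) +
      A3 * (1 / (2 * θ0 ^ 2) - 1 / (2 * θ1 ^ 2)) := by
  let H : ℝ → ℝ := fun θ => A1 * θ + A2 * Real.log θ - A3 * (1 / (2 * θ ^ 2))
  have hH : ∀ θ ∈ Set.Icc θ0 θ1, HasDerivAt H (A1 + A2 / θ + A3 / θ ^ 3) θ := by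
    intro θ hθ
    have hp : 0 < θ := h0.trans_le hθ.1
    have h1 := (hasDerivAt_id θ).const_mul A1
    have h2 := (Real.hasDerivAt_log hp.ne').const_mul A2
    have h3 : HasDerivAt (fun θ : ℝ => 1 / (2 * θ ^ 2)) (-1 / θ ^ 3) θ := by
      have := (((hasDerivAt_pow 2 θ).const_mul 2).inv (by positivity : 2 * θ ^ 2 ≠ 0))
      simp only [one_div]
      refine this.congr_deriv ?_
      field_simp
      norm_num
    refine ((h1.add h2).sub (h3.const_mul A3)).congr_deriv ?_
    field_simp
    ring
  have key : ∀ ε : ℝ, |ε| = 1 → ε * (f θ1 - f θ0) ≤ H θ1 - H θ0 := by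
    intro ε hε
    have hm : MonotoneOn (fun θ => H θ - ε * f θ) (Set.Icc θ0 θ1) := by
      refine monotoneOn_of_deriv_nonneg (convex_Icc _ _) ?_ ?_ ?_
      · intro θ hθ
        exact (((hH θ hθ).sub ((hf θ hθ).const_mul ε)).continuousAt).continuousWithinAt
      · intro θ hθ
        have hθ' := interior_subset hθ
        exact (((hH θ hθ').sub ((hf θ hθ').const_mul ε)).differentiableAt).differentiableWithinAt
      · intro θ hθ
        have hθ' := interior_subset hθ
        have hder : deriv (fun θ => H θ - ε * f θ) θ = A1 + A2 / θ + A3 / θ ^ 3 - ε * f' θ :=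
          ((hH θ hθ').sub ((hf θ hθ').const_mul ε)).deriv
        rw [hder]
        have h1 := hb θ hθ'
        have h2 : ε * f' θ ≤ |f' θ| := by
          calc ε * f' θ ≤ |ε * f' θ| := le_abs_self _
            _ = |f' θ| := by rw [abs_mul, hε, one_mul]
        linarith
    have := hm ⟨le_rfl, h01⟩ ⟨h01, le_rfl⟩ h01
    simp only at this
    linarith
  have k1 := key 1 (by simp)
  have k2 := key (-1) (by simp)
  have e : H θ1 - H θ0 = A1 * (θ1 - θ0) + A2 * (Real.log θ1 - Real.log θ0) +
      A3 * (1 / (2 * θ0 ^ 2) - 1 / (2 * θ1 ^ 2)) := by simp only [H]; ring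
  rw [← e, abs_le]
  constructor <;> linarith


lemma stdG_box {d : ℕ} (a b y : Fin d → ℝ) (hab : ∀ i, a i ≤ b i) (τ : ℝ) (hτ : 0 < τ) :
    stdG d {g | (fun i => y i + τ * g i) ∈ rect a b} =
      ENNReal.ofReal (Gp (RF a b τ) 0 y) := by
  have e : {g : Fin d → ℝ | (fun i => y i + τ * g i) ∈ rect a b} =
      Set.pi Set.univ (fun i => Set.Ioo ((a i - y i) / τ) ((b i - y i) / τ)) := by
    ext g
    simp only [rect, Set.mem_ofPred_eq, Set.mem_pi, Set.mem_univ, forall_true_left, Set.mem_Ioo,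
      div_lt_iff₀ hτ, lt_div_iff₀ hτ]
    refine forall_congr' fun i => ?_
    constructor <;> rintro ⟨h1, h2⟩ <;> constructor <;> linarith
  rw [e]
  unfold stdG
  rw [Measure.pi_pi]
  have h1 : ∀ i, (a i - y i) / τ ≤ (b i - y i) / τ := fun i => by
    have := hab i
    gcongr
  simp only [gaussian_Ioo _ _ (h1 _)]
  rw [← ENNReal.ofReal_prod_of_nonneg fun i _ => sub_nonneg.2 (nPhi_mono (h1 i))]
  congr 1
  unfold Gp RF
  simp [nder]

lemma Gp0_nonneg {d : ℕ} (a b y : Fin d → ℝ) (hab : ∀ i, a i ≤ b i) (τ : ℝ) (hτ : 0 < τ) :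
    0 ≤ Gp (RF a b τ) 0 y := by
  unfold Gp RF
  refine Finset.prod_nonneg fun i _ => ?_
  simp only [nder, Pi.zero_apply, pow_zero, one_mul]
  refine sub_nonneg.2 (nPhi_mono ?_)
  have := hab i
  gcongr

lemma comb_cont {d : ℕ} (x : Fin d → ℝ) (c u : ℝ) :
    Continuous (fun z : Fin d → ℝ => (fun i => c * x i + u * z i)) := by fun_prop

lemma smooth_rect {d : ℕ} (S S' : Matrix (Fin d) (Fin d) ℝ) (hS : S.PosDef) (hS' : S'.PosDef)
    (s : ℝ) (hs : 0 < s) (hSS : S = S' + s ^ 2 • 1) (a b : Fin d → ℝ) (hab : ∀ i, a i ≤ b i)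
    (x : Fin d → ℝ) (c u : ℝ) (hu : 0 < u) :
    ∫ z, Gp (RF a b (u * s)) 0 (fun i => c * x i + u * z i) ∂(gaussianMeasure d S') =
      (gaussianMeasure d S).real {z | (fun i => c * x i + u * z i) ∈ rect a b} := by
  have := gm_prob S' hS'
  have hm : MeasurableSet {z : Fin d → ℝ | (fun i => c * x i + u * z i) ∈ rect a b} :=
    (comb_cont x c u).measurable (rect_meas a b)
  have hconv := gm_conv S' 1 S hS' PosDef.one hS 1 s (by rw [hSS]; simp)
  rw [gm_one] at hconv
  have hmm : Measurable (fun p : (Fin d → ℝ) × (Fin d → ℝ) => fun i => 1 * p.1 i + s * p.2 i) :=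
    comb_meas (fun z => z) measurable_id 1 s
  rw [Measure.real, hconv, Measure.map_apply hmm hm, Measure.prod_apply (hmm hm),
    integral_eq_lintegral_of_nonneg_ae
      (Filter.Eventually.of_forall fun z => Gp0_nonneg a b _ hab _ (by positivity))
      ((Gp_RF_continuous a b _ _).comp (comb_cont x c u)).aestronglyMeasurable]
  congr 1
  refine lintegral_congr fun z => ?_
  rw [← stdG_box a b _ hab _ (by positivity)]
  congr 1
  ext g
  simp only [Set.mem_ofPred_eq, Set.mem_preimage]
  have : (fun i => c * x i + u * z i + u * s * g i) = fun i => c * x i + u * (1 * z i + s * g i) := by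
    funext i; ring
  rw [this]

lemma psi_eq {d : ℕ} {Ω : Type} [MeasurableSpace Ω] (P : Measure Ω) [IsProbabilityMeasure P]
    (W : Ω → Fin d → ℝ) (hW : Measurable W)
    (S S' : Matrix (Fin d) (Fin d) ℝ) (hS : S.PosDef) (hS' : S'.PosDef)
    (s : ℝ) (hs : 0 < s) (hSS : S = S' + s ^ 2 • 1) (a b : Fin d → ℝ) (hab : ∀ i, a i ≤ b i)
    (θ : ℝ) (hθ : 0 < Real.sin θ) :
    psi P S' a b s W θ = ∫ ω, (gaussianMeasure d S).real
      {z | (fun i => Real.cos θ * W ω i + Real.sin θ * z i) ∈ rect a b} ∂P := by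
  have := gm_prob S' hS'
  unfold psi
  obtain ⟨B, hB0, hB⟩ := Gp_bdd a b (Real.sin θ * s) (by positivity)
  rw [integral_prod]
  · refine integral_congr_ae (Filter.Eventually.of_forall fun ω => ?_)
    exact smooth_rect S S' hS hS' s hs hSS a b hab (W ω) _ _ hθ
  · refine Integrable.of_bound ((Gp_RF_continuous a b _ _).measurable.comp
      (comb_meas W hW _ _)).aestronglyMeasurable B (Filter.Eventually.of_forall fun p => ?_)
    exact hB _ le_rfl _ (fun i => by simp) _

lemma posDef_sub {d : ℕ} (S : Matrix (Fin d) (Fin d) ℝ) (hS : S.PosDef) (σ : ℝ) (hσ : 0 < σ)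
    (h : IsSmallestEigenvalueSq S σ) : (S - (σ / 2) ^ 2 • 1).PosDef := by
  have hH : (S - (σ / 2) ^ 2 • (1 : Matrix (Fin d) (Fin d) ℝ)).IsHermitian := by
    refine hS.isHermitian.sub ?_
    rw [IsHermitian, conjTranspose_smul, conjTranspose_one]; simp
  rw [hH.posDef_iff_eigenvalues_pos]
  intro i
  have h1 := hH.mulVec_eigenvectorBasis i
  set v := (hH.eigenvectorBasis i).ofLp with hv
  have hv0 : v ≠ 0 := by
    intro h0
    have := hH.eigenvectorBasis.orthonormal.ne_zero i
    apply this
    ext k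
    exact congrFun h0 k
  have h2 := h.2 (show (hH.eigenvalues i + (σ / 2) ^ 2) ∈
      {r : ℝ | ∃ x : Fin d → ℝ, x ≠ 0 ∧ S.mulVec x = r • x} from ⟨v, hv0, by
    rw [sub_mulVec, smul_mulVec, one_mulVec] at h1
    rw [add_smul, ← h1]; simp⟩)
  nlinarith

lemma eps_bound {d : ℕ} {Ω : Type} [MeasurableSpace Ω] (P : Measure Ω)
    [IsProbabilityMeasure P]
    (W W' : Ω → Fin d → ℝ) (hW : Measurable W) (hW' : Measurable W')
    (hWi : ∀ j, Integrable (fun ω => W ω j) P)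
    (hex : Measure.map (fun ω => (W ω, W' ω)) P = Measure.map (fun ω => (W' ω, W ω)) P)
    (Λ : Matrix (Fin d) (Fin d) ℝ) (hΛ : Λ.det ≠ 0) (R : Ω → Fin d → ℝ)
    (hR : P[fun ω => W' ω - W ω | MeasurableSpace.comap W inferInstance]
          =ᵐ[P] fun ω => -Λ.mulVec (W ω + R ω))
    (D : Ω → Fin d → ℝ) (hD : D = (fun ω => W' ω - W ω)) (hD4 : Integrable (fun ω => ‖D ω‖ ^ 4) P)
    (S : Matrix (Fin d) (Fin d) ℝ) (hS : S.PosDef) (η : ℝ)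
    (hd : 3 ≤ d) (L : ℝ) (hL1 : 1 ≤ L) (hL : L ^ 2 = Real.log d)
    (a b : Fin d → ℝ) (hab : ∀ i, a i ≤ b i) (σ : ℝ) (hσ : 0 < σ) (hσS : IsSmallestEigenvalueSq S σ)
    (r1 r2 r3 : ℝ) (hr1 : r1 = ∫ ω, ⨆ j, |R ω j| ∂P)
    (hr2 : r2 = ∫ ω, ⨆ j, ⨆ k, |S j k - (1 / 2) *
            (P[fun ω' => Λ⁻¹.mulVec (D ω') j * D ω' k |
                MeasurableSpace.comap W inferInstance]) ω| ∂P)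
    (hr3 : r3 = (∫ ω, ⨆ j, ⨆ k, ⨆ l, ⨆ m,
          (P[fun ω' => |Λ⁻¹.mulVec (D ω') j * D ω' k * D ω' l * D ω' m| |
              MeasurableSpace.comap W inferInstance]) ω ∂P) +
        ∫ ω in {ω | η < ‖D ω‖}, ⨆ j, ⨆ k, ⨆ l, ⨆ m,
          |Λ⁻¹.mulVec (D ω) j * D ω k * D ω l * D ω m| ∂P)
    (h1 : 0 ≤ r1) (h2 : 0 ≤ r2) (h3 : 0 ≤ r3)
    (θ : ℝ) (hθ : 0 < θ) (hθ1 : θ ≤ π / 2) (hη : η ≤ θ * (σ / L)) :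
    |(gaussianMeasure d S).real (rect a b) - ∫ ω, (gaussianMeasure d S).real
      {z | (fun i => Real.cos θ * W ω i + Real.sin θ * z i) ∈ rect a b} ∂P| ≤
      16 * K2 * ((L / σ) * r1 + (L / σ) ^ 2 * r2 * (1 - Real.log θ) + (L / σ) ^ 4 * r3 / θ ^ 2) := by
  have hS' := posDef_sub S hS σ hσ hσS
  set s := σ / 2 with hsd
  set S' := S - s ^ 2 • (1 : Matrix (Fin d) (Fin d) ℝ) with hS'd
  have hs : 0 < s := by positivity
  have hSS : S = S' + s ^ 2 • 1 := by rw [hS'd]; simp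
  have hL0 : 0 < L := by linarith
  have hsin : ∀ θ' ∈ Set.Icc θ (π / 2), 0 < Real.sin θ' := fun θ' h =>
    Real.sin_pos_of_pos_of_lt_pi (hθ.trans_le h.1) (by linarith [Real.pi_pos, h.2])
  have h2s : 2 * s = σ := by rw [hsd]; ring
  have hI := integrate_bound (psi P S' a b s W) (fun θ' => ∫ p, Dth a b s W θ' p
    ∂(P.prod (gaussianMeasure d S'))) θ (π / 2) (K2 * (L / s) * r1) (K2 * (L / s) ^ 2 * r2)
    (K2 * (L / s) ^ 4 * r3) hθ hθ1
    (fun θ' h => (psi_hasDerivAt P W hW hWi S' hS' a b s hs θ' (hsin θ' h)).2)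
    (fun θ' h => psi_deriv_bound P W W' hW hW' hWi hex Λ hΛ R hR D hD hD4 S S' hS' η hd L hL1 hL a b
      hab s hs hSS r1 r2 r3 hr1 hr2 hr3 h2 h3 θ' (hθ.trans_le h.1) h.2 (by
        rw [h2s]
        refine hη.trans ?_
        have := h.1
        gcongr))
  rw [psi_eq P W hW S S' hS hS' s hs hSS a b hab _ (hsin _ ⟨hθ1, le_rfl⟩),
    psi_eq P W hW S S' hS hS' s hs hSS a b hab _ (hsin _ ⟨le_rfl, hθ1⟩)] at hI
  have e0 : ∀ ω, {z : Fin d → ℝ | (fun i => Real.cos (π / 2) * W ω i + Real.sin (π / 2) * z i) ∈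
      rect a b} = rect a b := by
    intro ω; ext z; simp
  simp only [e0, integral_const, probReal_univ, one_smul] at hI
  refine hI.trans ?_
  have hK := K2_pos
  have q : L / s = 2 * (L / σ) := by rw [hsd]; field_simp
  have hp : 0 < L / σ := by positivity
  rw [q]
  have hpi := Real.pi_lt_four
  have b1 : K2 * (2 * (L / σ)) * r1 * (π / 2 - θ) ≤ K2 * (2 * (L / σ)) * r1 * 2 := by
    gcongr; linarith
  have hlog : Real.log (π / 2) - Real.log θ ≤ 1 - Real.log θ := by
    have : Real.log (π / 2) ≤ π / 2 - 1 := Real.log_le_sub_one_of_pos (by positivity)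
    linarith
  have b2 : K2 * (2 * (L / σ)) ^ 2 * r2 * (Real.log (π / 2) - Real.log θ) ≤
    K2 * (2 * (L / σ)) ^ 2 * r2 * (1 - Real.log θ) := by gcongr
  have hlog0 : 0 ≤ 1 - Real.log θ := by
    have : Real.log θ ≤ θ - 1 := Real.log_le_sub_one_of_pos hθ
    linarith
  have b3 : K2 * (2 * (L / σ)) ^ 4 * r3 * (1 / (2 * θ ^ 2) - 1 / (2 * (π / 2) ^ 2)) ≤
      K2 * (2 * (L / σ)) ^ 4 * r3 * (1 / (2 * θ ^ 2)) := by
    have : 0 ≤ 1 / (2 * (π / 2) ^ 2) := by positivity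
    gcongr; linarith
  have c1 : 0 ≤ K2 * (L / σ) * r1 := by positivity
  have c2 : 0 ≤ K2 * (L / σ) ^ 2 * r2 * (1 - Real.log θ) := by positivity
  have c3 : 0 ≤ K2 * (L / σ) ^ 4 * r3 / θ ^ 2 := by positivity
  have d3 : K2 * (2 * (L / σ)) ^ 4 * r3 * (1 / (2 * θ ^ 2)) = 8 * (K2 * (L / σ) ^ 4 * r3 / θ ^ 2) := by
    field_simp; ring
  have d2 : K2 * (2 * (L / σ)) ^ 2 * r2 * (1 - Real.log θ) =
    4 * (K2 * (L / σ) ^ 2 * r2 * (1 - Real.log θ)) := by ring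
  have d1 : K2 * (2 * (L / σ)) * r1 * 2 = 4 * (K2 * (L / σ) * r1) := by ring
  have dd : 16 * K2 * ((L / σ) * r1 + (L / σ) ^ 2 * r2 * (1 - Real.log θ) +
      (L / σ) ^ 4 * r3 / θ ^ 2) = 16 * (K2 * (L / σ) * r1) +
      16 * (K2 * (L / σ) ^ 2 * r2 * (1 - Real.log θ)) + 16 * (K2 * (L / σ) ^ 4 * r3 / θ ^ 2) := by
    ring
  rw [dd]
  linarith


lemma smooth_core {α : Type*} [MeasurableSpace α] (N : Measure α) [IsProbabilityMeasure N]
    (k : α → ℝ) (hk : Integrable k N) (bad : Set α) (hbad : MeasurableSet bad)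
    (hb4 : N.real bad ≤ 1 / 4) (v γ ε : ℝ) (hγ : 0 ≤ γ) (hε : 0 ≤ ε)
    (h1 : ∀ z, z ∉ bad → v ≤ k z) (h2 : ∀ z, -γ ≤ k z) (h3 : ∫ z, k z ∂N ≤ ε) :
    v ≤ 4 / 3 * ε + γ / 3 := by
  rcases le_or_gt v 0 with hv | hv
  · have : 0 ≤ 4 / 3 * ε + γ / 3 := by positivity
    linarith
  have hm : ∫ z, (badᶜ).indicator (fun _ => v + γ) z ∂N ≤ ∫ z, (k z + γ) ∂N := by
    refine integral_mono ((integrable_const _).indicator hbad.compl)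
      (hk.add (integrable_const _)) fun z => ?_
    by_cases hz : z ∈ bad
    · rw [Set.indicator_of_notMem (by simpa using hz)]
      linarith [h2 z]
    · rw [Set.indicator_of_mem (by simpa using hz)]
      linarith [h1 z hz]
  rw [integral_indicator_const _ hbad.compl, integral_add hk (integrable_const _), integral_const,
    probReal_univ, probReal_compl_eq_one_sub hbad] at hm
  simp only [smul_eq_mul, one_mul] at hm
  nlinarith

lemma fub_rect {d : ℕ} (Q N : Measure (Fin d → ℝ)) [IsProbabilityMeasure Q]
    [IsProbabilityMeasure N] (T : ℝ) (B : Set (Fin d → ℝ)) (hB : MeasurableSet B) :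
    Integrable (fun z => Q.real {w | (fun i => w i + T * z i) ∈ B}) N ∧
    Integrable (fun w => N.real {z | (fun i => w i + T * z i) ∈ B}) Q ∧
    ∫ z, Q.real {w | (fun i => w i + T * z i) ∈ B} ∂N =
      (Q.prod N).real {p | (fun i => p.1 i + T * p.2 i) ∈ B} ∧
    ∫ w, N.real {z | (fun i => w i + T * z i) ∈ B} ∂Q =
      (Q.prod N).real {p | (fun i => p.1 i + T * p.2 i) ∈ B} := by
  have hc : Continuous (fun p : (Fin d → ℝ) × (Fin d → ℝ) => fun i => p.1 i + T * p.2 i) := by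
    fun_prop
  have hm : MeasurableSet {p : (Fin d → ℝ) × (Fin d → ℝ) | (fun i => p.1 i + T * p.2 i) ∈ B} :=
    hc.measurable hB
  have m1 : Measurable (fun z : Fin d → ℝ => Q {w : Fin d → ℝ | (fun i => w i + T * z i) ∈ B}) :=
    measurable_measure_prodMk_right hm
  have m2 : Measurable (fun w : Fin d → ℝ => N {z : Fin d → ℝ | (fun i => w i + T * z i) ∈ B}) :=
    measurable_measure_prodMk_left hm
  refine ⟨?_, ?_, ?_, ?_⟩
  · refine Integrable.of_bound m1.ennreal_toReal.aestronglyMeasurable 1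
      (Filter.Eventually.of_forall fun z => ?_)
    rw [Real.norm_eq_abs, abs_of_nonneg measureReal_nonneg]
    exact measureReal_le_one
  · refine Integrable.of_bound m2.ennreal_toReal.aestronglyMeasurable 1
      (Filter.Eventually.of_forall fun z => ?_)
    rw [Real.norm_eq_abs, abs_of_nonneg measureReal_nonneg]
    exact measureReal_le_one
  · unfold Measure.real
    rw [Measure.prod_apply_symm hm, integral_toReal m1.aemeasurable
      (Filter.Eventually.of_forall fun z => measure_lt_top _ _)]
    rfl
  · unfold Measure.real
    rw [Measure.prod_apply hm, integral_toReal m2.aemeasurable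
      (Filter.Eventually.of_forall fun z => measure_lt_top _ _)]
    rfl

lemma rect_shift {d : ℕ} (a b z : Fin d → ℝ) (T : ℝ) :
    {w | (fun i => w i + T * z i) ∈ rect a b} =
      rect (fun i => a i - T * z i) (fun i => b i - T * z i) := by
  ext w
  simp only [rect, Set.mem_ofPred_eq]
  refine forall_congr' fun i => ?_
  constructor <;> rintro ⟨h1, h2⟩ <;> constructor <;> linarith

/-- the smoothing step, integrated form -/
lemma smooth_int {d : ℕ} (S : Matrix (Fin d) (Fin d) ℝ) (hS : S.PosDef)
    {Ω : Type} [MeasurableSpace Ω] (P : Measure Ω) [IsProbabilityMeasure P]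
    (W : Ω → Fin d → ℝ) (hW : Measurable W) (c u ε : ℝ) (hc : 0 < c) (hcu : c ^ 2 + u ^ 2 = 1)
    (hεb : ∀ a b : Fin d → ℝ, |(gaussianMeasure d S).real (rect a b) -
      ∫ ω, (gaussianMeasure d S).real {z | (fun i => c * W ω i + u * z i) ∈ rect a b} ∂P| ≤ ε)
    (a b : Fin d → ℝ) :
    Integrable (fun z => (P.map W).real (rect (fun i => a i - u / c * z i)
        (fun i => b i - u / c * z i)) - (gaussianMeasure d S).real
        (rect (fun i => a i - u / c * z i) (fun i => b i - u / c * z i))) (gaussianMeasure d S) ∧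
    |∫ z, ((P.map W).real (rect (fun i => a i - u / c * z i) (fun i => b i - u / c * z i)) -
      (gaussianMeasure d S).real (rect (fun i => a i - u / c * z i) (fun i => b i - u / c * z i)))
      ∂(gaussianMeasure d S)| ≤ ε := by
  have := gm_prob S hS
  have : IsProbabilityMeasure (P.map W) := Measure.isProbabilityMeasure_map hW.aemeasurable
  obtain ⟨i1, j1, e1, e2⟩ := fub_rect (P.map W) (gaussianMeasure d S) (u / c) (rect a b)
    (rect_meas a b)
  obtain ⟨i3, _, e3, _⟩ := fub_rect (gaussianMeasure d S) (gaussianMeasure d S) (u / c) (rect a b)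
    (rect_meas a b)
  simp only [rect_shift] at i1 e1 i3 e3
  refine ⟨i1.sub i3, ?_⟩
  rw [integral_sub i1 i3, e1, e3, ← e2]
  rw [integral_map hW.aemeasurable j1.aestronglyMeasurable]
  have h := hεb (fun i => c * a i) (fun i => c * b i)
  have hsc : ∀ x z : Fin d → ℝ, (fun i => c * x i + u * z i) ∈
      rect (fun i => c * a i) (fun i => c * b i) ↔ (fun i => x i + u / c * z i) ∈ rect a b := by
    intro x z
    simp only [rect, Set.mem_ofPred_eq]
    refine forall_congr' fun i => ?_
    have : c * x i + u * z i = c * (x i + u / c * z i) := by field_simp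
    rw [this, mul_lt_mul_iff_right₀ hc, mul_lt_mul_iff_right₀ hc]
  simp only [hsc] at h
  have hconv := gm_conv S S S hS hS hS c u (by rw [← add_smul, hcu, one_smul])
  have hmm : Measurable (fun p : (Fin d → ℝ) × (Fin d → ℝ) => fun i => c * p.1 i + u * p.2 i) :=
    comb_meas (fun z => z) measurable_id c u
  have e4 : (gaussianMeasure d S).real (rect (fun i => c * a i) (fun i => c * b i)) =
      ((gaussianMeasure d S).prod (gaussianMeasure d S)).real
        {p | (fun i => p.1 i + u / c * p.2 i) ∈ rect a b} := by
    conv_lhs => rw [hconv]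
    rw [map_measureReal_apply hmm (rect_meas _ _)]
    congr 1
    ext p
    exact hsc p.1 p.2
  rw [e4, abs_sub_comm] at h
  exact h

lemma smoothing {d : ℕ} (hd : 3 ≤ d) (S : Matrix (Fin d) (Fin d) ℝ) (hS : S.PosDef)
    (σb σl : ℝ) (hσb : 0 < σb) (hσl : 0 < σl) (hb : ∀ j, S j j ≤ σb ^ 2) (hl : ∀ j, σl ^ 2 ≤ S j j)
    (L : ℝ) (hL1 : 1 ≤ L) (hL : L ^ 2 = Real.log d)
    {Ω : Type} [MeasurableSpace Ω] (P : Measure Ω) [IsProbabilityMeasure P]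
    (W : Ω → Fin d → ℝ) (hW : Measurable W) (c u ε : ℝ) (hc : 0 < c) (hu : 0 ≤ u)
    (hcu : c ^ 2 + u ^ 2 = 1) (hε : 0 ≤ ε)
    (hεb : ∀ a b : Fin d → ℝ, |(gaussianMeasure d S).real (rect a b) -
      ∫ ω, (gaussianMeasure d S).real {z | (fun i => c * W ω i + u * z i) ∈ rect a b} ∂P| ≤ ε)
    (a b : Fin d → ℝ) :
    |(P.map W).real (rect a b) - (gaussianMeasure d S).real (rect a b)| ≤
      2 * ε + 522 * (u / c) * (σb / σl) * L ^ 2 := by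
  have := gm_prob S hS
  have : IsProbabilityMeasure (P.map W) := Measure.isProbabilityMeasure_map hW.aemeasurable
  set N := gaussianMeasure d S with hN
  set Q := P.map W with hQ
  let G : (Fin d → ℝ) × (Fin d → ℝ) → ℝ := fun p => |Q.real (rect p.1 p.2) - N.real (rect p.1 p.2)|
  have hG1 : ∀ p, G p ≤ 1 := by
    intro p
    have h1 : Q.real (rect p.1 p.2) ≤ 1 := measureReal_le_one
    have h2 : N.real (rect p.1 p.2) ≤ 1 := measureReal_le_one
    have h3 : 0 ≤ Q.real (rect p.1 p.2) := measureReal_nonneg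
    have h4 : 0 ≤ N.real (rect p.1 p.2) := measureReal_nonneg
    exact abs_le.2 ⟨by linarith, by linarith⟩
  have hbdd : BddAbove (Set.range G) := ⟨1, by rintro _ ⟨p, rfl⟩; exact hG1 p⟩
  set γ := ⨆ p, G p with hγd
  have hGγ : ∀ a b, |Q.real (rect a b) - N.real (rect a b)| ≤ γ := fun a b => le_ciSup hbdd (a, b)
  have hγ0 : 0 ≤ γ := (abs_nonneg _).trans (hGγ a b)
  set T := u / c with hT
  have hT0 : 0 ≤ T := by positivity
  set r := 3 * σb * L with hr
  have hr0 : 0 < r := by positivity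
  set δ := T * r with hδ
  have hδ0 : 0 ≤ δ := by positivity
  set bad : Set (Fin d → ℝ) := {z | ∃ j, r ≤ |z j|} with hbadd
  have hbadm : MeasurableSet bad := by
    have : bad = ⋃ j, {z | r ≤ |z j|} := by ext z; simp [bad]
    rw [this]
    exact MeasurableSet.iUnion fun j => measurableSet_le measurable_const
      (continuous_apply j).abs.measurable
  have hb4 : N.real bad ≤ 1 / 4 := gm_max_tail hd S hS σb hσb hb L hL1 hL
  have hgood : ∀ z, z ∉ bad → ∀ j, |T * z j| ≤ δ := by
    intro z hz j
    simp only [bad, Set.mem_ofPred_eq, not_exists, not_le] at hz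
    rw [abs_mul, abs_of_nonneg hT0]
    exact mul_le_mul_of_nonneg_left (hz j).le hT0
  have main : ∀ a b, |Q.real (rect a b) - N.real (rect a b)| ≤
      58 * (2 * δ / σl * L) + (4 / 3 * ε + γ / 3) := by
    intro a b
    rw [abs_le]
    constructor
    · -- lower
      obtain ⟨hi, hI⟩ := smooth_int S hS P W hW c u ε hc hcu hεb (fun i => a i + δ) (fun i => b i - δ)
      rw [← hT, ← hN, ← hQ] at hi hI
      have hcore := smooth_core N _ hi.neg bad hbadm hb4
        (N.real (rect (fun i => a i + 2 * δ) (fun i => b i - 2 * δ)) - Q.real (rect a b)) γ ε hγ0 hε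
        (by
          intro z hz
          have hz' := hgood z hz
          have s1 : Q.real (rect (fun i => a i + δ - T * z i) (fun i => b i - δ - T * z i)) ≤
              Q.real (rect a b) := by
            refine mr_mono Q fun x hx j => ?_
            have h1 := hx j
            have h2 := abs_le.1 (hz' j)
            constructor <;> linarith [h1.1, h1.2, h2.1, h2.2]
          have s2 : N.real (rect (fun i => a i + 2 * δ) (fun i => b i - 2 * δ)) ≤
              N.real (rect (fun i => a i + δ - T * z i) (fun i => b i - δ - T * z i)) := by
            refine mr_mono N fun x hx j => ?_
            have h1 := hx j
            have h2 := abs_le.1 (hz' j)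
            constructor <;> linarith [h1.1, h1.2, h2.1, h2.2]
          simp only [Pi.neg_apply]
          linarith)
        (by
          intro z
          have := abs_le.1 (hGγ (fun i => a i + δ - T * z i) (fun i => b i - δ - T * z i))
          simp only [Pi.neg_apply]
          linarith [this.2])
        (by
          simp only [Pi.neg_apply]
          rw [integral_neg]
          linarith [(abs_le.1 hI).1])
      have hnz := naz_rect hd S hS σl hσl hl L hL1 hL (fun i => a i + 2 * δ) (fun i => b i - 2 * δ)
        (2 * δ) (by positivity)
      simp only [add_sub_cancel_right, sub_add_cancel] at hnz
      rw [← hN] at hnz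
      linarith
    · obtain ⟨hi, hI⟩ := smooth_int S hS P W hW c u ε hc hcu hεb (fun i => a i - δ) (fun i => b i + δ)
      rw [← hT, ← hN, ← hQ] at hi hI
      have hcore := smooth_core N _ hi bad hbadm hb4
        (Q.real (rect a b) - N.real (rect (fun i => a i - 2 * δ) (fun i => b i + 2 * δ))) γ ε hγ0 hε
        (by
          intro z hz
          have hz' := hgood z hz
          have s1 : Q.real (rect a b) ≤
              Q.real (rect (fun i => a i - δ - T * z i) (fun i => b i + δ - T * z i)) := by
            refine mr_mono Q fun x hx j => ?_
            have h1 := hx j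
            have h2 := abs_le.1 (hz' j)
            constructor <;> linarith [h1.1, h1.2, h2.1, h2.2]
          have s2 : N.real (rect (fun i => a i - δ - T * z i) (fun i => b i + δ - T * z i)) ≤
              N.real (rect (fun i => a i - 2 * δ) (fun i => b i + 2 * δ)) := by
            refine mr_mono N fun x hx j => ?_
            have h1 := hx j
            have h2 := abs_le.1 (hz' j)
            constructor <;> linarith [h1.1, h1.2, h2.1, h2.2]
          linarith)
        (by
          intro z
          have := abs_le.1 (hGγ (fun i => a i - δ - T * z i) (fun i => b i + δ - T * z i))
          linarith [this.1])
        (abs_le.1 hI).2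
      have hnz := naz_rect hd S hS σl hσl hl L hL1 hL a b (2 * δ) (by positivity)
      rw [← hN] at hnz
      linarith
  have hγle : γ ≤ 58 * (2 * δ / σl * L) + (4 / 3 * ε + γ / 3) :=
    ciSup_le fun p => main p.1 p.2
  refine (hGγ a b).trans ?_
  have e : 58 * (2 * δ / σl * L) = 348 * (T * (σb / σl) * L ^ 2) := by
    rw [hδ, hr]; field_simp; ring
  rw [e] at hγle
  linarith


lemma hyper_reduce {d : ℕ} (Q N : Measure (Fin d → ℝ)) [IsProbabilityMeasure Q]
    [IsProbabilityMeasure N] (B : ℝ) (hB : 0 ≤ B)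
    (h : ∀ a b : Fin d → ℝ, |Q.real (rect a b) - N.real (rect a b)| ≤ B)
    (A : Set (Fin d → ℝ)) (hA : IsHyperrectangle A) :
    MeasurableSet A ∧ |Q.real A - N.real A| ≤ B := by
  obtain ⟨a, b, hAe⟩ := hA
  rcases Set.eq_empty_or_nonempty A with he | ⟨x0, hx0⟩
  · rw [he]
    exact ⟨MeasurableSet.empty, by simpa using hB⟩
  rw [hAe] at hx0
  have ha : ∀ j, a j ≠ ⊤ := fun j => ((hx0 j).1.trans_le le_top).ne
  have hb : ∀ j, b j ≠ ⊥ := fun j => (bot_le.trans_lt (hx0 j).2).ne'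
  let an : ℕ → Fin d → ℝ := fun n j => if a j = ⊥ then -(n : ℝ) else (a j).toReal
  let bn : ℕ → Fin d → ℝ := fun n j => if b j = ⊤ then (n : ℝ) else (b j).toReal
  have hanm : ∀ n m, n ≤ m → ∀ j, an m j ≤ an n j := by
    intro n m hnm j
    simp only [an]
    split_ifs
    · exact neg_le_neg (by exact_mod_cast hnm)
    · exact le_rfl
  have hbnm : ∀ n m, n ≤ m → ∀ j, bn n j ≤ bn m j := by
    intro n m hnm j
    simp only [bn]
    split_ifs
    · exact_mod_cast hnm
    · exact le_rfl
  have hmono : Monotone fun n => rect (an n) (bn n) := by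
    intro n m hnm x hx j
    exact ⟨(hanm n m hnm j).trans_lt (hx j).1, (hx j).2.trans_le (hbnm n m hnm j)⟩
  have hU : A = ⋃ n, rect (an n) (bn n) := by
    rw [hAe]
    ext x
    simp only [Set.mem_iUnion]
    constructor
    · intro hx
      obtain ⟨n, hn⟩ := exists_nat_gt ‖x‖
      refine ⟨n, fun j => ?_⟩
      have hxj : |x j| < n := (norm_le_pi_norm x j).trans_lt hn
      rw [abs_lt] at hxj
      obtain ⟨h1, h2⟩ := hx j
      constructor
      · simp only [an]
        split_ifs with h0
        · exact hxj.1
        · rw [← EReal.coe_toReal (ha j) h0] at h1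
          exact_mod_cast h1
      · simp only [bn]
        split_ifs with h0
        · exact hxj.2
        · rw [← EReal.coe_toReal h0 (hb j)] at h2
          exact_mod_cast h2
    · rintro ⟨n, hn⟩ j
      obtain ⟨h1, h2⟩ := hn j
      constructor
      · simp only [an] at h1
        split_ifs at h1 with h0
        · rw [h0]; exact EReal.bot_lt_coe _
        · rw [← EReal.coe_toReal (ha j) h0]
          exact_mod_cast h1
      · simp only [bn] at h2
        split_ifs at h2 with h0
        · rw [h0]; exact EReal.coe_lt_top _
        · rw [← EReal.coe_toReal h0 (hb j)]
          exact_mod_cast h2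
  have hm : MeasurableSet A := by
    rw [hU]
    exact MeasurableSet.iUnion fun n => rect_meas _ _
  refine ⟨hm, ?_⟩
  have tq : ∀ M : Measure (Fin d → ℝ), IsProbabilityMeasure M →
      Filter.Tendsto (fun n => M.real (rect (an n) (bn n))) Filter.atTop (nhds (M.real A)) := by
    intro M hM
    rw [hU]
    exact (ENNReal.tendsto_toReal (measure_ne_top _ _)).comp (tendsto_measure_iUnion_atTop hmono)
  exact le_of_tendsto ((tq Q inferInstance).sub (tq N inferInstance)).abs
    (Filter.Eventually.of_forall fun n => h _ _)

set_option maxHeartbeats 1000000 in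
/-- **Theorem 2 (Error bound using exchangeable pairs).** -/
theorem exchangeable_pair_bound :
    ∃ C : ℝ, 0 < C ∧
      ∀ (d : ℕ), 3 ≤ d →
      ∀ (Ω : Type) (_ : MeasurableSpace Ω) (P : Measure Ω) (_ : IsProbabilityMeasure P)
        (W W' : Ω → Fin d → ℝ), Measurable W → Measurable W' →
        (∀ j, Integrable (fun ω => W ω j) P) → (∀ j, ∫ ω, W ω j ∂P = 0) →
        -- exchangeability
        Measure.map (fun ω => (W ω, W' ω)) P = Measure.map (fun ω => (W' ω, W ω)) P →
      ∀ (Λ : Matrix (Fin d) (Fin d) ℝ), Λ.det ≠ 0 →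
      ∀ R : Ω → Fin d → ℝ,
        -- linearity condition `E(W' - W | W) = -Λ(W + R)`
        (P[fun ω => W' ω - W ω | MeasurableSpace.comap W inferInstance]
          =ᵐ[P] fun ω => -Λ.mulVec (W ω + R ω)) →
      ∀ D : Ω → Fin d → ℝ, D = (fun ω => W' ω - W ω) →
        Integrable (fun ω => ‖D ω‖ ^ 4) P →
      ∀ S : Matrix (Fin d) (Fin d) ℝ, S.PosDef →
      ∀ σbar σlow σs : ℝ, 0 < σbar → 0 < σlow → 0 < σs →
        IsGreatest (Set.range fun j => S j j) (σbar ^ 2) →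
        IsLeast (Set.range fun j => S j j) (σlow ^ 2) →
        IsSmallestEigenvalueSq S σs →
      ∀ Δ₁ : ℝ, Δ₁ = ∫ ω, ⨆ j, ⨆ k,
          |S j k - (1 / 2) *
            (P[fun ω' => Λ⁻¹.mulVec (D ω') j * D ω' k |
                MeasurableSpace.comap W inferInstance]) ω| ∂P →
      ∀ Δ₂ : ℝ, Δ₂ = ∫ ω, ⨆ j, ⨆ k, ⨆ l, ⨆ m,
          (P[fun ω' => |Λ⁻¹.mulVec (D ω') j * D ω' k * D ω' l * D ω' m| |
              MeasurableSpace.comap W inferInstance]) ω ∂P →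
      ∀ η : ℝ, 0 ≤ η →
      ∀ Δ₃ : ℝ, Δ₃ = ∫ ω in {ω | η < ‖D ω‖}, ⨆ j, ⨆ k, ⨆ l, ⨆ m,
          |Λ⁻¹.mulVec (D ω) j * D ω k * D ω l * D ω m| ∂P →
      ∀ t : ℝ, 0 < t → η / Real.sqrt t ≤ σs / Real.sqrt (Real.log d) →
      ∀ A : Set (Fin d → ℝ), IsHyperrectangle A →
        |(P (W ⁻¹' A)).toReal - (gaussianMeasure d S A).toReal| ≤
          C * ((1 / σs) * (∫ ω, ⨆ j, |R ω j| ∂P) * Real.sqrt (Real.log d)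
            + (1 / σs ^ 2) * Δ₁ * (|Real.log t| ⊔ 1) * Real.log d
            + (1 / σs ^ 4) * (Δ₂ + Δ₃) * (Real.log d) ^ 2 / t
            + (σbar / σlow) * Real.sqrt t * Real.log d) := by
  refine ⟨64 * K2 + 1045, by linarith [K2_pos], ?_⟩
  intro d hd Ω _ P _ W W' hW hW' hWi _ hex Λ hΛ R hR D hD hD4 S hS σb σl σ hσb hσl hσ hgb hll hσS
    Δ₁ hΔ₁ Δ₂ hΔ₂ η hη0 Δ₃ hΔ₃ t ht hηt A hA
  have hK := K2_pos
  have hN := gm_prob S hS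
  have hQ : IsProbabilityMeasure (P.map W) := Measure.isProbabilityMeasure_map hW.aemeasurable
  have hlog : 1 ≤ Real.log d := log3_ge.trans
    (Real.log_le_log (by norm_num) (by exact_mod_cast hd))
  set L := √(Real.log d) with hLd
  have hL : L ^ 2 = Real.log d := Real.sq_sqrt (by linarith)
  have hL1 : 1 ≤ L := Real.one_le_sqrt.2 hlog
  have hL0 : 0 < L := by linarith
  have hb : ∀ j, S j j ≤ σb ^ 2 := fun j => hgb.2 ⟨j, rfl⟩
  have hl : ∀ j, σl ^ 2 ≤ S j j := fun j => hll.2 ⟨j, rfl⟩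
  have hlb : σl ≤ σb := by
    have := (hl ⟨0, by omega⟩).trans (hb ⟨0, by omega⟩)
    exact (sq_le_sq₀ hσl.le hσb.le).1 this
  have hrat : 1 ≤ σb / σl := (one_le_div hσl).2 hlb
  set r1 := ∫ ω, ⨆ j, |R ω j| ∂P with hr1
  have h1 : 0 ≤ r1 := integral_nonneg fun ω => Real.iSup_nonneg fun j => abs_nonneg _
  have h2 : 0 ≤ Δ₁ := by
    rw [hΔ₁]
    exact integral_nonneg fun ω => Real.iSup_nonneg fun j => Real.iSup_nonneg fun k => abs_nonneg _
  have h3a : 0 ≤ Δ₂ := by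
    rw [hΔ₂]
    refine integral_nonneg_of_ae ?_
    have : ∀ᵐ ω ∂P, ∀ j k l m, 0 ≤
        (P[fun ω' => |Λ⁻¹.mulVec (D ω') j * D ω' k * D ω' l * D ω' m| |
              MeasurableSpace.comap W inferInstance]) ω := by
      simp only [MeasureTheory.ae_all_iff]
      intro j k l m
      exact condExp_nonneg (Filter.Eventually.of_forall fun ω => abs_nonneg _)
    filter_upwards [this] with ω h
    exact Real.iSup_nonneg fun j => Real.iSup_nonneg fun k => Real.iSup_nonneg fun l =>
      Real.iSup_nonneg fun m => h j k l m
  have h3b : 0 ≤ Δ₃ := by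
    rw [hΔ₃]
    exact integral_nonneg fun ω => Real.iSup_nonneg fun j => Real.iSup_nonneg fun k =>
      Real.iSup_nonneg fun l => Real.iSup_nonneg fun m => abs_nonneg _
  have hst : 0 < √t := Real.sqrt_pos.2 ht
  set M := |Real.log t| ⊔ 1 with hM
  have hM1 : 1 ≤ M := le_max_right _ _
  have hMl : |Real.log t| ≤ M := le_max_left _ _
  have e1 : 1 / σ * r1 * L = (L / σ) * r1 := by ring
  have e2 : 1 / σ ^ 2 * Δ₁ * M * Real.log d = (L / σ) ^ 2 * Δ₁ * M := by rw [← hL]; ring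
  have e3 : 1 / σ ^ 4 * (Δ₂ + Δ₃) * (Real.log d) ^ 2 / t = (L / σ) ^ 4 * (Δ₂ + Δ₃) / t := by
    rw [← hL]; ring
  rw [e1, e2, e3]
  set T1 := (L / σ) * r1 with hT1
  set T2 := (L / σ) ^ 2 * Δ₁ * M with hT2
  set T3 := (L / σ) ^ 4 * (Δ₂ + Δ₃) / t with hT3
  set T4 := (σb / σl) * √t * Real.log d with hT4
  have p1 : 0 ≤ T1 := by positivity
  have p2 : 0 ≤ T2 := by positivity
  have p3 : 0 ≤ T3 := by positivity
  have p4 : 0 ≤ T4 := by positivity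
  have key : ∀ a b : Fin d → ℝ, |(P.map W).real (rect a b) - (gaussianMeasure d S).real (rect a b)| ≤
      (64 * K2 + 1045) * (T1 + T2 + T3 + T4) := by
    intro a b
    rcases le_or_gt 1 T4 with h4 | h4
    · have q1 : (P.map W).real (rect a b) ≤ 1 := measureReal_le_one
      have q2 : (gaussianMeasure d S).real (rect a b) ≤ 1 := measureReal_le_one
      have q3 : 0 ≤ (P.map W).real (rect a b) := measureReal_nonneg
      have q4 : 0 ≤ (gaussianMeasure d S).real (rect a b) := measureReal_nonneg
      have q5 : (1 : ℝ) ≤ (64 * K2 + 1045) * (T1 + T2 + T3 + T4) :=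
        one_le_mul_of_one_le_of_one_le (by linarith) (by linarith)
      exact abs_le.2 ⟨by linarith, by linarith⟩
    have hst1 : √t < 1 := by
      have : 1 * √t * 1 ≤ T4 := by rw [hT4]; gcongr
      linarith
    have hπ := Real.pi_gt_three
    have hθ1 : √t ≤ π / 2 := by linarith
    have hcos : 1 / 2 ≤ Real.cos √t := by
      have := Real.one_sub_sq_div_two_le_cos (x := √t)
      have h5 : √t ^ 2 ≤ 1 := pow_le_one₀ hst.le hst1.le
      linarith
    have hsin0 : 0 ≤ Real.sin √t := Real.sin_nonneg_of_nonneg_of_le_pi hst.le (by linarith)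
    have hsin1 : Real.sin √t ≤ √t := Real.sin_le hst.le
    have hη' : η ≤ √t * (σ / L) := by
      rw [div_le_iff₀ hst] at hηt
      linarith
    have hlogθ : 1 - Real.log √t ≤ 2 * M := by
      rw [Real.log_sqrt ht.le]
      have := neg_abs_le (Real.log t)
      linarith
    set ε := 32 * K2 * (T1 + T2 + T3) with hε
    have hε0 : 0 ≤ ε := by positivity
    have hεb : ∀ a b : Fin d → ℝ, |(gaussianMeasure d S).real (rect a b) -
        ∫ ω, (gaussianMeasure d S).real
          {z | (fun i => Real.cos √t * W ω i + Real.sin √t * z i) ∈ rect a b} ∂P| ≤ ε := by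
      intro a b
      by_cases hab : ∀ i, a i ≤ b i
      · refine (eps_bound P W W' hW hW' hWi hex Λ hΛ R hR D hD hD4 S hS η hd L hL1 hL a b hab σ hσ
          hσS r1 Δ₁ (Δ₂ + Δ₃) hr1 hΔ₁ (by rw [hΔ₂, hΔ₃]) h1 h2 (by linarith) √t hst hθ1 hη').trans ?_
        rw [Real.sq_sqrt ht.le, ← hT1, ← hT3]
        have : (L / σ) ^ 2 * Δ₁ * (1 - Real.log √t) ≤ 2 * T2 := by
          calc _ ≤ (L / σ) ^ 2 * Δ₁ * (2 * M) := by gcongr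
            _ = 2 * T2 := by rw [hT2]; ring
        rw [hε]
        calc 16 * K2 * (T1 + (L / σ) ^ 2 * Δ₁ * (1 - Real.log √t) + T3)
            ≤ 16 * K2 * (2 * (T1 + T2 + T3)) := by gcongr; linarith
          _ = _ := by ring
      · push Not at hab
        obtain ⟨i, hi⟩ := hab
        have hem : rect a b = ∅ := by
          ext x
          simp only [Set.mem_empty_iff_false, iff_false]
          intro hx
          have := hx i
          linarith [this.1, this.2]
        simp only [hem, Set.mem_empty_iff_false]
        simpa using hε0
    refine (smoothing hd S hS σb σl hσb hσl hb hl L hL1 hL P W hW (Real.cos √t) (Real.sin √t) ε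
      (by linarith) hsin0 (by linarith [Real.sin_sq_add_cos_sq √t]) hε0 hεb a b).trans ?_
    have huc : Real.sin √t / Real.cos √t ≤ 2 * √t := by
      rw [div_le_iff₀ (by linarith)]
      have := mul_le_mul_of_nonneg_left hcos hst.le
      linarith
    have : 522 * (Real.sin √t / Real.cos √t) * (σb / σl) * L ^ 2 ≤ 1044 * T4 := by
      rw [hL, hT4]
      calc _ ≤ 522 * (2 * √t) * (σb / σl) * Real.log d := by gcongr
        _ = _ := by ring
    rw [hε]
    have q := mul_nonneg hK.le p4
    have q' : (64 * K2 + 1045) * (T1 + T2 + T3 + T4) = 2 * (32 * K2 * (T1 + T2 + T3)) + 1044 * T4 +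
      (64 * (K2 * T4) + 1045 * (T1 + T2 + T3) + T4) := by ring
    rw [q']
    linarith
  have hfin := hyper_reduce (P.map W) (gaussianMeasure d S) _ (by positivity) key A hA
  have hmap : (P (W ⁻¹' A)).toReal = (P.map W).real A := by
    rw [Measure.real, Measure.map_apply hW hfin.1]
  rw [hmap]
  exact hfin.2
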